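/- arXiv:1210.4391 — 3 statements merged into one kernel-verified Lean document; each statement's English description precedes it below -/
import Mathlib

section
/- Fix b ∈ (0, ∞], indices 1 < p ≤ q < ∞, and weights u, v on I_b = (0, b). Then the least constant C > 0 in the inequality (∫₀ᵇ (u(t)·(Qf)(t))^q dt)^{1/q} ≤ C (∫₀ᵇ (v(t) f(t))^p dt)^{1/p}, required to hold for all f ∈ M₊(I_b), is equivalent (up to multiplicative constants depending only on p and q) to sup_{0<r<b} (∫₀ʳ u(t)^q dt)^{1/q} (∫ᵣᵇ (t v(t))^{-p'} dt)^{1/p'}; in particular, the inequality holds with some finite C if and only if this supremum is finite. -/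
open MeasureTheory Set ENNReal Filter

noncomputable section

/-- The interval `I_b = (0, b)` for `b ∈ (0, ∞]`, as a subset of `ℝ`. -/
def IbSet (b : ℝ≥0∞) : Set ℝ := {t : ℝ | 0 < t ∧ ENNReal.ofReal t < b}

/-- `∫₀ᵗ φ`. -/
def intPhi (φ : ℝ → ℝ≥0∞) (t : ℝ) : ℝ≥0∞ := ∫⁻ s in Ioo (0 : ℝ) t, φ s

/-- `∫ₜᵇ φ(s) s^(-p) ds`. -/
def tailP (b : ℝ≥0∞) (p : ℝ) (φ : ℝ → ℝ≥0∞) (t : ℝ) : ℝ≥0∞ :=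
  ∫⁻ s in {s : ℝ | t < s ∧ ENNReal.ofReal s < b}, φ s * ENNReal.ofReal (s ^ (-p))

/-- `∫₀ᵗ φ + tᵖ ∫ₜᵇ φ(s) s^(-p) ds`. -/
def DPhi (b : ℝ≥0∞) (p : ℝ) (φ : ℝ → ℝ≥0∞) (t : ℝ) : ℝ≥0∞ :=
  intPhi φ t + ENNReal.ofReal (t ^ p) * tailP b p φ t

/-- The Hardy averaging operator `P`. -/
def Pavg (g : ℝ → ℝ≥0∞) (t : ℝ) : ℝ≥0∞ := (ENNReal.ofReal t)⁻¹ * ∫⁻ s in Ioo (0 : ℝ) t, g s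

/-- The dual Hardy operator `Q`, `(Qg)(t) = ∫ₜᵇ g(s) s⁻¹ ds`. -/
def Qavg (b : ℝ≥0∞) (g : ℝ → ℝ≥0∞) (t : ℝ) : ℝ≥0∞ :=
  ∫⁻ s in {s : ℝ | t < s ∧ ENNReal.ofReal s < b}, g s * (ENNReal.ofReal s)⁻¹

/-- The operator `Q_p`, `(Q_p g)(t) = p t^(p-1) ∫ₜᵇ g(s) s^(-p) ds`. -/
def Qp (b : ℝ≥0∞) (p : ℝ) (g : ℝ → ℝ≥0∞) (t : ℝ) : ℝ≥0∞ :=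
  ENNReal.ofReal (p * t ^ (p - 1)) *
    ∫⁻ s in {s : ℝ | t < s ∧ ENNReal.ofReal s < b}, g s * ENNReal.ofReal (s ^ (-p))

/-- `(PQ_p)(φ)(t) = t⁻¹ [∫₀ᵗ φ + tᵖ ∫ₜᵇ φ(s) s^(-p) ds]`. -/
def PQp (b : ℝ≥0∞) (p : ℝ) (φ : ℝ → ℝ≥0∞) (t : ℝ) : ℝ≥0∞ :=
  (ENNReal.ofReal t)⁻¹ * DPhi b p φ t

/-- A weight on `I_b`: a positive, finite, locally integrable function. -/
def IsWeight (b : ℝ≥0∞) (φ : ℝ → ℝ≥0∞) : Prop :=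
  Measurable φ ∧ (∀ t ∈ IbSet b, 0 < φ t ∧ φ t < ⊤) ∧
    ∀ a c : ℝ, 0 < a → ENNReal.ofReal c < b → ∫⁻ t in Icc a c, φ t < ⊤

/-- A non-trivial weight on `I_b` for the index `p`. -/
def IsNontrivialWeight (b : ℝ≥0∞) (p : ℝ) (φ : ℝ → ℝ≥0∞) : Prop :=
  IsWeight b φ ∧
    (b = ⊤ → ∫⁻ t in Ioi (1 : ℝ), φ t * ENNReal.ofReal (t ^ (-p)) < ⊤) ∧
    tailP b p φ 0 = ⊤

/-- The dual weight `ψ(t) = t^(p+p'-1) (∫₀ᵗ φ)(∫ₜᵇ φ(s)s^(-p) ds)/D(t)^(p'+1)`. -/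
def dualWeight (b : ℝ≥0∞) (p : ℝ) (φ : ℝ → ℝ≥0∞) (t : ℝ) : ℝ≥0∞ :=
  ENNReal.ofReal (t ^ (p + p / (p - 1) - 1)) * intPhi φ t * tailP b p φ t /
    (DPhi b p φ t) ^ (p / (p - 1) + 1)

/-- `ψ = (Pφ)(Q_pφ)/[(PQ_p)(φ)]^(p'+1)`. -/
def dualWeight' (b : ℝ≥0∞) (p : ℝ) (φ : ℝ → ℝ≥0∞) (t : ℝ) : ℝ≥0∞ :=
  Pavg φ t * Qp b p φ t / (PQp b p φ t) ^ (p / (p - 1) + 1)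

/-- The decreasing rearrangement `f*`. -/
def decRearr {α : Type*} [MeasurableSpace α] (μ : Measure α) (f : α → ℝ) (t : ℝ) : ℝ≥0∞ :=
  sInf {l : ℝ≥0∞ | μ {x | l < (‖f x‖₊ : ℝ≥0∞)} ≤ ENNReal.ofReal t}

/-- `f**(t) = t⁻¹ ∫₀ᵗ f*`. -/
def avgRearr {α : Type*} [MeasurableSpace α] (μ : Measure α) (f : α → ℝ) (t : ℝ) : ℝ≥0∞ :=
  (ENNReal.ofReal t)⁻¹ * ∫⁻ s in Ioo (0 : ℝ) t, decRearr μ f s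

/-- The Lorentz Gamma functional `ρ_{p,φ}(f) = (∫_{I_b} f**(t)^p φ(t) dt)^(1/p)`. -/
def rhoGamma {α : Type*} [MeasurableSpace α] (μ : Measure α) (b : ℝ≥0∞) (p : ℝ)
    (φ : ℝ → ℝ≥0∞) (f : α → ℝ) : ℝ≥0∞ :=
  (∫⁻ t in IbSet b, (avgRearr μ f t) ^ p * φ t) ^ (1 / p)

/-- The Stieltjes operator `(Sg)(t) = ∫₀^∞ g(s)/(s+t) ds`. -/
def Sop (g : ℝ → ℝ≥0∞) (t : ℝ) : ℝ≥0∞ :=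
  ∫⁻ s in Ioi (0 : ℝ), g s / ENNReal.ofReal (s + t)

/-- Lebesgue measure on `(0,∞)`. -/
def mu0 : Measure ℝ := volume.restrict (Ioi (0 : ℝ))

/-- The Muckenhoupt-type constant for the dual Hardy operator `Q`. -/
def HardyConstQ (b : ℝ≥0∞) (p q : ℝ) (u v : ℝ → ℝ≥0∞) : ℝ≥0∞ :=
  ⨆ (r : ℝ) (_ : r ∈ IbSet b),
    (∫⁻ t in Ioo (0 : ℝ) r, (u t) ^ q) ^ (1 / q) *
      (∫⁻ t in {t : ℝ | r < t ∧ ENNReal.ofReal t < b},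
        (ENNReal.ofReal t * v t) ^ (-(p / (p - 1)))) ^ (1 / (p / (p - 1)))

theorem aux_Iio (μ : Measure ℝ) [NullSingletonClass μ] (E : Set ℝ) (c : ℝ≥0∞)
    (h : ∀ t ∈ E, μ (Iio t) ≤ c) : μ E ≤ c := by
  by_cases hm : ∃ m ∈ E, ∀ t ∈ E, t ≤ m
  · obtain ⟨m, hm, hmax⟩ := hm
    calc μ E ≤ μ (Iic m) := measure_mono fun t ht => hmax t ht
      _ = μ (Iio m) := (measure_congr Iio_ae_eq_Iic).symm
      _ ≤ c := h m hm
  · push Not at hm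
    obtain ⟨T, hTE, hTc, hT⟩ := TopologicalSpace.isOpen_biUnion_countable E (fun t : ℝ => Iio t)
      (fun _ _ => isOpen_Iio)
    calc μ E ≤ μ (⋃ t ∈ T, Iio t) := by
          rw [hT]
          refine measure_mono fun t ht => ?_
          obtain ⟨s, hs, hts⟩ := hm t ht
          exact mem_biUnion hs hts
      _ = ⨆ t ∈ T, μ (Iio t) := by
          refine measure_biUnion_eq_iSup hTc ?_
          intro x hx y hy
          rcases le_total x y with hxy | hxy
          · exact ⟨y, hy, Iio_subset_Iio hxy, subset_rfl⟩
          · exact ⟨x, hx, subset_rfl, Iio_subset_Iio hxy⟩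
      _ ≤ c := iSup₂_le fun t ht => h t (hTE ht)

theorem aux_Ioi (μ : Measure ℝ) [NullSingletonClass μ] (E : Set ℝ) (c : ℝ≥0∞)
    (h : ∀ t ∈ E, μ (Ioi t) ≤ c) : μ E ≤ c := by
  by_cases hm : ∃ m ∈ E, ∀ t ∈ E, m ≤ t
  · obtain ⟨m, hm, hmax⟩ := hm
    calc μ E ≤ μ (Ici m) := measure_mono fun t ht => hmax t ht
      _ = μ (Ioi m) := (measure_congr Ioi_ae_eq_Ici).symm
      _ ≤ c := h m hm
  · push Not at hm
    obtain ⟨T, hTE, hTc, hT⟩ := TopologicalSpace.isOpen_biUnion_countable E (fun t : ℝ => Ioi t)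
      (fun _ _ => isOpen_Ioi)
    calc μ E ≤ μ (⋃ t ∈ T, Ioi t) := by
          rw [hT]
          refine measure_mono fun t ht => ?_
          obtain ⟨s, hs, hts⟩ := hm t ht
          exact mem_biUnion hs hts
      _ = ⨆ t ∈ T, μ (Ioi t) := by
          refine measure_biUnion_eq_iSup hTc ?_
          intro x hx y hy
          rcases le_total x y with hxy | hxy
          · exact ⟨x, hx, subset_rfl, Ioi_subset_Ioi hxy⟩
          · exact ⟨y, hy, Ioi_subset_Ioi hxy, subset_rfl⟩
      _ ≤ c := iSup₂_le fun t ht => h t (hTE ht)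

theorem aux_lint_Iio (μ : Measure ℝ) [NullSingletonClass μ] (g : ℝ → ℝ≥0∞) (E : Set ℝ)
    (hE : MeasurableSet E) (c : ℝ≥0∞)
    (h : ∀ t ∈ E, ∫⁻ s in Iio t, g s ∂μ ≤ c) : ∫⁻ s in E, g s ∂μ ≤ c := by
  rw [← withDensity_apply _ hE]
  refine aux_Iio _ E c fun t ht => ?_
  rw [withDensity_apply _ measurableSet_Iio]
  exact h t ht

theorem aux_lint_Ioi (μ : Measure ℝ) [NullSingletonClass μ] (g : ℝ → ℝ≥0∞) (E : Set ℝ)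
    (hE : MeasurableSet E) (c : ℝ≥0∞)
    (h : ∀ t ∈ E, ∫⁻ s in Ioi t, g s ∂μ ≤ c) : ∫⁻ s in E, g s ∂μ ≤ c := by
  rw [← withDensity_apply _ hE]
  refine aux_Ioi _ E c fun t ht => ?_
  rw [withDensity_apply _ measurableSet_Ioi]
  exact h t ht

theorem aux_tsum_rpow (a : ℤ → ℝ≥0∞) (x : ℝ) (hx : 1 ≤ x) :
    ∑' k, (a k) ^ x ≤ (∑' k, a k) ^ x := by
  have e : ∀ y : ℝ≥0∞, y ^ x = y * y ^ (x - 1) := fun y => by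
    conv_rhs => rw [← ENNReal.rpow_one y, ← ENNReal.rpow_mul, one_mul]
    rw [← ENNReal.rpow_add_of_nonneg _ _ zero_le_one (by linarith)]
    ring_nf
  rw [e (∑' k, a k), ← ENNReal.tsum_mul_right]
  refine ENNReal.tsum_le_tsum fun k => ?_
  rw [e]
  exact mul_le_mul_right (ENNReal.rpow_le_rpow (ENNReal.le_tsum k) (by linarith)) _

theorem aux_holder (μ : Measure ℝ) (p : ℝ) (hp : 1 < p) (w g : ℝ → ℝ≥0∞)
    (hw : Measurable w) (hg : Measurable g)
    (hw0 : ∀ᵐ t ∂μ, w t ≠ 0 ∧ w t ≠ ⊤) :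
    ∫⁻ s, g s ∂μ ≤ (∫⁻ s, (w s * g s) ^ p ∂μ) ^ (1 / p) *
      (∫⁻ s, (w s) ^ (-(p / (p - 1))) ∂μ) ^ (1 / (p / (p - 1))) := by
  have hpq : p.HolderConjugate (p / (p - 1)) := Real.HolderConjugate.conjExponent hp
  have := ENNReal.lintegral_mul_le_Lp_mul_Lq μ hpq (f := fun s => w s * g s)
    (g := fun s => (w s)⁻¹) (hw.mul hg).aemeasurable hw.inv.aemeasurable
  have e1 : ∫⁻ s, g s ∂μ = ∫⁻ s, ((fun s => w s * g s) * fun s => (w s)⁻¹) s ∂μ := by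
    refine lintegral_congr_ae ?_
    filter_upwards [hw0] with s hs
    simp only [Pi.mul_apply]
    rw [mul_comm (w s), mul_assoc, ENNReal.mul_inv_cancel hs.1 hs.2, mul_one]
  rw [e1]
  simpa only [ENNReal.inv_rpow, ENNReal.rpow_neg] using this

theorem aux_upper (μ : Measure ℝ) [NullSingletonClass μ] (I : Set ℝ) (hI : MeasurableSet I)
    (hμ : ∀ᵐ t ∂μ, t ∈ I) (p q : ℝ) (hp : 1 < p) (hpq : p ≤ q) (u w g : ℝ → ℝ≥0∞)
    (hw : Measurable w) (hg : Measurable g)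
    (hw0 : ∀ t ∈ I, w t ≠ 0 ∧ w t ≠ ⊤) (A : ℝ≥0∞)
    (hA : ∀ r ∈ I, (∫⁻ t in Iio r, (u t) ^ q ∂μ) ^ (1 / q) *
      (∫⁻ t in Ioi r, (w t) ^ (-(p / (p - 1))) ∂μ) ^ (1 / (p / (p - 1))) ≤ A)
    (hV : ∀ r ∈ I, ∫⁻ t in Ioi r, (w t) ^ (-(p / (p - 1))) ∂μ ≠ ⊤)
    (hN : ∫⁻ t, (w t * g t) ^ p ∂μ ≠ ⊤) :
    (∫⁻ t, (u t * ∫⁻ s in Ioi t, g s ∂μ) ^ q ∂μ) ^ (1 / q) ≤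
      8 * A * (∫⁻ t, (w t * g t) ^ p ∂μ) ^ (1 / p) := by
  have hp0 : 0 < p := by linarith
  have hq0 : 0 < q := by linarith
  have hp'0 : 0 < p / (p - 1) := div_pos hp0 (by linarith)
  set N := ∫⁻ t, (w t * g t) ^ p ∂μ with hNdef
  set F : ℝ → ℝ≥0∞ := fun t => ∫⁻ s in Ioi t, g s ∂μ with hF
  have hFanti : Antitone F := fun s t hst => lintegral_mono_set (Ioi_subset_Ioi hst)
  have hFm : Measurable F := hFanti.measurable
  have hwae : ∀ᵐ t ∂μ, w t ≠ 0 ∧ w t ≠ ⊤ := hμ.mono fun t ht => hw0 t ht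
  have hFfin : ∀ t ∈ I, F t ≠ ⊤ := by
    intro t ht
    have h1 := aux_holder (μ.restrict (Ioi t)) p hp w g hw hg (ae_restrict_of_ae hwae)
    refine ne_top_of_le_ne_top ?_ h1
    refine ENNReal.mul_ne_top ?_ ?_
    · refine ENNReal.rpow_ne_top_of_nonneg (by positivity) ?_
      exact ne_top_of_le_ne_top hN (setLIntegral_le_lintegral _ _)
    · exact ENNReal.rpow_ne_top_of_nonneg (by positivity) (hV t ht)
  set E : ℤ → Set ℝ := fun k => F ⁻¹' (Ioc (2 ^ k) (2 ^ (k + 1))) ∩ I with hE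
  have hEm : ∀ k, MeasurableSet (E k) := fun k => (hFm measurableSet_Ioc).inter hI
  set a : ℤ → ℝ≥0∞ := fun k => ∫⁻ t in E k, (w t * g t) ^ p ∂μ with ha
  have two_zpow : ∀ k : ℤ, (2 : ℝ≥0∞) ^ (k + 1) = 2 * 2 ^ k := fun k => by
    rw [ENNReal.zpow_add (by norm_num) (by norm_num), zpow_one, mul_comm]
  have hmono : ∀ {j k : ℤ}, j ≤ k → (2 : ℝ≥0∞) ^ j ≤ 2 ^ k := fun h =>
    ENNReal.zpow_le_of_le (by norm_num) h
  have hdisj : Pairwise (Function.onFun Disjoint E) := by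
    have key : ∀ j k : ℤ, j < k → Disjoint (E j) (E k) := by
      intro j k hjk
      rw [Set.disjoint_left]
      rintro t ⟨⟨_, h1⟩, _⟩ ⟨⟨h2, _⟩, _⟩
      exact absurd (h2.trans_le h1) (not_lt.mpr (hmono (by omega)))
    intro j k hjk
    rcases lt_or_gt_of_ne hjk with h | h
    · exact key j k h
    · exact (key k j h).symm
  have hsum : ∑' k, a k ≤ N := by
    rw [ha, ← lintegral_iUnion hEm hdisj]
    exact setLIntegral_le_lintegral _ _
  -- the lower level estimate
  have hlow : ∀ k, ∀ t ∈ E (k + 1), (2 : ℝ≥0∞) ^ k ≤ (a k + a (k + 1)) ^ (1 / p) *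
      (∫⁻ s in Ioi t, (w s) ^ (-(p / (p - 1))) ∂μ) ^ (1 / (p / (p - 1))) := by
    intro k t ht
    obtain ⟨⟨ht1, ht2⟩, htI⟩ := ht
    have hsub : (∀ᵐ s ∂μ, s ∈ Ioi t → s ∈ (F ⁻¹' (Iic (2 ^ k)) ∪ (Ioi t ∩ (E k ∪ E (k + 1))))) := by
      filter_upwards [hμ] with s hsI hs
      by_cases h1 : F s ≤ 2 ^ k
      · exact Or.inl h1
      · refine Or.inr ⟨hs, ?_⟩
        push Not at h1
        by_cases h2 : F s ≤ 2 ^ (k + 1)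
        · exact Or.inl ⟨⟨h1, h2⟩, hsI⟩
        · push Not at h2
          exact Or.inr ⟨⟨h2, (hFanti (le_of_lt hs)).trans ht2⟩, hsI⟩
    have h1 : F t ≤ 2 ^ k + ∫⁻ s in Ioi t ∩ (E k ∪ E (k + 1)), g s ∂μ := by
      calc F t ≤ ∫⁻ s in (F ⁻¹' (Iic (2 ^ k)) ∪ (Ioi t ∩ (E k ∪ E (k + 1)))), g s ∂μ :=
            lintegral_mono_set' hsub
        _ ≤ _ := (lintegral_union_le _ _ _).trans (by
            gcongr
            exact aux_lint_Ioi μ g _ (hFm measurableSet_Iic) _ fun s hs => hs)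
    have h2 : (2 : ℝ≥0∞) ^ k ≤ ∫⁻ s in Ioi t ∩ (E k ∪ E (k + 1)), g s ∂μ := by
      have h3 : (2 : ℝ≥0∞) ^ k + 2 ^ k ≤ 2 ^ k + ∫⁻ s in Ioi t ∩ (E k ∪ E (k + 1)), g s ∂μ := by
        rw [← two_mul, ← two_zpow]
        exact ht1.le.trans h1
      exact (ENNReal.add_le_add_iff_left (ENNReal.zpow_ne_top (by norm_num) (by norm_num) k)).1 h3
    refine h2.trans ((aux_holder _ p hp w g hw hg (ae_restrict_of_ae hwae)).trans ?_)
    gcongr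
    · refine (lintegral_mono_set inter_subset_right).trans (lintegral_union_le _ _ _)
    · exact inter_subset_left
  have hlev : ∀ k, ∫⁻ t in E (k + 1), (u t * F t) ^ q ∂μ ≤
      (4 * A * (a k + a (k + 1)) ^ (1 / p)) ^ q := by
    intro k
    have hE1 : ∫⁻ t in E (k + 1), (u t * F t) ^ q ∂μ ≤
        ∫⁻ t in E (k + 1), ((4 * 2 ^ k) ^ q) * (u t) ^ q ∂μ := by
      refine setLIntegral_mono' (hEm _) fun t ht => ?_
      rw [← ENNReal.mul_rpow_of_nonneg _ _ hq0.le, mul_comm]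
      gcongr
      refine ht.1.2.trans ?_
      rw [two_zpow, two_zpow, ← mul_assoc]
      norm_num
    refine hE1.trans ?_
    rw [lintegral_const_mul' _ _ (ENNReal.rpow_ne_top_of_nonneg hq0.le
      (ENNReal.mul_ne_top (by norm_num) (ENNReal.zpow_ne_top (by norm_num) (by norm_num) k)))]
    rw [← lintegral_const_mul' _ _ (ENNReal.rpow_ne_top_of_nonneg hq0.le
      (ENNReal.mul_ne_top (by norm_num) (ENNReal.zpow_ne_top (by norm_num) (by norm_num) k)))]
    refine aux_lint_Iio μ _ _ (hEm _) _ fun t ht => ?_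
    rw [lintegral_const_mul' _ _ (ENNReal.rpow_ne_top_of_nonneg hq0.le
      (ENNReal.mul_ne_top (by norm_num) (ENNReal.zpow_ne_top (by norm_num) (by norm_num) k)))]
    have hU : ∫⁻ s in Iio t, (u s) ^ q ∂μ = ((∫⁻ s in Iio t, (u s) ^ q ∂μ) ^ (1 / q)) ^ q := by
      rw [← ENNReal.rpow_mul, one_div_mul_cancel hq0.ne', ENNReal.rpow_one]
    rw [hU, ← ENNReal.mul_rpow_of_nonneg _ _ hq0.le]
    refine ENNReal.rpow_le_rpow ?_ hq0.le
    calc 4 * 2 ^ k * (∫⁻ s in Iio t, (u s) ^ q ∂μ) ^ (1 / q)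
        ≤ 4 * ((a k + a (k + 1)) ^ (1 / p) *
          (∫⁻ s in Ioi t, (w s) ^ (-(p / (p - 1))) ∂μ) ^ (1 / (p / (p - 1)))) *
            (∫⁻ s in Iio t, (u s) ^ q ∂μ) ^ (1 / q) := by
          gcongr
          exact hlow k t ht
      _ = 4 * ((∫⁻ s in Iio t, (u s) ^ q ∂μ) ^ (1 / q) *
          (∫⁻ s in Ioi t, (w s) ^ (-(p / (p - 1))) ∂μ) ^ (1 / (p / (p - 1)))) *
            (a k + a (k + 1)) ^ (1 / p) := by ring
      _ ≤ _ := by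
          gcongr
          exact hA t ht.2
  have hcover : ∀ᵐ t ∂μ, t ∈ (F ⁻¹' {0} ∪ ⋃ k : ℤ, E (k + 1)) := by
    filter_upwards [hμ] with t ht
    by_cases h0 : F t = 0
    · exact Or.inl h0
    · obtain ⟨n, hn⟩ := ENNReal.exists_mem_Ioc_zpow h0 (hFfin t ht) (y := 2)
        (by norm_num) (by norm_num)
      refine Or.inr (mem_iUnion.2 ⟨n - 1, ?_⟩)
      rw [sub_add_cancel]
      exact ⟨hn, ht⟩
  have hmain : ∫⁻ t, (u t * F t) ^ q ∂μ ≤ (4 * A * (2 * N) ^ (1 / p)) ^ q := by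
    calc ∫⁻ t, (u t * F t) ^ q ∂μ
        = ∫⁻ t in (F ⁻¹' {0} ∪ ⋃ k : ℤ, E (k + 1)), (u t * F t) ^ q ∂μ := by
          rw [Measure.restrict_eq_self_of_ae_mem hcover]
      _ ≤ ∫⁻ t in F ⁻¹' {0}, (u t * F t) ^ q ∂μ + ∑' k : ℤ, ∫⁻ t in E (k + 1), (u t * F t) ^ q ∂μ :=
          (lintegral_union_le _ _ _).trans (by gcongr; exact lintegral_iUnion_le _ _)
      _ ≤ 0 + ∑' k : ℤ, (4 * A) ^ q * (a k + a (k + 1)) ^ (q / p) := by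
          gcongr with k
          · refine le_of_eq ?_
            rw [setLIntegral_congr_fun (g := fun _ => 0) (hFm (measurableSet_singleton 0))]
            · simp
            · intro t ht
              have : F t = 0 := ht
              simp [this, hq0]
          · refine (hlev k).trans (le_of_eq ?_)
            rw [ENNReal.mul_rpow_of_nonneg _ _ hq0.le, ← ENNReal.rpow_mul]
            congr 2
            ring
      _ = (4 * A) ^ q * ∑' k : ℤ, (a k + a (k + 1)) ^ (q / p) := by
          rw [zero_add, ENNReal.tsum_mul_left]
      _ ≤ (4 * A) ^ q * (2 * N) ^ (q / p) := by
          gcongr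
          refine (aux_tsum_rpow _ _ ((one_le_div hp0).2 hpq)).trans ?_
          refine ENNReal.rpow_le_rpow ?_ (by positivity)
          rw [ENNReal.tsum_add, two_mul]
          refine add_le_add hsum ?_
          exact ((Equiv.addRight (1 : ℤ)).tsum_eq a).trans_le hsum
      _ = _ := by
          rw [ENNReal.mul_rpow_of_nonneg (4 * A) ((2 * N) ^ (1 / p)) hq0.le, ← ENNReal.rpow_mul]
          congr 2
          ring
  calc (∫⁻ t, (u t * F t) ^ q ∂μ) ^ (1 / q) ≤ ((4 * A * (2 * N) ^ (1 / p)) ^ q) ^ (1 / q) := by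
        gcongr
    _ = 4 * A * (2 ^ (1 / p) * N ^ (1 / p)) := by
        rw [← ENNReal.rpow_mul, mul_one_div_cancel hq0.ne', ENNReal.rpow_one,
          ENNReal.mul_rpow_of_nonneg _ _ (by positivity)]
    _ ≤ 4 * A * (2 ^ (1 : ℝ) * N ^ (1 / p)) := by
        gcongr
        · norm_num
        · rw [div_le_one hp0]; exact hp.le
    _ = 8 * A * N ^ (1 / p) := by
        rw [ENNReal.rpow_one]; ring

theorem aux_lower (μ : Measure ℝ) [SigmaFinite μ] (p q : ℝ) (hp : 1 < p) (hpq : p ≤ q)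
    (u w : ℝ → ℝ≥0∞) (hw : Measurable w)
    (hw0 : ∀ᵐ t ∂μ, w t ≠ 0 ∧ w t ≠ ⊤) (K : ℝ≥0∞)
    (hK : ∀ g : ℝ → ℝ≥0∞, Measurable g →
      (∫⁻ t, (u t * ∫⁻ s in Ioi t, g s ∂μ) ^ q ∂μ) ^ (1 / q) ≤
        K * (∫⁻ t, (w t * g t) ^ p ∂μ) ^ (1 / p)) (r : ℝ) :
    (∫⁻ t in Iio r, (u t) ^ q ∂μ) ^ (1 / q) *
      (∫⁻ t in Ioi r, (w t) ^ (-(p / (p - 1))) ∂μ) ^ (1 / (p / (p - 1))) ≤ K := by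
  have hp0 : 0 < p := by linarith
  have hq0 : 0 < q := by linarith
  have hp1 : 0 < p - 1 := by linarith
  have hp'0 : 0 < p / (p - 1) := div_pos hp0 hp1
  set x := -(p / (p - 1)) with hx
  set B : ℕ → Set ℝ := fun n => Ioi r ∩ (spanningSets μ n ∩ {s | (w s) ^ x ≤ n}) with hB
  have hwx : Measurable fun s => (w s) ^ x := hw.pow_const x
  have hBm : ∀ n, MeasurableSet (B n) := fun n => measurableSet_Ioi.inter
    ((measurableSet_spanningSets μ n).inter (measurableSet_le hwx measurable_const))
  have hBmono : Monotone B := by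
    intro m n hmn
    refine inter_subset_inter_right _ (inter_subset_inter (monotone_spanningSets μ hmn) ?_)
    intro s hs
    have hs' : (w s) ^ x ≤ (m : ℝ≥0∞) := hs
    exact hs'.trans (by exact_mod_cast hmn)
  set V : ℕ → ℝ≥0∞ := fun n => ∫⁻ s in B n, (w s) ^ x ∂μ with hV
  have hVtop : ∀ n, V n ≠ ⊤ := by
    intro n
    refine ne_top_of_le_ne_top (b := n * μ (spanningSets μ n)) ?_ ?_
    · exact ENNReal.mul_ne_top (by simp) (measure_spanningSets_lt_top μ n).ne
    · calc V n ≤ ∫⁻ s in B n, (n : ℝ≥0∞) ∂μ := setLIntegral_mono' (hBm n) fun s hs => hs.2.2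
        _ = n * μ (B n) := by simp
        _ ≤ _ := by
          gcongr
          exact inter_subset_right.trans inter_subset_left
  have hVsup : ∫⁻ t in Ioi r, (w t) ^ x ∂μ = ⨆ n, V n := by
    rw [hV, ← setLIntegral_iUnion_of_directed _ hBmono.directed_le]
    refine setLIntegral_congr ?_
    filter_upwards [hw0] with s hs
    refine propext ⟨fun h => ?_, fun h => ?_⟩
    · have h1 : (w s) ^ x ≠ ⊤ := by
        rw [hx, ENNReal.rpow_neg]
        simp [hs.1, hp'0, hs.2, hp'0.not_gt]
      obtain ⟨m, hm⟩ := ENNReal.exists_nat_gt h1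
      have h2 := mem_spanningSetsIndex μ s
      refine mem_iUnion.2 ⟨max m (spanningSetsIndex μ s), h, ?_, ?_⟩
      · exact monotone_spanningSets μ (le_max_right _ _) h2
      · refine hm.le.trans ?_
        exact_mod_cast le_max_left _ _
    · obtain ⟨n, hn⟩ := mem_iUnion.1 h
      exact hn.1
  have hstep : ∀ n, (∫⁻ t in Iio r, (u t) ^ q ∂μ) ^ (1 / q) * (V n) ^ (1 / (p / (p - 1))) ≤ K := by
    intro n
    by_cases hV0 : V n = 0
    · rw [hV0, ENNReal.zero_rpow_of_pos (by positivity)]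
      simp
    have h := hK ((B n).indicator fun s => (w s) ^ x) (hwx.indicator (hBm n))
    have hR : ∫⁻ t, (w t * (B n).indicator (fun s => (w s) ^ x) t) ^ p ∂μ = V n := by
      simp only [hV]
      rw [← lintegral_indicator (hBm n)]
      refine lintegral_congr_ae ?_
      filter_upwards [hw0] with s hs
      by_cases hsB : s ∈ B n
      · simp only [indicator_of_mem hsB]
        have : w s * w s ^ x = w s ^ (1 + x) := by
          rw [ENNReal.rpow_add _ _ hs.1 hs.2, ENNReal.rpow_one]
        rw [this, ← ENNReal.rpow_mul]
        congr 1
        rw [hx]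
        field_simp
        ring
      · simp [indicator_of_notMem hsB, hp0]
    have hLft : (∫⁻ t in Iio r, (u t) ^ q ∂μ) ^ (1 / q) * V n ≤
        (∫⁻ t, (u t * ∫⁻ s in Ioi t, (B n).indicator (fun s => (w s) ^ x) s ∂μ) ^ q ∂μ) ^ (1 / q) := by
      have e : (∫⁻ t in Iio r, (u t) ^ q ∂μ) ^ (1 / q) * V n =
          (∫⁻ t in Iio r, (u t * V n) ^ q ∂μ) ^ (1 / q) := by
        simp_rw [ENNReal.mul_rpow_of_nonneg _ _ hq0.le]
        rw [lintegral_mul_const' _ _ (ENNReal.rpow_ne_top_of_nonneg hq0.le (hVtop n)),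
          ENNReal.mul_rpow_of_nonneg _ _ (by positivity), ← ENNReal.rpow_mul,
          mul_one_div_cancel hq0.ne', ENNReal.rpow_one]
      rw [e]
      refine ENNReal.rpow_le_rpow ?_ (by positivity)
      refine le_trans ?_ (setLIntegral_le_lintegral (Iio r) _)
      refine setLIntegral_mono' measurableSet_Iio fun t ht => ?_
      gcongr
      rw [setLIntegral_indicator (hBm n)]
      refine lintegral_mono_set ?_
      intro s hs
      have h1 : t < r := ht
      have h2 : r < s := hs.1
      exact ⟨hs, h1.trans h2⟩
    rw [hR] at h
    have h2 := hLft.trans h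
    have hVp0 : (V n) ^ (1 / p) ≠ 0 := by
      simp [hV0, hp0, hp0.not_gt]
    have hVpt : (V n) ^ (1 / p) ≠ ⊤ := ENNReal.rpow_ne_top_of_nonneg (by positivity) (hVtop n)
    have e2 : V n = (V n) ^ (1 / (p / (p - 1))) * (V n) ^ (1 / p) := by
      rw [← ENNReal.rpow_add _ _ hV0 (hVtop n)]
      have : 1 / (p / (p - 1)) + 1 / p = 1 := by
        field_simp
        ring
      rw [this, ENNReal.rpow_one]
    rw [← ENNReal.mul_le_mul_iff_left hVp0 hVpt, mul_assoc, ← e2]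
    exact h2
  rw [hVsup]
  have e3 : (⨆ n, V n) ^ (1 / (p / (p - 1))) = ⨆ n, (V n) ^ (1 / (p / (p - 1))) :=
    (ENNReal.orderIsoRpow (1 / (p / (p - 1))) (by positivity)).map_iSup V
  rw [e3, ENNReal.mul_iSup]
  exact iSup_le hstep

theorem statement5 (p q : ℝ) (hp : 1 < p) (hpq : p ≤ q) :
    ∃ c C : ℝ, 0 < c ∧ 0 < C ∧
      ∀ b : ℝ≥0∞, 0 < b → ∀ u v : ℝ → ℝ≥0∞, IsWeight b u → IsWeight b v →
        (∀ f : ℝ → ℝ≥0∞, Measurable f →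
            (∫⁻ t in IbSet b, (u t * Qavg b f t) ^ q) ^ (1 / q) ≤
              ENNReal.ofReal C * HardyConstQ b p q u v *
                (∫⁻ t in IbSet b, (v t * f t) ^ p) ^ (1 / p)) ∧
        ∀ K : ℝ≥0∞, (∀ f : ℝ → ℝ≥0∞, Measurable f →
            (∫⁻ t in IbSet b, (u t * Qavg b f t) ^ q) ^ (1 / q) ≤
              K * (∫⁻ t in IbSet b, (v t * f t) ^ p) ^ (1 / p)) →
          ENNReal.ofReal c * HardyConstQ b p q u v ≤ K := by
  refine ⟨1, 8, one_pos, by norm_num, ?_⟩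
  intro b hb u v hu hv
  have hp0 : 0 < p := by linarith
  have hq0 : 0 < q := by linarith
  have hp1 : 0 < p - 1 := by linarith
  have hp'0 : 0 < p / (p - 1) := div_pos hp0 hp1
  have hlt : ∀ c : ℝ≥0∞, MeasurableSet {t : ℝ | ENNReal.ofReal t < c} := fun c =>
    measurableSet_lt ENNReal.measurable_ofReal measurable_const
  have hIm : MeasurableSet (IbSet b) := measurableSet_Ioi.inter (hlt b)
  set μ : Measure ℝ := volume.restrict (IbSet b) with hμdef
  have hμ : ∀ᵐ t ∂μ, t ∈ IbSet b := ae_restrict_mem hIm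
  set w : ℝ → ℝ≥0∞ := fun t => ENNReal.ofReal t * v t with hwdef
  have hwm : Measurable w := ENNReal.measurable_ofReal.mul hv.1
  have hw0 : ∀ t ∈ IbSet b, w t ≠ 0 ∧ w t ≠ ⊤ := fun t ht =>
    ⟨mul_ne_zero (ENNReal.ofReal_pos.2 ht.1).ne' (hv.2.1 t ht).1.ne',
      ENNReal.mul_ne_top ENNReal.ofReal_ne_top (hv.2.1 t ht).2.ne⟩
  have hwae : ∀ᵐ t ∂μ, w t ≠ 0 ∧ w t ≠ ⊤ := hμ.mono fun t ht => hw0 t ht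
  have hIoi : ∀ t ∈ IbSet b, ∀ h : ℝ → ℝ≥0∞,
      ∫⁻ s in {s : ℝ | t < s ∧ ENNReal.ofReal s < b}, h s = ∫⁻ s in Ioi t, h s ∂μ := by
    intro t ht h
    rw [hμdef, Measure.restrict_restrict measurableSet_Ioi]
    congr 2
    ext s
    exact ⟨fun hs => ⟨hs.1, ht.1.trans hs.1, hs.2⟩, fun hs => ⟨hs.1, hs.2.2⟩⟩
  have hIio : ∀ r ∈ IbSet b, ∀ h : ℝ → ℝ≥0∞,
      ∫⁻ s in Ioo (0 : ℝ) r, h s = ∫⁻ s in Iio r, h s ∂μ := by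
    intro r hr h
    rw [hμdef, Measure.restrict_restrict measurableSet_Iio]
    congr 2
    ext s
    exact ⟨fun hs => ⟨hs.2, hs.1, (ENNReal.ofReal_le_ofReal hs.2.le).trans_lt hr.2⟩,
      fun hs => ⟨hs.2.1, hs.1⟩⟩
  have hsup : HardyConstQ b p q u v = ⨆ (r : ℝ) (_ : r ∈ IbSet b),
      (∫⁻ t in Iio r, (u t) ^ q ∂μ) ^ (1 / q) *
      (∫⁻ t in Ioi r, (w t) ^ (-(p / (p - 1))) ∂μ) ^ (1 / (p / (p - 1))) := by
    unfold HardyConstQ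
    refine iSup_congr fun r => iSup_congr fun hr => ?_
    rw [hIoi r hr, hIio r hr]
  have hQ : ∀ f : ℝ → ℝ≥0∞, ∫⁻ t, (u t * Qavg b f t) ^ q ∂μ =
      ∫⁻ t, (u t * ∫⁻ s in Ioi t, f s * (ENNReal.ofReal s)⁻¹ ∂μ) ^ q ∂μ := by
    intro f
    refine lintegral_congr_ae ?_
    filter_upwards [hμ] with t ht
    unfold Qavg
    rw [hIoi t ht]
  constructor
  · intro f hf
    rw [hQ f]
    set g : ℝ → ℝ≥0∞ := fun s => f s * (ENNReal.ofReal s)⁻¹ with hg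
    have hgm : Measurable g := hf.mul ENNReal.measurable_ofReal.inv
    have hN : ∫⁻ t, (v t * f t) ^ p ∂μ = ∫⁻ t, (w t * g t) ^ p ∂μ := by
      refine lintegral_congr_ae ?_
      filter_upwards [hμ] with t ht
      have : w t * g t = v t * f t * (ENNReal.ofReal t * (ENNReal.ofReal t)⁻¹) := by
        simp only [hwdef, hg]; ring
      rw [this, ENNReal.mul_inv_cancel (ENNReal.ofReal_pos.2 ht.1).ne' ENNReal.ofReal_ne_top,
        mul_one]
    rw [hN]
    have h8 : ENNReal.ofReal 8 = 8 := by norm_num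
    rw [h8]
    by_cases hN0 : ∫⁻ t, (w t * g t) ^ p ∂μ = 0
    · have hg0 : g =ᵐ[μ] 0 := by
        rw [lintegral_eq_zero_iff (f := fun t => (w t * g t) ^ p)
          ((hwm.mul hgm).pow_const p)] at hN0
        filter_upwards [hN0, hwae] with s hs hws
        have h1 : w s * g s = 0 := by
          have : (w s * g s) ^ p = 0 := hs
          rwa [ENNReal.rpow_eq_zero_iff_of_pos hp0] at this
        exact (mul_eq_zero.1 h1).resolve_left hws.1
      have hz : ∀ t, ∫⁻ s in Ioi t, g s ∂μ = 0 := fun t => by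
        rw [lintegral_congr_ae (ae_restrict_of_ae hg0)]
        simp
      simp [hz, hq0]
    set A := HardyConstQ b p q u v with hAdef
    have hle : ∀ r ∈ IbSet b, (∫⁻ t in Iio r, (u t) ^ q ∂μ) ^ (1 / q) *
      (∫⁻ t in Ioi r, (w t) ^ (-(p / (p - 1))) ∂μ) ^ (1 / (p / (p - 1))) ≤ A := by
      intro r hr
      rw [hsup]
      exact le_iSup₂_of_le r hr le_rfl
    have hUpos : ∀ r ∈ IbSet b, ∫⁻ t in Iio r, (u t) ^ q ∂μ ≠ 0 := by
      intro r hr h0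
      rw [← hIio r hr, setLIntegral_eq_zero_iff measurableSet_Ioo (hu.1.pow_const q)] at h0
      have h1 : volume (Ioo 0 r) = 0 := by
        refine measure_mono_null ?_ h0
        intro s hs hs2
        have h3 := hs2 hs
        rw [ENNReal.rpow_eq_zero_iff_of_pos hq0] at h3
        exact (hu.2.1 s ⟨hs.1, (ENNReal.ofReal_le_ofReal hs.2.le).trans_lt hr.2⟩).1.ne' h3
      rw [Real.volume_Ioo] at h1
      simp at h1
      exact absurd hr.1 (not_lt.2 h1)
    have hVpos : ∃ r ∈ IbSet b, ∫⁻ t in Ioi r, (w t) ^ (-(p / (p - 1))) ∂μ ≠ 0 := by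
      obtain ⟨c, hc0, hcb⟩ := ENNReal.lt_iff_exists_nnreal_btwn.1 hb
      have hc : (0 : ℝ) < c := by exact_mod_cast hc0
      have hsub : ∀ s ∈ Ioo ((c : ℝ) / 2) c, s ∈ IbSet b := fun s hs =>
        ⟨by linarith [hs.1], (ENNReal.ofReal_le_ofReal hs.2.le).trans_lt (by simpa using hcb)⟩
      refine ⟨c / 2, ⟨by linarith, ?_⟩, ?_⟩
      · refine (ENNReal.ofReal_le_ofReal (q := (c : ℝ)) (by linarith)).trans_lt (by simpa using hcb)
      · intro h0
        rw [hμdef, Measure.restrict_restrict measurableSet_Ioi,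
          setLIntegral_eq_zero_iff (measurableSet_Ioi.inter hIm) (hwm.pow_const _)] at h0
        have h1 : volume (Ioo ((c : ℝ) / 2) c) = 0 := by
          refine measure_mono_null ?_ h0
          intro s hs hs2
          have h3 := hs2 ⟨hs.1, hsub s hs⟩
          rw [ENNReal.rpow_neg, ENNReal.inv_eq_zero] at h3
          exact ENNReal.rpow_ne_top_of_nonneg hp'0.le (hw0 s (hsub s hs)).2 h3
        rw [Real.volume_Ioo] at h1
        rw [ENNReal.ofReal_eq_zero] at h1
        linarith
    have hA0 : A ≠ 0 := by
      obtain ⟨r, hr, hVr⟩ := hVpos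
      intro hA
      have h1 := hle r hr
      rw [hA] at h1
      have h2 := mul_eq_zero.1 (le_antisymm h1 bot_le)
      rcases h2 with h2 | h2
      · rw [ENNReal.rpow_eq_zero_iff_of_pos (by positivity)] at h2
        exact hUpos r hr h2
      · rw [ENNReal.rpow_eq_zero_iff_of_pos (by positivity)] at h2
        exact hVr h2
    by_cases hAt : A = ⊤
    · have hNp : (∫⁻ t, (w t * g t) ^ p ∂μ) ^ (1 / p) ≠ 0 := by
        rw [Ne, ENNReal.rpow_eq_zero_iff_of_pos (by positivity)]
        exact hN0
      rw [hAt, ENNReal.mul_top (by norm_num), ENNReal.top_mul hNp]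
      exact le_top
    by_cases hNt : ∫⁻ t, (w t * g t) ^ p ∂μ = ⊤
    · rw [hNt, ENNReal.top_rpow_of_pos (by positivity),
        ENNReal.mul_top (mul_ne_zero (by norm_num) hA0)]
      exact le_top
    refine aux_upper μ (IbSet b) hIm hμ p q hp hpq u w g hwm hgm hw0 A hle ?_ hNt
    intro r hr hVt
    have h1 := hle r hr
    rw [hVt, ENNReal.top_rpow_of_pos (by positivity), ENNReal.mul_top] at h1
    · exact hAt (top_le_iff.1 h1)
    · rw [Ne, ENNReal.rpow_eq_zero_iff_of_pos (by positivity)]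
      exact hUpos r hr
  · intro K hK
    rw [ENNReal.ofReal_one, one_mul, hsup]
    refine iSup₂_le fun r _ => aux_lower μ p q hp hpq u w hwm hwae K ?_ r
    intro g hg
    have h := hK (fun s => ENNReal.ofReal s * g s) (ENNReal.measurable_ofReal.mul hg)
    rw [hQ] at h
    have e1 : ∀ t, ∫⁻ s in Ioi t, ENNReal.ofReal s * g s * (ENNReal.ofReal s)⁻¹ ∂μ =
        ∫⁻ s in Ioi t, g s ∂μ := fun t => by
      refine lintegral_congr_ae (ae_restrict_of_ae ?_)
      filter_upwards [hμ] with s hs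
      rw [mul_comm, ← mul_assoc, ENNReal.inv_mul_cancel (ENNReal.ofReal_pos.2 hs.1).ne'
        ENNReal.ofReal_ne_top, one_mul]
    have e2 : ∀ t, v t * (ENNReal.ofReal t * g t) = w t * g t := fun t => by
      simp only [hwdef]; ring
    simp only [e1, e2] at h
    exact h

end
end

section
/- Fix indices 1 < p ≤ q < ∞ and weights u, v on (0, ∞). Then the least constant K > 0 in the inequality (∫₀^∞ (Sf)(t)^q u(t) dt)^{1/q} ≤ K (∫₀^∞ f(t)^p v(t) dt)^{1/p}, required to hold for all f ∈ M₊((0,∞)), is equivalent (up to multiplicative constants depending only on p and q) to sup_{t>0} (∫₀^∞ (t/(s+t))^q u(s) ds)^{1/q} (∫₀^∞ v(s)^{1-p'} (s+t)^{-p'} ds)^{1/p'}; in particular, the inequality holds with some finite K if and only if this supremum is finite. -/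
open MeasureTheory Set ENNReal Filter

noncomputable section

/-- The Andersen constant for the Stieltjes transform, case `1 < p ≤ q < ∞`. -/
def StieltjesConst (p q : ℝ) (u v : ℝ → ℝ≥0∞) : ℝ≥0∞ :=
  ⨆ (t : ℝ) (_ : 0 < t),
    (∫⁻ s in Ioi (0 : ℝ), ENNReal.ofReal ((t / (s + t)) ^ q) * u s) ^ (1 / q) *
      (∫⁻ s in Ioi (0 : ℝ),
        (v s) ^ (1 - p / (p - 1)) * ENNReal.ofReal ((s + t) ^ (-(p / (p - 1))))) ^
        (1 / (p / (p - 1)))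

theorem exists_coinitial (E : Set ℝ) : ∃ C ⊆ E, C.Countable ∧ ∀ x ∈ E, ∃ y ∈ C, y ≤ x := by
  classical
  have h : ∀ r : ℚ, ∃ c : ℝ, (E ∩ Iio (r:ℝ)).Nonempty → c ∈ E ∩ Iio (r:ℝ) := by
    intro r
    by_cases hr : (E ∩ Iio (r:ℝ)).Nonempty
    · obtain ⟨c, hc⟩ := hr
      exact ⟨c, fun _ => hc⟩
    · exact ⟨0, fun h => absurd h hr⟩
  choose c hc using h
  refine ⟨{x | x ∈ E ∧ ∀ y ∈ E, x ≤ y} ∪ c '' {r : ℚ | (E ∩ Iio (r:ℝ)).Nonempty}, ?_, ?_, ?_⟩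
  · rintro x (hx | ⟨r, hr, rfl⟩)
    · exact hx.1
    · exact (hc r hr).1
  · refine Countable.union ?_ ((to_countable _).image _)
    apply Set.Subsingleton.countable
    rintro a ha b hb
    exact le_antisymm (ha.2 b hb.1) (hb.2 a ha.1)
  · intro x hx
    by_cases hm : ∀ y ∈ E, x ≤ y
    · exact ⟨x, Or.inl ⟨hx, hm⟩, le_rfl⟩
    · push Not at hm
      obtain ⟨y, hy, hyx⟩ := hm
      obtain ⟨r, hr1, hr2⟩ := exists_rat_btwn hyx
      have hne : (E ∩ Iio (r:ℝ)).Nonempty := ⟨y, hy, hr1⟩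
      exact ⟨c r, Or.inr ⟨r, hne, rfl⟩, (lt_trans (hc r hne).2 hr2).le⟩

theorem measure_le_of_Ici (ν : Measure ℝ) (E : Set ℝ) (M : ℝ≥0∞)
    (h : ∀ x ∈ E, ν (E ∩ Ici x) ≤ M) : ν E ≤ M := by
  obtain ⟨C, hCE, hC, hco⟩ := exists_coinitial E
  have h1 : E ⊆ ⋃ x ∈ C, E ∩ Ici x := by
    intro x hx
    obtain ⟨y, hy, hyx⟩ := hco x hx
    simp only [mem_iUnion]
    exact ⟨y, hy, hx, hyx⟩
  refine (measure_mono h1).trans ?_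
  rw [measure_biUnion_eq_iSup hC]
  · exact iSup₂_le fun x hx => h x (hCE hx)
  · intro a ha b hb
    rcases le_total a b with hab | hab
    · exact ⟨a, ha, subset_rfl, inter_subset_inter_right _ (Ici_subset_Ici.2 hab)⟩
    · exact ⟨b, hb, inter_subset_inter_right _ (Ici_subset_Ici.2 hab), subset_rfl⟩

theorem measure_le_of_Iic (ν : Measure ℝ) (E : Set ℝ) (M : ℝ≥0∞)
    (h : ∀ x ∈ E, ν (E ∩ Iic x) ≤ M) : ν E ≤ M := by
  have hm : Measurable (fun x : ℝ => -x) := measurable_neg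
  have key := measure_le_of_Ici (ν.map (MeasurableEquiv.neg ℝ)) (-E) M ?_
  · rw [MeasurableEquiv.map_apply] at key
    convert key using 2
    ext x; simp
  · intro x hx
    rw [MeasurableEquiv.map_apply]
    convert h (-x) hx using 2
    ext y; simp

theorem tsum_rpow_le' {ι : Type*} (a : ι → ℝ≥0∞) (r : ℝ) (hr : 1 ≤ r) :
    ∑' i, a i ^ r ≤ (∑' i, a i) ^ r := by
  have e : ∀ x : ℝ≥0∞, x ^ r = x * x ^ (r - 1) := by
    intro x
    have := ENNReal.rpow_add_of_nonneg (x := x) 1 (r - 1) zero_le_one (by linarith)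
    rw [ENNReal.rpow_one] at this
    rw [← this]; congr 1; ring
  rw [e (∑' i, a i), ← ENNReal.tsum_mul_right]
  refine ENNReal.tsum_le_tsum fun i => ?_
  rw [e]
  exact mul_le_mul_right (ENNReal.rpow_le_rpow (ENNReal.le_tsum i) (by linarith)) _

theorem hardy_aux {p pc q : ℝ} (hpp : p.HolderConjugate pc) (hpq : p ≤ q) (μ : Measure ℝ)
    [NullSingletonClass μ] (g w U : ℝ → ℝ≥0∞) (hg : Measurable g) (hw : Measurable w) (hU : Measurable U)
    (A : ℝ≥0∞)
    (hA : ∀ x : ℝ, (∫⁻ t in Ici x, U t ∂μ) ^ (1 / q) *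
      (∫⁻ s in Iio x, w s ^ pc ∂μ) ^ (1 / pc) ≤ A) :
    (∫⁻ x, (∫⁻ s in Iio x, g s * w s ∂μ) ^ q * U x ∂μ) ^ (1 / q) ≤
      8 * A * (∫⁻ s, g s ^ p ∂μ) ^ (1 / p) := by
  have hp0 : 0 < p := hpp.pos
  have hp1 : 1 < p := hpp.lt
  have hq0 : 0 < q := hp0.trans_le hpq
  set F : ℝ → ℝ≥0∞ := fun x => ∫⁻ s in Iio x, g s * w s ∂μ with hF
  have hFm : Monotone F := fun a b hab => lintegral_mono_set (Iio_subset_Iio hab)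
  have hFmeas : Measurable F := hFm.measurable
  set ν := μ.withDensity U with hν
  have hνE : ∀ E : Set ℝ, MeasurableSet E → ν E = ∫⁻ t in E, U t ∂μ := fun E hE =>
    withDensity_apply _ hE
  -- Hölder
  have hold : ∀ (E : Set ℝ) (x : ℝ), MeasurableSet E → ∫⁻ s in Iio x ∩ E, g s * w s ∂μ ≤
      (∫⁻ s in E, g s ^ p ∂μ) ^ (1 / p) * (∫⁻ s in Iio x, w s ^ pc ∂μ) ^ (1 / pc) := by
    intro E x hE
    refine (ENNReal.lintegral_mul_le_Lp_mul_Lq (μ.restrict (Iio x ∩ E)) hpp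
      hg.aemeasurable hw.aemeasurable).trans ?_
    gcongr
    · exact inter_subset_right
    · exact one_div_nonneg.2 hpp.symm.pos.le
    · exact inter_subset_left
  -- tail bound
  have tail : ∀ (E : Set ℝ) (x : ℝ) (c : ℝ≥0∞), MeasurableSet E →
      c ≤ ∫⁻ s in Iio x ∩ E, g s * w s ∂μ →
      c * ν (Ici x) ^ (1 / q) ≤ A * (∫⁻ s in E, g s ^ p ∂μ) ^ (1 / p) := by
    intro E x c hE hc
    rw [hνE _ measurableSet_Ici]
    calc c * (∫⁻ t in Ici x, U t ∂μ) ^ (1 / q)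
        ≤ ((∫⁻ s in E, g s ^ p ∂μ) ^ (1 / p) * (∫⁻ s in Iio x, w s ^ pc ∂μ) ^ (1 / pc)) *
          (∫⁻ t in Ici x, U t ∂μ) ^ (1 / q) := by
          gcongr
          exact hc.trans (hold E x hE)
      _ = ((∫⁻ t in Ici x, U t ∂μ) ^ (1 / q) * (∫⁻ s in Iio x, w s ^ pc ∂μ) ^ (1 / pc)) *
          (∫⁻ s in E, g s ^ p ∂μ) ^ (1 / p) := by ring
      _ ≤ _ := by gcongr; exact hA x
  -- sublevel sets
  have sub : ∀ c : ℝ≥0∞, ∫⁻ s in {s | F s ≤ c}, g s * w s ∂μ ≤ c := by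
    intro c
    have hms : MeasurableSet {s | F s ≤ c} := measurableSet_le hFmeas measurable_const
    rw [← withDensity_apply _ hms]
    apply measure_le_of_Iic
    intro x hx
    refine (measure_mono inter_subset_right).trans ?_
    rw [withDensity_apply _ measurableSet_Iic, setLIntegral_congr (Iio_ae_eq_Iic (μ := μ)).symm]
    exact hx
  set N := ∫⁻ s, g s ^ p ∂μ with hN
  by_cases htop : A * N ^ (1 / p) = ⊤
  · rw [mul_assoc, htop]; simp
  set E : ℤ → Set ℝ := fun k => {x | F x ∈ Ioc ((2 : ℝ≥0∞) ^ k) (2 ^ (k + 1))} with hE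
  have hEm : ∀ k, MeasurableSet (E k) := fun k => hFmeas measurableSet_Ioc
  have hEtop : ν {x | F x = ⊤} ≤ 0 := by
    apply measure_le_of_Ici
    intro x hx
    refine (measure_mono inter_subset_right).trans ?_
    have h1 := tail univ x ⊤ MeasurableSet.univ (by rw [inter_univ]; exact hx.ge)
    rw [setLIntegral_univ] at h1
    by_contra hne
    have h2 : ν (Ici x) ^ (1 / q) ≠ 0 := by
      intro h
      rw [ENNReal.rpow_eq_zero_iff_of_pos (one_div_pos.2 hq0)] at h
      exact hne h.le
    rw [ENNReal.top_mul h2] at h1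
    exact htop (top_le_iff.1 h1)
  set W : ℤ → Set ℝ := fun k => E (k - 1) ∪ E k with hW
  have hWm : ∀ k, MeasurableSet (W k) := fun k => (hEm _).union (hEm _)
  have key : ∀ k, (2 : ℝ≥0∞) ^ (k - 1) * ν (E k) ^ (1 / q) ≤
      A * (∫⁻ s in W k, g s ^ p ∂μ) ^ (1 / p) := by
    intro k
    have h2k : (2 : ℝ≥0∞) ^ k = 2 ^ (k - 1) + 2 ^ (k - 1) := by
      rw [← mul_two]
      have := ENNReal.zpow_add (x := 2) (by simp) (by simp) (k - 1) 1
      simpa using this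
    have hc0 : (2 : ℝ≥0∞) ^ (k - 1) ≠ 0 := (ENNReal.zpow_pos (by simp) (by simp) _).ne'
    have hct : (2 : ℝ≥0∞) ^ (k - 1) ≠ ⊤ := (ENNReal.zpow_lt_top (by simp) (by simp) _).ne
    have hx : ∀ x ∈ E k, (2 : ℝ≥0∞) ^ (k - 1) ≤ ∫⁻ s in Iio x ∩ W k, g s * w s ∂μ := by
      intro x hx
      have h1 : F x ≤ 2 ^ (k - 1) + ∫⁻ s in Iio x ∩ W k, g s * w s ∂μ := by
        calc F x ≤ ∫⁻ s in {s | F s ≤ 2 ^ (k - 1)} ∪ (Iio x ∩ W k), g s * w s ∂μ := by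
              apply lintegral_mono_set
              intro s hs
              by_cases h : F s ≤ 2 ^ (k - 1)
              · exact Or.inl h
              · refine Or.inr ⟨hs, ?_⟩
                push Not at h
                by_cases h' : F s ≤ 2 ^ k
                · refine Or.inl ⟨h, ?_⟩
                  simpa using h'
                · exact Or.inr ⟨not_le.1 h', (hFm (le_of_lt hs)).trans hx.2⟩
          _ ≤ _ := lintegral_union_le _ _ _
          _ ≤ _ := by gcongr; exact sub _
      have h2 := hx.1.le.trans h1
      rw [h2k] at h2
      exact (ENNReal.add_le_add_iff_left hct).1 h2
    have h3 : ν (E k) ≤ (A * (∫⁻ s in W k, g s ^ p ∂μ) ^ (1 / p) / 2 ^ (k - 1)) ^ q := by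
      apply measure_le_of_Ici
      intro x hxE
      refine (measure_mono inter_subset_right).trans ?_
      have h4 := tail (W k) x _ (hWm k) (hx x hxE)
      rw [mul_comm] at h4
      have h5 := (ENNReal.le_div_iff_mul_le (Or.inl hc0) (Or.inl hct)).2 h4
      rw [one_div, ENNReal.rpow_inv_le_iff hq0] at h5
      exact h5
    rw [← ENNReal.rpow_inv_le_iff hq0, ← one_div, ENNReal.le_div_iff_mul_le (Or.inl hc0) (Or.inl hct)] at h3
    rwa [mul_comm]
  have key2 : ∀ k, ∫⁻ x in E k, F x ^ q * U x ∂μ ≤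
      (4 * A) ^ q * (∫⁻ s in W k, g s ^ p ∂μ) ^ (q / p) := by
    intro k
    have h4 : (2 : ℝ≥0∞) ^ (k + 1) = 4 * 2 ^ (k - 1) := by
      have := ENNReal.zpow_add (x := 2) (by simp) (by simp) (k - 1) 2
      rw [show k + 1 = k - 1 + 2 by ring, this, mul_comm]
      norm_num
    calc ∫⁻ x in E k, F x ^ q * U x ∂μ ≤ ∫⁻ x in E k, (2 ^ (k + 1)) ^ q * U x ∂μ := by
          apply setLIntegral_mono' (hEm k)
          intro x hx
          gcongr
          exact hx.2
      _ = (2 ^ (k + 1)) ^ q * ν (E k) := by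
          rw [lintegral_const_mul _ hU, hνE _ (hEm k)]
      _ = (4 * (2 ^ (k - 1) * ν (E k) ^ (1 / q))) ^ q := by
          rw [← mul_assoc, ← h4, ENNReal.mul_rpow_of_nonneg _ _ hq0.le, ← ENNReal.rpow_mul,
            one_div_mul_cancel hq0.ne', ENNReal.rpow_one]
      _ ≤ (4 * (A * (∫⁻ s in W k, g s ^ p ∂μ) ^ (1 / p))) ^ q := by
          exact ENNReal.rpow_le_rpow (mul_le_mul_right (key k) 4) hq0.le
      _ = _ := by
          rw [← mul_assoc, ENNReal.mul_rpow_of_nonneg _ _ hq0.le, ← ENNReal.rpow_mul,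
            one_div_mul_eq_div]
  have hdisj : Pairwise (Function.onFun Disjoint E) := by
    have hmono : Monotone (fun k : ℤ => (2 : ℝ≥0∞) ^ k) := fun a b hab =>
      ENNReal.zpow_le_of_le (by norm_num) hab
    intro i j hij
    have := hmono.pairwise_disjoint_on_Ioc_succ hij
    exact this.preimage F
  have sumE : ∑' k, ∫⁻ s in E k, g s ^ p ∂μ ≤ N := by
    rw [← lintegral_iUnion hEm hdisj]
    exact setLIntegral_le_lintegral _ _
  have sumW : ∑' k, ∫⁻ s in W k, g s ^ p ∂μ ≤ 2 * N := by
    calc ∑' k, ∫⁻ s in W k, g s ^ p ∂μ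
        ≤ ∑' k, (∫⁻ s in E (k - 1), g s ^ p ∂μ + ∫⁻ s in E k, g s ^ p ∂μ) :=
          ENNReal.tsum_le_tsum fun k => lintegral_union_le _ _ _
      _ = ∑' k, ∫⁻ s in E (k - 1), g s ^ p ∂μ + ∑' k, ∫⁻ s in E k, g s ^ p ∂μ := ENNReal.tsum_add
      _ = ∑' k, ∫⁻ s in E k, g s ^ p ∂μ + ∑' k, ∫⁻ s in E k, g s ^ p ∂μ := by
          rw [← (Equiv.subRight (1 : ℤ)).tsum_eq (fun k => ∫⁻ s in E k, g s ^ p ∂μ)]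
          simp
      _ ≤ N + N := by gcongr
      _ = 2 * N := (two_mul N).symm
  have main : ∫⁻ x, F x ^ q * U x ∂μ ≤ (4 * A) ^ q * (2 * N) ^ (q / p) := by
    have hcov : (univ : Set ℝ) ⊆ ({x | F x = 0} ∪ {x | F x = ⊤}) ∪ ⋃ k, E k := by
      intro x _
      by_cases h0 : F x = 0
      · exact Or.inl (Or.inl h0)
      by_cases ht : F x = ⊤
      · exact Or.inl (Or.inr ht)
      obtain ⟨n, hn⟩ := ENNReal.exists_mem_Ioc_zpow h0 ht (y := 2) (by norm_num) (by simp)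
      exact Or.inr (mem_iUnion.2 ⟨n, hn⟩)
    have z1 : ∫⁻ x in {x | F x = 0}, F x ^ q * U x ∂μ = 0 := by
      have hms : MeasurableSet {x | F x = 0} := hFmeas (measurableSet_singleton 0)
      rw [setLIntegral_congr_fun (g := fun _ => 0) hms]
      · simp
      · intro x hx
        have : F x = 0 := hx
        simp [this, hq0]
    have z2 : ∫⁻ x in {x | F x = ⊤}, F x ^ q * U x ∂μ = 0 := by
      have hms : MeasurableSet {x | F x = ⊤} := hFmeas (measurableSet_singleton ⊤)
      have h1 := le_antisymm hEtop bot_le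
      rw [hνE _ hms] at h1
      rw [lintegral_eq_zero_iff hU] at h1
      rw [lintegral_eq_zero_iff (f := fun x => F x ^ q * U x) (by fun_prop)]
      filter_upwards [h1] with x hx
      simp at hx
      simp [hx]
    calc ∫⁻ x, F x ^ q * U x ∂μ = ∫⁻ x in univ, F x ^ q * U x ∂μ := by rw [setLIntegral_univ]
      _ ≤ ∫⁻ x in ({x | F x = 0} ∪ {x | F x = ⊤}) ∪ ⋃ k, E k, F x ^ q * U x ∂μ :=
          lintegral_mono_set hcov
      _ ≤ ∫⁻ x in ({x | F x = 0} ∪ {x | F x = ⊤}), F x ^ q * U x ∂μ +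
          ∫⁻ x in ⋃ k, E k, F x ^ q * U x ∂μ := lintegral_union_le _ _ _
      _ ≤ 0 + ∑' k, ∫⁻ x in E k, F x ^ q * U x ∂μ := by
          gcongr
          · refine (lintegral_union_le _ _ _).trans ?_
            rw [z1, z2]; simp
          · exact lintegral_iUnion_le _ _
      _ ≤ ∑' k, (4 * A) ^ q * (∫⁻ s in W k, g s ^ p ∂μ) ^ (q / p) := by
          rw [zero_add]
          exact ENNReal.tsum_le_tsum key2
      _ = (4 * A) ^ q * ∑' k, (∫⁻ s in W k, g s ^ p ∂μ) ^ (q / p) := ENNReal.tsum_mul_left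
      _ ≤ (4 * A) ^ q * (∑' k, ∫⁻ s in W k, g s ^ p ∂μ) ^ (q / p) := by
          gcongr
          exact tsum_rpow_le' _ _ ((one_le_div hp0).2 hpq)
      _ ≤ _ := by gcongr
  calc (∫⁻ x, F x ^ q * U x ∂μ) ^ (1 / q)
      ≤ ((4 * A) ^ q * (2 * N) ^ (q / p)) ^ (1 / q) := by gcongr
    _ = 4 * A * (2 * N) ^ (1 / p) := by
        rw [ENNReal.mul_rpow_of_nonneg _ _ (one_div_pos.2 hq0).le, ← ENNReal.rpow_mul,
          ← ENNReal.rpow_mul, mul_one_div_cancel hq0.ne', ENNReal.rpow_one]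
        congr 2
        field_simp
    _ = 4 * A * (2 ^ (1 / p) * N ^ (1 / p)) := by
        rw [ENNReal.mul_rpow_of_nonneg _ _ (one_div_pos.2 hp0).le]
    _ ≤ 4 * A * (2 ^ (1 : ℝ) * N ^ (1 / p)) := by
        gcongr
        · norm_num
        · rw [div_le_one hp0]; exact hp1.le
    _ = 8 * A * N ^ (1 / p) := by rw [ENNReal.rpow_one]; ring

theorem hardy_aux' {p pc q : ℝ} (hpp : p.HolderConjugate pc) (hpq : p ≤ q) (μ : Measure ℝ)
    [NullSingletonClass μ] (g w U : ℝ → ℝ≥0∞) (hg : Measurable g) (hw : Measurable w) (hU : Measurable U)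
    (A : ℝ≥0∞)
    (hA : ∀ x : ℝ, (∫⁻ t in Iic x, U t ∂μ) ^ (1 / q) *
      (∫⁻ s in Ioi x, w s ^ pc ∂μ) ^ (1 / pc) ≤ A) :
    (∫⁻ x, (∫⁻ s in Ioi x, g s * w s ∂μ) ^ q * U x ∂μ) ^ (1 / q) ≤
      8 * A * (∫⁻ s, g s ^ p ∂μ) ^ (1 / p) := by
  set e := MeasurableEquiv.neg ℝ with he
  have hem : Measurable (fun x : ℝ => -x) := measurable_neg
  have : NullSingletonClass (μ.map e) := by
    constructor
    intro x
    rw [MeasurableEquiv.map_apply]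
    have : e ⁻¹' {x} = {-x} := by ext y; simp [he]
    rw [this, measure_singleton]
  have h1 : ∀ x : ℝ, e ⁻¹' (Iio x) = Ioi (-x) := by intro x; ext y; simp [he]
  have h2 : ∀ x : ℝ, e ⁻¹' (Ici x) = Iic (-x) := by intro x; ext y; simp [he]
  have key := hardy_aux hpp hpq (μ.map e) (fun x => g (-x)) (fun x => w (-x)) (fun x => U (-x))
    (hg.comp hem) (hw.comp hem) (hU.comp hem) A ?_
  · simp only [MeasurableEquiv.restrict_map, lintegral_map_equiv, h1] at key
    simpa [he] using key
  · intro x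
    simp only [MeasurableEquiv.restrict_map, lintegral_map_equiv, h1, h2]
    simpa [he] using hA (-x)

theorem bnd_aux {r c : ℝ} (hr : 0 < r) (hc : 0 ≤ c) (S : Set ℝ) (hS : MeasurableSet S)
    (a b : ℝ → ℝ≥0∞) (hb : Measurable b)
    (h : ∀ t ∈ S, 0 < t → a t ≤ ENNReal.ofReal (c ^ r) * b t) :
    (∫⁻ t in S, a t ∂(volume.restrict (Ioi (0 : ℝ)))) ^ (1 / r) ≤
      ENNReal.ofReal c * (∫⁻ t in Ioi (0 : ℝ), b t) ^ (1 / r) := by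
  have h1 : ∫⁻ t in S, a t ∂(volume.restrict (Ioi (0 : ℝ))) ≤
      ENNReal.ofReal (c ^ r) * ∫⁻ t in Ioi (0 : ℝ), b t := by
    rw [← lintegral_const_mul _ hb, Measure.restrict_restrict hS]
    refine (setLIntegral_mono' (hS.inter measurableSet_Ioi) (fun t ht => h t ht.1 ht.2)).trans ?_
    exact lintegral_mono_set inter_subset_right
  calc _ ≤ (ENNReal.ofReal (c ^ r) * ∫⁻ t in Ioi (0 : ℝ), b t) ^ (1 / r) :=
        ENNReal.rpow_le_rpow h1 (one_div_pos.2 hr).le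
    _ = _ := by
        rw [ENNReal.mul_rpow_of_nonneg _ _ (one_div_pos.2 hr).le,
          ← ENNReal.ofReal_rpow_of_nonneg hc hr.le, ← ENNReal.rpow_mul, mul_one_div_cancel hr.ne',
          ENNReal.rpow_one]

theorem upper_aux (p q : ℝ) (hp : 1 < p) (hpq : p ≤ q) (u v : ℝ → ℝ≥0∞) (hu : IsWeight ⊤ u)
    (hv : IsWeight ⊤ v) (f : ℝ → ℝ≥0∞) (hf : Measurable f) :
    (∫⁻ t in Ioi (0 : ℝ), (Sop f t) ^ q * u t) ^ (1 / q) ≤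
      ENNReal.ofReal 64 * StieltjesConst p q u v *
        (∫⁻ t in Ioi (0 : ℝ), f t ^ p * v t) ^ (1 / p) := by
  obtain ⟨hum, hupos, -⟩ := hu
  obtain ⟨hvm, hvpos, -⟩ := hv
  have hp0 : 0 < p := by linarith
  have hq0 : 0 < q := by linarith
  have hq1 : 1 ≤ q := by linarith
  have hpp : p.HolderConjugate (p / (p - 1)) := Real.HolderConjugate.conjExponent hp
  set A := StieltjesConst p q u v with hAdef
  have hAt : ∀ t : ℝ, 0 < t →
    (∫⁻ s in Ioi (0 : ℝ), ENNReal.ofReal ((t / (s + t)) ^ q) * u s) ^ (1 / q) *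
      (∫⁻ s in Ioi (0 : ℝ),
        (v s) ^ (1 - p / (p - 1)) * ENNReal.ofReal ((s + t) ^ (-(p / (p - 1))))) ^
        (1 / (p / (p - 1))) ≤ A := fun t ht => by
    rw [hAdef, StieltjesConst]
    exact le_iSup₂ (f := fun (t : ℝ) (_ : 0 < t) =>
      (∫⁻ s in Ioi (0 : ℝ), ENNReal.ofReal ((t / (s + t)) ^ q) * u s) ^ (1 / q) *
      (∫⁻ s in Ioi (0 : ℝ),
        (v s) ^ (1 - p / (p - 1)) * ENNReal.ofReal ((s + t) ^ (-(p / (p - 1))))) ^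
        (1 / (p / (p - 1)))) t ht
  have hexp : -(1 / p) * (p / (p - 1)) = 1 - p / (p - 1) := by
    have : p - 1 ≠ 0 := by linarith
    field_simp
    ring
  set pc := p / (p - 1) with hpc
  have hpc0 : 0 < pc := hpp.symm.pos
  set μ := volume.restrict (Ioi (0 : ℝ)) with hμ
  set g : ℝ → ℝ≥0∞ := fun s => f s * v s ^ (1 / p) with hg
  set w : ℝ → ℝ≥0∞ := fun s => v s ^ (-(1 / p)) with hw
  set w2 : ℝ → ℝ≥0∞ := fun s => w s * ENNReal.ofReal (s⁻¹) with hw2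
  set U : ℝ → ℝ≥0∞ := fun t => ENNReal.ofReal (t ^ (-q)) * u t with hU
  have hgm : Measurable g := by fun_prop
  have hwm : Measurable w := by fun_prop
  have hw2m : Measurable w2 := by fun_prop
  have hUm : Measurable U := by fun_prop
  have hgp : ∀ s, g s ^ p = f s ^ p * v s := by
    intro s
    simp only [hg]
    rw [ENNReal.mul_rpow_of_nonneg _ _ hp0.le, ← ENNReal.rpow_mul, one_div_mul_cancel hp0.ne',
      ENNReal.rpow_one]
  have hgw : ∀ s, 0 < s → g s * w s = f s := by
    intro s hs
    have := hvpos s ⟨hs, by simp⟩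
    simp only [hg, hw]
    rw [mul_assoc, ← ENNReal.rpow_add _ _ this.1.ne' this.2.ne]
    simp
  have hwp : ∀ s, w s ^ pc = v s ^ (1 - pc) := by
    intro s
    simp only [hw]
    rw [← ENNReal.rpow_mul, hexp]
  have H1 := hardy_aux hpp hpq μ g w U hgm hwm hUm (4 * A) (by
    intro x
    rcases le_or_gt x 0 with hx | hx
    · have : ∫⁻ s in Iio x, w s ^ pc ∂μ = 0 := by
        rw [hμ, Measure.restrict_restrict measurableSet_Iio]
        have : Iio x ∩ Ioi (0 : ℝ) = ∅ := by
          ext y; simp only [mem_inter_iff, mem_Iio, mem_Ioi, mem_empty_iff_false, iff_false]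
          rintro ⟨h1, h2⟩; linarith
        simp [this]
      rw [this, ENNReal.zero_rpow_of_pos (one_div_pos.2 hpc0)]
      simp
    have b1 := bnd_aux hq0 (c := 2 / x) (by positivity) (Ici x) measurableSet_Ici U
      (fun s => ENNReal.ofReal ((x / (s + x)) ^ q) * u s) (by fun_prop) (by
        intro t ht ht0
        simp only [hU]
        rw [← mul_assoc, ← ENNReal.ofReal_mul (by positivity)]
        gcongr
        rw [← Real.mul_rpow (by positivity) (by positivity), Real.rpow_neg ht0.le,
          ← Real.inv_rpow ht0.le]
        apply Real.rpow_le_rpow (by positivity) _ hq0.le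
        have : x ≤ t := ht
        have e : 2 / x * (x / (t + x)) = 2 / (t + x) := by field_simp
        rw [e, inv_eq_one_div, div_le_div_iff₀ ht0 (by positivity)]
        linarith)
    have b2 := bnd_aux hpc0 (c := 2 * x) (by positivity) (Iio x) measurableSet_Iio
      (fun s => w s ^ pc)
      (fun s => v s ^ (1 - pc) * ENNReal.ofReal ((s + x) ^ (-pc))) (by fun_prop) (by
        intro t ht ht0
        simp only [hwp]
        rw [mul_left_comm, ← ENNReal.ofReal_mul (by positivity)]
        refine le_mul_of_one_le_right' ?_
        rw [← ENNReal.ofReal_one]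
        apply ENNReal.ofReal_le_ofReal
        have : t < x := ht
        rw [Real.rpow_neg (by positivity), ← Real.inv_rpow (by positivity),
          ← Real.mul_rpow (by positivity) (by positivity)]
        apply Real.one_le_rpow _ hpc0.le
        rw [← div_eq_mul_inv, one_le_div (by positivity)]
        linarith)
    refine (mul_le_mul' b1 b2).trans ?_
    rw [mul_mul_mul_comm, ← ENNReal.ofReal_mul (by positivity)]
    have : 2 / x * (2 * x) = 4 := by field_simp; norm_num
    rw [this]
    refine mul_le_mul' (by simp) (hAt x hx))
  have H2 := hardy_aux' hpp hpq μ g w2 u hgm hw2m hum (4 * A) (by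
    intro x
    rcases le_or_gt x 0 with hx | hx
    · have : ∫⁻ s in Iic x, u s ∂μ = 0 := by
        rw [hμ, Measure.restrict_restrict measurableSet_Iic]
        have : Iic x ∩ Ioi (0 : ℝ) = ∅ := by
          ext y; simp only [mem_inter_iff, mem_Iic, mem_Ioi, mem_empty_iff_false, iff_false]
          rintro ⟨h1, h2⟩; linarith
        simp [this]
      rw [this, ENNReal.zero_rpow_of_pos (one_div_pos.2 hq0)]
      simp
    have b1 := bnd_aux hq0 (c := 2) (by positivity) (Iic x) measurableSet_Iic u
      (fun s => ENNReal.ofReal ((x / (s + x)) ^ q) * u s) (by fun_prop) (by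
        intro t ht ht0
        rw [← mul_assoc, ← ENNReal.ofReal_mul (by positivity)]
        refine le_mul_of_one_le_left' ?_
        rw [← ENNReal.ofReal_one]
        apply ENNReal.ofReal_le_ofReal
        have : t ≤ x := ht
        rw [← Real.mul_rpow (by positivity) (by positivity)]
        apply Real.one_le_rpow _ hq0.le
        rw [← mul_div_assoc, one_le_div (by positivity)]
        linarith)
    have b2 := bnd_aux hpc0 (c := 2) (by positivity) (Ioi x) measurableSet_Ioi
      (fun s => w2 s ^ pc)
      (fun s => v s ^ (1 - pc) * ENNReal.ofReal ((s + x) ^ (-pc))) (by fun_prop) (by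
        intro t ht ht0
        simp only [hw2]
        rw [ENNReal.mul_rpow_of_nonneg _ _ hpc0.le, hwp, mul_left_comm,
          ← ENNReal.ofReal_mul (by positivity), ENNReal.ofReal_rpow_of_nonneg (by positivity) hpc0.le]
        gcongr
        have : x < t := ht
        rw [Real.rpow_neg (by positivity), ← Real.inv_rpow (by positivity) pc,
          ← Real.mul_rpow (by positivity) (by positivity)]
        apply Real.rpow_le_rpow (by positivity) _ hpc0.le
        rw [← div_eq_mul_inv, inv_eq_one_div, div_le_div_iff₀ ht0 (by positivity)]
        linarith)
    refine (mul_le_mul' b1 b2).trans ?_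
    rw [mul_mul_mul_comm, ← ENNReal.ofReal_mul (by positivity)]
    refine mul_le_mul' (by norm_num) (hAt x hx))
  set F1 : ℝ → ℝ≥0∞ := fun x => ∫⁻ s in Iio x, g s * w s ∂μ with hF1
  set F2 : ℝ → ℝ≥0∞ := fun x => ∫⁻ s in Ioi x, g s * w2 s ∂μ with hF2
  have hF1m : Measurable F1 := by
    have : Monotone F1 := fun a b hab => lintegral_mono_set (Iio_subset_Iio hab)
    exact this.measurable
  have hF2m : Measurable F2 := by
    have : Antitone F2 := fun a b hab => lintegral_mono_set (Ioi_subset_Ioi hab)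
    exact this.measurable
  have hS : ∀ t, 0 < t → Sop f t ≤ ENNReal.ofReal (t⁻¹) * F1 t + F2 t := by
    intro t ht
    rw [Sop, ← hμ, ← lintegral_add_compl _ (measurableSet_Iio (a := t)), compl_Iio]
    have hae : ∀ᵐ s ∂μ, 0 < s := ae_restrict_mem measurableSet_Ioi
    refine add_le_add ?_ ?_
    · simp only [hF1]
      rw [← lintegral_const_mul _ (by fun_prop)]
      apply lintegral_mono_ae
      filter_upwards [ae_restrict_of_ae hae] with s hs
      rw [hgw s hs, mul_comm, div_eq_mul_inv, ← ENNReal.ofReal_inv_of_pos (by positivity)]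
      gcongr
      linarith
    · simp only [hF2]
      rw [setLIntegral_congr (Ioi_ae_eq_Ici (μ := μ)).symm]
      apply lintegral_mono_ae
      filter_upwards [ae_restrict_of_ae hae] with s hs
      rw [hw2, ← mul_assoc, hgw s hs, div_eq_mul_inv, ← ENNReal.ofReal_inv_of_pos (by positivity)]
      gcongr
      linarith
  have hN : ∫⁻ s, g s ^ p ∂μ = ∫⁻ t in Ioi (0 : ℝ), f t ^ p * v t := by simp only [hgp, hμ]
  rw [hN] at H1 H2
  set N := ∫⁻ t in Ioi (0 : ℝ), f t ^ p * v t with hNdef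
  have hpowq : ∀ a b : ℝ≥0∞, (a * b ^ (1 / q)) ^ q = a ^ q * b := by
    intro a b
    rw [ENNReal.mul_rpow_of_nonneg _ _ hq0.le, ← ENNReal.rpow_mul, one_div_mul_cancel hq0.ne',
      ENNReal.rpow_one]
  have hmink := ENNReal.lintegral_Lp_add_le (μ := μ) (p := q)
    (f := fun t => F1 t * U t ^ (1 / q)) (g := fun t => F2 t * u t ^ (1 / q))
    (by fun_prop) (by fun_prop) hq1
  simp only [Pi.add_apply, hpowq] at hmink
  have hle : ∫⁻ t in Ioi (0 : ℝ), (Sop f t) ^ q * u t ≤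
      ∫⁻ t, (F1 t * U t ^ (1 / q) + F2 t * u t ^ (1 / q)) ^ q ∂μ := by
    apply setLIntegral_mono' measurableSet_Ioi
    intro t ht
    have ht0 : (0 : ℝ) < t := ht
    rw [← hpowq]
    apply ENNReal.rpow_le_rpow _ hq0.le
    have hUq : U t ^ (1 / q) = ENNReal.ofReal (t⁻¹) * u t ^ (1 / q) := by
      simp only [hU]
      rw [ENNReal.mul_rpow_of_nonneg _ _ (one_div_pos.2 hq0).le,
        ENNReal.ofReal_rpow_of_nonneg (by positivity) (one_div_pos.2 hq0).le,
        ← Real.rpow_mul ht0.le, ← Real.rpow_neg_one]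
      congr 3
      field_simp
    rw [hUq]
    calc Sop f t * u t ^ (1 / q) ≤ (ENNReal.ofReal (t⁻¹) * F1 t + F2 t) * u t ^ (1 / q) := by
          gcongr
          exact hS t ht0
      _ = _ := by ring
  calc (∫⁻ t in Ioi (0 : ℝ), (Sop f t) ^ q * u t) ^ (1 / q)
      ≤ _ := ENNReal.rpow_le_rpow hle (one_div_pos.2 hq0).le
    _ ≤ _ := hmink
    _ ≤ _ := add_le_add H1 H2
    _ = ENNReal.ofReal 64 * A * N ^ (1 / p) := by
        rw [show ENNReal.ofReal 64 = 64 by norm_num]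
        ring

theorem lower_aux (p q : ℝ) (hp : 1 < p) (hpq : p ≤ q) (u v : ℝ → ℝ≥0∞) (hu : IsWeight ⊤ u)
    (hv : IsWeight ⊤ v) (K : ℝ≥0∞)
    (hK : ∀ f : ℝ → ℝ≥0∞, Measurable f →
            (∫⁻ t in Ioi (0 : ℝ), (Sop f t) ^ q * u t) ^ (1 / q) ≤
              K * (∫⁻ t in Ioi (0 : ℝ), f t ^ p * v t) ^ (1 / p)) :
    StieltjesConst p q u v ≤ K := by
  obtain ⟨hum, hupos, -⟩ := hu
  obtain ⟨hvm, hvpos, -⟩ := hv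
  have hp0 : 0 < p := by linarith
  have hq0 : 0 < q := by linarith
  have hpp : p.HolderConjugate (p / (p - 1)) := Real.HolderConjugate.conjExponent hp
  have hexp : (1 - p / (p - 1)) * p + 1 = 1 - p / (p - 1) := by
    have : p - 1 ≠ 0 := by linarith
    field_simp
    ring
  have hexp2 : -(p / (p - 1) - 1) * p = - (p / (p - 1)) := by
    have : p - 1 ≠ 0 := by linarith
    field_simp
    ring
  have hexp3 : 1 / (p / (p - 1)) = 1 - 1 / p := by
    have : p - 1 ≠ 0 := by linarith
    field_simp
  have hpc0 : 0 < p / (p - 1) := hpp.symm.pos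
  rw [StieltjesConst]
  set pc := p / (p - 1) with hpc
  apply iSup₂_le
  intro t ht
  set G : ℝ → ℝ≥0∞ := fun s => v s ^ (1 - pc) * ENNReal.ofReal ((s + t) ^ (-pc)) with hG
  have hGm : Measurable G := by fun_prop
  have hGtop : ∀ s, 0 < s → G s ≠ ⊤ := by
    intro s hs
    have := hvpos s ⟨hs, by simp⟩
    exact ENNReal.mul_ne_top (ENNReal.rpow_ne_top_of_ne_zero this.1.ne' this.2.ne)
      ENNReal.ofReal_ne_top
  set T := (∫⁻ s in Ioi (0 : ℝ), ENNReal.ofReal ((t / (s + t)) ^ q) * u s) ^ (1 / q) with hT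
  set D : ℕ → Set ℝ := fun n => {s | 0 < s ∧ s ≤ n ∧ G s ≤ n} with hD
  have hDm : ∀ n, MeasurableSet (D n) := fun n =>
    (measurableSet_lt measurable_const measurable_id).inter
      ((measurableSet_le measurable_id measurable_const).inter
        (measurableSet_le hGm measurable_const))
  have hDmono : Monotone D := by
    intro a b hab s hs
    have : (a : ℝ) ≤ b := by exact_mod_cast hab
    have h2 : (a : ℝ≥0∞) ≤ b := by exact_mod_cast hab
    exact ⟨hs.1, hs.2.1.trans this, hs.2.2.trans h2⟩
  have hDU : ⋃ n, D n = Ioi 0 := by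
    ext s
    simp only [mem_iUnion, mem_Ioi]
    constructor
    · rintro ⟨n, hn⟩; exact hn.1
    · intro hs
      obtain ⟨n, hn⟩ := exists_nat_ge s
      obtain ⟨m, hm⟩ := ENNReal.exists_nat_gt (hGtop s hs)
      refine ⟨max n m, hs, hn.trans ?_, hm.le.trans ?_⟩
      · exact_mod_cast le_max_left n m
      · exact_mod_cast le_max_right n m
  have hfin : ∀ n, ∫⁻ s in D n, G s ≠ ⊤ := by
    intro n
    have h1 : ∫⁻ s in D n, G s ≤ ∫⁻ s in D n, (n : ℝ≥0∞) :=
      setLIntegral_mono' (hDm n) fun s hs => hs.2.2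
    refine (h1.trans_lt ?_).ne
    rw [setLIntegral_const]
    refine ENNReal.mul_lt_top (by simp) ?_
    refine (measure_mono (t := Icc 0 (n : ℝ)) fun s hs => ⟨hs.1.le, hs.2.1⟩).trans_lt ?_
    simp
  have hn : ∀ n, T * (∫⁻ s in D n, G s) ^ (1 / pc) ≤ K := by
    intro n
    set B := ∫⁻ s in D n, G s with hB
    by_cases hB0 : B = 0
    · rw [hB0, ENNReal.zero_rpow_of_pos (one_div_pos.2 hpc0)]; simp
    set f : ℝ → ℝ≥0∞ := (D n).indicator
      (fun s => v s ^ (1 - pc) * ENNReal.ofReal ((s + t) ^ (-(pc - 1)))) with hf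
    have hfm : Measurable f := Measurable.indicator (by fun_prop) (hDm n)
    have hDI : D n ⊆ Ioi 0 := fun s hs => hs.1
    have hnorm : ∫⁻ s in Ioi (0 : ℝ), f s ^ p * v s = B := by
      have : ∀ s, f s ^ p * v s = (D n).indicator G s := by
        intro s
        by_cases hs : s ∈ D n
        · have hvs := hvpos s ⟨hs.1, by simp⟩
          have hst : 0 < s + t := add_pos hs.1 ht
          simp only [hf, indicator_of_mem hs, hG]
          rw [ENNReal.mul_rpow_of_nonneg _ _ hp0.le, ← ENNReal.rpow_mul,
            ENNReal.ofReal_rpow_of_nonneg (by positivity) hp0.le, ← Real.rpow_mul hst.le, hexp2,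
            mul_right_comm]
          congr 1
          conv_rhs => rw [← hexp]
          rw [ENNReal.rpow_add _ _ hvs.1.ne' hvs.2.ne, ENNReal.rpow_one]
        · simp [hf, indicator_of_notMem hs, hp0]
      simp only [this]
      rw [setLIntegral_indicator (hDm n), inter_eq_left.2 hDI]
    have hSop : ∀ x, 0 < x → ENNReal.ofReal (t / (x + t)) * B ≤ Sop f x := by
      intro x hx
      rw [Sop, hB, ← lintegral_const_mul _ hGm]
      have : ∫⁻ s in Ioi (0 : ℝ), f s / ENNReal.ofReal (s + x) ≥
          ∫⁻ s in D n, f s / ENNReal.ofReal (s + x) := lintegral_mono_set hDI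
      refine le_trans ?_ this
      apply setLIntegral_mono' (hDm n)
      intro s hs
      have hs0 : 0 < s := hs.1
      simp only [hf, indicator_of_mem hs, hG]
      rw [div_eq_mul_inv _ (ENNReal.ofReal (s + x)), ← ENNReal.ofReal_inv_of_pos (by positivity),
        mul_left_comm, mul_assoc,
        ← ENNReal.ofReal_mul (by positivity), ← ENNReal.ofReal_mul (by positivity)]
      refine mul_le_mul_right (ENNReal.ofReal_le_ofReal ?_) _
      have e : (s + t) ^ (-pc) = (s + t) ^ (-(pc - 1)) * (s + t)⁻¹ := by
        rw [← Real.rpow_neg_one (s + t), ← Real.rpow_add (by positivity)]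
        congr 1; ring
      rw [e, mul_left_comm]
      gcongr
      rw [← div_eq_mul_inv, div_div, inv_eq_one_div, div_le_div_iff₀ (by positivity) (by positivity)]
      nlinarith [mul_pos hs0 hx, mul_pos ht ht]
    have h1 : T * B ≤ (∫⁻ x in Ioi (0 : ℝ), (Sop f x) ^ q * u x) ^ (1 / q) := by
      have : B ^ q * ∫⁻ s in Ioi (0 : ℝ), ENNReal.ofReal ((t / (s + t)) ^ q) * u s ≤
          ∫⁻ x in Ioi (0 : ℝ), (Sop f x) ^ q * u x := by
        rw [← lintegral_const_mul _ (by fun_prop)]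
        apply setLIntegral_mono' measurableSet_Ioi
        intro x hx
        have hx0 : (0 : ℝ) < x := hx
        rw [← mul_assoc]
        gcongr
        rw [← ENNReal.ofReal_rpow_of_nonneg (by positivity) hq0.le,
          ← ENNReal.mul_rpow_of_nonneg _ _ hq0.le, mul_comm]
        exact ENNReal.rpow_le_rpow (hSop x hx0) hq0.le
      have h2 := ENNReal.rpow_le_rpow this (one_div_pos.2 hq0).le
      rw [ENNReal.mul_rpow_of_nonneg _ _ (one_div_pos.2 hq0).le, ← ENNReal.rpow_mul,
        mul_one_div_cancel hq0.ne', ENNReal.rpow_one, mul_comm] at h2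
      exact h2
    have h2 := h1.trans (hK f hfm)
    rw [hnorm] at h2
    have hBp0 : B ^ (1 / p) ≠ 0 := (ENNReal.rpow_pos (pos_iff_ne_zero.2 hB0) (hfin n)).ne'
    have hBpt : B ^ (1 / p) ≠ ⊤ := ENNReal.rpow_ne_top_of_nonneg (one_div_pos.2 hp0).le (hfin n)
    rw [hexp3, ENNReal.rpow_sub _ _ hB0 (hfin n), ENNReal.rpow_one, ← mul_div_assoc]
    exact (ENNReal.div_le_iff hBp0 hBpt).2 h2
  have hsup : ∫⁻ s in Ioi (0 : ℝ), G s = ⨆ n, ∫⁻ s in D n, G s := by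
    rw [← hDU]
    exact setLIntegral_iUnion_of_directed _ hDmono.directed_le
  have hsup2 : (∫⁻ s in Ioi (0 : ℝ), G s) ^ (1 / pc) = ⨆ n, (∫⁻ s in D n, G s) ^ (1 / pc) := by
    rw [hsup]
    exact (ENNReal.orderIsoRpow (1 / pc) (one_div_pos.2 hpc0)).map_iSup _
  rw [hsup2, ENNReal.mul_iSup]
  exact iSup_le hn

theorem statement6 (p q : ℝ) (hp : 1 < p) (hpq : p ≤ q) :
    ∃ c C : ℝ, 0 < c ∧ 0 < C ∧
      ∀ u v : ℝ → ℝ≥0∞, IsWeight ⊤ u → IsWeight ⊤ v →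
        (∀ f : ℝ → ℝ≥0∞, Measurable f →
            (∫⁻ t in Ioi (0 : ℝ), (Sop f t) ^ q * u t) ^ (1 / q) ≤
              ENNReal.ofReal C * StieltjesConst p q u v *
                (∫⁻ t in Ioi (0 : ℝ), f t ^ p * v t) ^ (1 / p)) ∧
        ∀ K : ℝ≥0∞, (∀ f : ℝ → ℝ≥0∞, Measurable f →
            (∫⁻ t in Ioi (0 : ℝ), (Sop f t) ^ q * u t) ^ (1 / q) ≤
              K * (∫⁻ t in Ioi (0 : ℝ), f t ^ p * v t) ^ (1 / p)) →
          ENNReal.ofReal c * StieltjesConst p q u v ≤ K := by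
  refine ⟨1, 64, one_pos, by norm_num, fun u v hu hv => ⟨?_, ?_⟩⟩
  · intro f hf
    exact upper_aux p q hp hpq u v hu hv f hf
  · intro K hK
    rw [ENNReal.ofReal_one, one_mul]
    exact lower_aux p q hp hpq u v hu hv K hK

end
end

section
/- Fix indices 1 < q < p < ∞ and weights u, v on (0, ∞). Then the least constant K > 0 in the inequality (∫₀^∞ (Sf)(t)^q u(t) dt)^{1/q} ≤ K (∫₀^∞ f(t)^p v(t) dt)^{1/p}, required to hold for all f ∈ M₊((0,∞)), is equivalent (up to multiplicative constants depending only on p and q) to [∫₀^∞ [(∫₀^∞ (t/(s+t))^q u(s) ds)^{1/p} (∫₀^∞ v(s)^{1-p'} (s+t)^{-p'} ds)^{1/p'}]^{pq/(p-q)} u(t) dt]^{(1/q)-(1/p)}; in particular, the inequality holds with some finite K if and only if this quantity is finite. -/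
open MeasureTheory Set ENNReal Filter

noncomputable section

/-- The Sinnamon constant for the Stieltjes transform, case `1 < q < p < ∞`. -/
def StieltjesConstQP (p q : ℝ) (u v : ℝ → ℝ≥0∞) : ℝ≥0∞ :=
  (∫⁻ t in Ioi (0 : ℝ),
      ((∫⁻ s in Ioi (0 : ℝ), ENNReal.ofReal ((t / (s + t)) ^ q) * u s) ^ (1 / p) *
        (∫⁻ s in Ioi (0 : ℝ), (v s) ^ (1 - p / (p - 1)) *
          ENNReal.ofReal ((s + t) ^ (-(p / (p - 1))))) ^ (1 / (p / (p - 1)))) ^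
        (p * q / (p - q)) * u t) ^ (1 / q - 1 / p)

theorem aux_meas_Iic (ω : Measure ℝ) (S : Set ℝ) (l : ℝ≥0∞)
    (h : ∀ s ∈ S, ω (S ∩ Iic s) ≤ l) : ω S ≤ l := by
  by_cases hm : ∃ s ∈ S, ∀ x ∈ S, x ≤ s
  · obtain ⟨s, hs, hx⟩ := hm
    refine le_trans (measure_mono ?_) (h s hs)
    exact fun x hxS => ⟨hxS, hx x hxS⟩
  · push Not at hm
    obtain ⟨T, hTS, hTc, hT⟩ := TopologicalSpace.isOpen_biUnion_countable S (fun s : ℝ => Iio s)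
      (fun i _ => isOpen_Iio)
    have h1 : S ⊆ ⋃ i ∈ T, S ∩ Iic i := by
      intro x hx
      obtain ⟨y, hy, hxy⟩ := hm x hx
      have : x ∈ ⋃ i ∈ S, Iio i := mem_biUnion hy hxy
      rw [← hT] at this
      simp only [mem_iUnion] at this ⊢
      obtain ⟨i, hi, hxi⟩ := this
      exact ⟨i, hi, hx, by simpa using le_of_lt (by simpa using hxi)⟩
    refine le_trans (measure_mono h1) ?_
    rw [measure_biUnion_eq_iSup hTc]
    · exact iSup₂_le fun i hi => h i (hTS hi)
    · intro a ha b hb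
      rcases le_total a b with hab | hab
      · exact ⟨b, hb, fun x hx => ⟨hx.1, le_trans hx.2 hab⟩, fun x hx => hx⟩
      · exact ⟨a, ha, fun x hx => hx, fun x hx => ⟨hx.1, le_trans hx.2 hab⟩⟩

theorem aux_meas_Ici (ω : Measure ℝ) (S : Set ℝ) (l : ℝ≥0∞)
    (h : ∀ s ∈ S, ω (S ∩ Ici s) ≤ l) : ω S ≤ l := by
  by_cases hm : ∃ s ∈ S, ∀ x ∈ S, s ≤ x
  · obtain ⟨s, hs, hx⟩ := hm
    refine le_trans (measure_mono ?_) (h s hs)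
    exact fun x hxS => ⟨hxS, hx x hxS⟩
  · push Not at hm
    obtain ⟨T, hTS, hTc, hT⟩ := TopologicalSpace.isOpen_biUnion_countable S (fun s : ℝ => Ioi s)
      (fun i _ => isOpen_Ioi)
    have h1 : S ⊆ ⋃ i ∈ T, S ∩ Ici i := by
      intro x hx
      obtain ⟨y, hy, hxy⟩ := hm x hx
      have : x ∈ ⋃ i ∈ S, Ioi i := mem_biUnion hy hxy
      rw [← hT] at this
      simp only [mem_iUnion] at this ⊢
      obtain ⟨i, hi, hxi⟩ := this
      exact ⟨i, hi, hx, by simpa using le_of_lt (by simpa using hxi)⟩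
    refine le_trans (measure_mono h1) ?_
    rw [measure_biUnion_eq_iSup hTc]
    · exact iSup₂_le fun i hi => h i (hTS hi)
    · intro a ha b hb
      rcases le_total a b with hab | hab
      · exact ⟨a, ha, fun x hx => hx, fun x hx => ⟨hx.1, le_trans hab hx.2⟩⟩
      · exact ⟨b, hb, fun x hx => ⟨hx.1, le_trans hab hx.2⟩, fun x hx => hx⟩

theorem aux_tail (a e : ℝ) (ha : 0 < a) (he : 0 < e) :
    ∫⁻ x in Ioi a, ENNReal.ofReal (x ^ (-e - 1)) = ENNReal.ofReal (a ^ (-e) / e) := by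
  rw [← ofReal_integral_eq_lintegral_ofReal]
  · rw [integral_Ioi_rpow_of_lt (by linarith) ha]
    congr 1
    have : -e - 1 + 1 = -e := by ring
    rw [this, neg_div_neg_eq]
  · exact integrableOn_Ioi_rpow_of_lt (by linarith) ha
  · filter_upwards [ae_restrict_mem measurableSet_Ioi] with x hx
    exact Real.rpow_nonneg (le_of_lt (lt_trans ha hx)) _

theorem aux_head (a d : ℝ) (ha : 0 < a) (hd : d < 1) :
    ∫⁻ x in Ioc 0 a, ENNReal.ofReal (x ^ (-d)) = ENNReal.ofReal (a ^ (1 - d) / (1 - d)) := by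
  rw [← ofReal_integral_eq_lintegral_ofReal]
  · rw [← intervalIntegral.integral_of_le ha.le, integral_rpow (Or.inl (by linarith))]
    congr 1
    have : -d + 1 = 1 - d := by ring
    rw [this, Real.zero_rpow (by linarith), sub_zero]
  · have := intervalIntegral.intervalIntegrable_rpow' (a := 0) (b := a) (r := -d) (by linarith)
    rwa [intervalIntegrable_iff_integrableOn_Ioc_of_le ha.le] at this
  · filter_upwards [ae_restrict_mem measurableSet_Ioc] with x hx
    exact Real.rpow_nonneg hx.1.le _

/-- lower layer cake -/
theorem aux_lower_s7 (ω : Measure ℝ) (Φ : ℝ → ℝ≥0∞) (hΦ : Measurable Φ) (D : ℝ) (hDp : 0 < D)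
    (hD : ∀ x : ℝ, 0 < x → ω {s | Φ s ≤ ENNReal.ofReal x} ≤ ENNReal.ofReal (D * x))
    (b : ℝ) (hb : 0 < b) :
    (ω univ) ^ (b + 1) ≤ ENNReal.ofReal (2 * (2 * D) ^ b) * ∫⁻ s, Φ s ^ b ∂ω := by
  have key : ∀ x : ℝ, 0 < x → ω univ ≤ ENNReal.ofReal (D * x) + ω {s | ENNReal.ofReal x < Φ s} := by
    intro x hx
    refine le_trans (measure_mono (t := {s | Φ s ≤ ENNReal.ofReal x} ∪ {s | ENNReal.ofReal x < Φ s})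
      ?_) (le_trans (measure_union_le _ _) (add_le_add_left (hD x hx) _))
    intro s _
    exact le_or_gt (Φ s) _
  have mk : ∀ x : ℝ, 0 < x →
      ENNReal.ofReal (x ^ b) * ω {s | ENNReal.ofReal x < Φ s} ≤ ∫⁻ s, Φ s ^ b ∂ω := by
    intro x hx
    refine le_trans ?_ (mul_meas_ge_le_lintegral (hΦ.pow_const b) (ENNReal.ofReal (x ^ b)))
    refine mul_le_mul_right (measure_mono fun s hs => ?_) _
    simp only [mem_ofPred_eq] at hs ⊢
    rw [← ENNReal.ofReal_rpow_of_pos hx]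
    exact ENNReal.rpow_le_rpow hs.le hb.le
  by_cases htop : ω univ = ⊤
  · have h1 := key 1 one_pos
    rw [htop, top_le_iff, ENNReal.add_eq_top] at h1
    have h2 := h1.resolve_left ENNReal.ofReal_ne_top
    have h3 := mk 1 one_pos
    rw [h2] at h3
    simp at h3
    rw [h3, ENNReal.mul_top]
    · exact le_top
    · simp; positivity
  by_cases h0 : ω univ = 0
  · rw [h0, ENNReal.zero_rpow_of_pos (by linarith)]; exact zero_le
  set M := (ω univ).toReal with hM
  have hMp : 0 < M := ENNReal.toReal_pos h0 htop
  have hMe : ω univ = ENNReal.ofReal M := (ENNReal.ofReal_toReal htop).symm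
  have hx : 0 < M / (2 * D) := by positivity
  have h1 := key _ hx
  have h2 := mk _ hx
  have h3 : ENNReal.ofReal (M / 2) ≤ ω {s | ENNReal.ofReal (M / (2 * D)) < Φ s} := by
    rw [hMe] at h1
    have e1 : D * (M / (2 * D)) = M / 2 := by field_simp
    have e2 : ENNReal.ofReal M = ENNReal.ofReal (M / 2) + ENNReal.ofReal (M / 2) := by
      rw [← ENNReal.ofReal_add (by positivity) (by positivity)]; congr 1; ring
    rw [e1, e2] at h1
    exact (ENNReal.add_le_add_iff_left ENNReal.ofReal_ne_top).1 h1
  calc (ω univ) ^ (b + 1) = ENNReal.ofReal (2 * (2 * D) ^ b) *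
        (ENNReal.ofReal ((M / (2 * D)) ^ b) * ENNReal.ofReal (M / 2)) := by
        rw [hMe, ENNReal.ofReal_rpow_of_pos hMp, ← ENNReal.ofReal_mul (by positivity),
          ← ENNReal.ofReal_mul (by positivity)]
        congr 1
        rw [Real.div_rpow hMp.le (by positivity), Real.rpow_add hMp, Real.rpow_one]
        have : (2 * D) ^ b ≠ 0 := by positivity
        field_simp
    _ ≤ _ := by
        gcongr
        exact le_trans (by gcongr) h2

/-- upper layer cake -/
theorem aux_cake (ω : Measure ℝ) [SFinite ω] (Φ : ℝ → ℝ≥0∞) (hΦ : Measurable Φ)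
    (h0 : ω {s | Φ s = 0} = 0) (e : ℝ) (he : 0 < e) :
    ∫⁻ s, Φ s ^ (-e) ∂ω ≤ ENNReal.ofReal e *
      ∫⁻ x in Ioi (0 : ℝ), ENNReal.ofReal (x ^ (-e - 1)) * ω {s | Φ s ≤ ENNReal.ofReal x} := by
  have hset : MeasurableSet {z : ℝ × ℝ | Φ z.1 ≤ ENNReal.ofReal z.2} :=
    measurableSet_le (hΦ.comp measurable_fst) (ENNReal.measurable_ofReal.comp measurable_snd)
  set G : ℝ → ℝ → ℝ≥0∞ := fun s x => ENNReal.ofReal (x ^ (-e - 1)) *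
    ({z : ℝ × ℝ | Φ z.1 ≤ ENNReal.ofReal z.2}.indicator 1 (s, x)) with hG
  have hGm : Measurable (Function.uncurry G) := by
    apply Measurable.mul
    · exact ENNReal.measurable_ofReal.comp (measurable_snd.pow_const _)
    · exact (measurable_one.indicator hset)
  have h1 : ∀ s, Φ s ≠ 0 → Φ s ^ (-e) ≤ ENNReal.ofReal e * ∫⁻ x in Ioi (0 : ℝ), G s x := by
    intro s hs
    by_cases ht : Φ s = ⊤
    · rw [ht, ENNReal.top_rpow_of_neg (by linarith)]; exact zero_le
    set a := (Φ s).toReal with ha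
    have hap : 0 < a := ENNReal.toReal_pos hs ht
    have hae : Φ s = ENNReal.ofReal a := (ENNReal.ofReal_toReal ht).symm
    calc Φ s ^ (-e) = ENNReal.ofReal e * ∫⁻ x in Ioi a, ENNReal.ofReal (x ^ (-e - 1)) := by
          rw [aux_tail a e hap he, ← ENNReal.ofReal_mul he.le, hae, ENNReal.ofReal_rpow_of_pos hap]
          congr 1; field_simp
      _ = ENNReal.ofReal e * ∫⁻ x in Ioi a, G s x := by
          congr 1
          refine setLIntegral_congr_fun measurableSet_Ioi fun x hx => ?_
          have : (s, x) ∈ {z : ℝ × ℝ | Φ z.1 ≤ ENNReal.ofReal z.2} := by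
            simp only [mem_ofPred_eq]; rw [hae]; exact ENNReal.ofReal_le_ofReal (le_of_lt hx)
          simp only [hG, indicator_of_mem this, Pi.one_apply, mul_one]
      _ ≤ _ := by
          gcongr
  calc ∫⁻ s, Φ s ^ (-e) ∂ω ≤ ∫⁻ s, (ENNReal.ofReal e * ∫⁻ x in Ioi (0 : ℝ), G s x) ∂ω := by
        apply lintegral_mono_ae
        have : ∀ᵐ s ∂ω, Φ s ≠ 0 := by
          rw [ae_iff]; simpa using h0
        filter_upwards [this] with s hs using h1 s hs
    _ = ENNReal.ofReal e * ∫⁻ x in Ioi (0 : ℝ), (∫⁻ s, G s x ∂ω) := by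
        rw [lintegral_const_mul' _ _ ENNReal.ofReal_ne_top, lintegral_lintegral_swap hGm.aemeasurable]
    _ = _ := by
        congr 1
        refine lintegral_congr fun x => ?_
        simp only [hG]
        rw [lintegral_const_mul' _ _ ENNReal.ofReal_ne_top]
        congr 1
        have : ∀ s, ({z : ℝ × ℝ | Φ z.1 ≤ ENNReal.ofReal z.2}.indicator (1 : ℝ × ℝ → ℝ≥0∞) (s, x))
          = {s | Φ s ≤ ENNReal.ofReal x}.indicator 1 s := fun s => rfl
        simp only [this]
        rw [lintegral_indicator_one (measurableSet_le hΦ measurable_const)]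

theorem aux_null (ω : Measure ℝ) (Φ : ℝ → ℝ≥0∞) (D : ℝ)
    (hD : ∀ x : ℝ, 0 < x → ω {s | Φ s ≤ ENNReal.ofReal x} ≤ ENNReal.ofReal (D * x)) :
    ω {s | Φ s = 0} = 0 := by
  have h : ∀ x : ℝ, 0 < x → ω {s | Φ s = 0} ≤ ENNReal.ofReal (D * x) := fun x hx =>
    le_trans (measure_mono fun s (hs : Φ s = 0) => by simp [hs]) (hD x hx)
  have ht : Tendsto (fun x : ℝ => ENNReal.ofReal (D * x)) (nhdsWithin 0 (Ioi 0)) (nhds 0) := by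
    have : Tendsto (fun x : ℝ => ENNReal.ofReal (D * x)) (nhds 0) (nhds (ENNReal.ofReal (D * 0))) :=
      (ENNReal.continuous_ofReal.comp (continuous_const.mul continuous_id)).tendsto 0
    simp only [mul_zero, ENNReal.ofReal_zero] at this
    exact this.mono_left nhdsWithin_le_nhds
  refine le_antisymm (ge_of_tendsto ht ?_) zero_le
  filter_upwards [self_mem_nhdsWithin] with x hx using h x hx

theorem aux_upper_b (ω : Measure ℝ) [SFinite ω] (Φ : ℝ → ℝ≥0∞) (hΦ : Measurable Φ) (D : ℝ)
    (hDp : 0 < D)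
    (hD : ∀ x : ℝ, 0 < x → ω {s | Φ s ≤ ENNReal.ofReal x} ≤ ENNReal.ofReal (D * x))
    (d : ℝ) (hd : 0 < d) (hd1 : d < 1) :
    ∫⁻ s, Φ s ^ (-d) ∂ω ≤ ENNReal.ofReal (d * D / (1 - d) + 1) * (ω univ) ^ (1 - d) := by
  have h1d : 0 < 1 - d := by linarith
  have hC : 0 < d * D / (1 - d) + 1 := by positivity
  by_cases htop : ω univ = ⊤
  · rw [htop, ENNReal.top_rpow_of_pos h1d, ENNReal.mul_top (by simpa using hC)]
    exact le_top
  by_cases h0 : ω univ = 0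
  · rw [Measure.measure_univ_eq_zero.1 h0]; simp
  set M := (ω univ).toReal with hM
  have hMp : 0 < M := ENNReal.toReal_pos h0 htop
  have hMe : ω univ = ENNReal.ofReal M := (ENNReal.ofReal_toReal htop).symm
  refine le_trans (aux_cake ω Φ hΦ (aux_null ω Φ D hD) d hd) ?_
  have hI : ∫⁻ x in Ioi (0 : ℝ), ENNReal.ofReal (x ^ (-d - 1)) * ω {s | Φ s ≤ ENNReal.ofReal x} ≤
      ENNReal.ofReal (D * (M ^ (1 - d) / (1 - d))) + ENNReal.ofReal (M * (M ^ (-d) / d)) := by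
    rw [← Ioc_union_Ioi_eq_Ioi hMp.le]
    refine le_trans (lintegral_union_le _ _ _) (add_le_add ?_ ?_)
    · rw [ENNReal.ofReal_mul hDp.le, ← aux_head M d hMp hd1,
        ← lintegral_const_mul' _ _ ENNReal.ofReal_ne_top]
      refine setLIntegral_mono' measurableSet_Ioc fun x hx => ?_
      refine le_trans (mul_le_mul_right (hD x hx.1) _) (le_of_eq ?_)
      rw [← ENNReal.ofReal_mul (by have := hx.1; positivity), ← ENNReal.ofReal_mul hDp.le]
      congr 1
      rw [Real.rpow_sub_one hx.1.ne']
      have := hx.1.ne'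
      field_simp
    · rw [ENNReal.ofReal_mul hMp.le, ← aux_tail M d hMp hd,
        ← lintegral_const_mul' _ _ ENNReal.ofReal_ne_top]
      refine setLIntegral_mono' measurableSet_Ioi fun x hx => ?_
      rw [mul_comm, ← hMe]
      gcongr
      exact subset_univ _
  refine le_trans (mul_le_mul_right hI _) (le_of_eq ?_)
  rw [hMe, ENNReal.ofReal_rpow_of_pos hMp, ← ENNReal.ofReal_add (by positivity) (by positivity),
    ← ENNReal.ofReal_mul hd.le, ← ENNReal.ofReal_mul hC.le]
  congr 1
  have : M ^ (1 - d) = M * M ^ (-d) := by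
    rw [sub_eq_add_neg, Real.rpow_add hMp, Real.rpow_one]
  rw [this]
  field_simp

theorem aux_upper_c (ω : Measure ℝ) [SFinite ω] (Φ : ℝ → ℝ≥0∞) (hΦ : Measurable Φ) (D : ℝ)
    (hDp : 0 < D)
    (hD : ∀ x : ℝ, 0 < x → ω {s | Φ s ≤ ENNReal.ofReal x} ≤ ENNReal.ofReal (D * x))
    (d : ℝ) (hd : 0 < d) (c : ℝ) (hc : 0 < c) (hΦc : ∀ᵐ s ∂ω, ENNReal.ofReal c ≤ Φ s) :
    ∫⁻ s, Φ s ^ (-(1 + d)) ∂ω ≤ ENNReal.ofReal ((1 + d) * D / d * c ^ (-d)) := by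
  refine le_trans (aux_cake ω Φ hΦ (aux_null ω Φ D hD) (1 + d) (by positivity)) ?_
  have hI : ∫⁻ x in Ioi (0 : ℝ), ENNReal.ofReal (x ^ (-(1 + d) - 1)) *
      ω {s | Φ s ≤ ENNReal.ofReal x} ≤ ENNReal.ofReal (D * (c ^ (-d) / d)) := by
    rw [ENNReal.ofReal_mul hDp.le, ← aux_tail c d hc hd,
        ← lintegral_const_mul' _ _ ENNReal.ofReal_ne_top]
    have hz : ∀ x : ℝ, x < c → ω {s | Φ s ≤ ENNReal.ofReal x} = 0 := by
      intro x hx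
      rw [ae_iff] at hΦc
      refine measure_mono_null (fun s hs => ?_) hΦc
      simp only [mem_ofPred_eq] at hs ⊢
      rw [not_le]
      exact lt_of_le_of_lt hs ((ENNReal.ofReal_lt_ofReal_iff hc).2 hx)
    rw [← lintegral_indicator measurableSet_Ioi, ← lintegral_indicator measurableSet_Ioi]
    have hcn : ∀ᵐ x : ℝ, x ≠ c := by
      rw [ae_iff]; simp
    refine lintegral_mono_ae ?_
    filter_upwards [hcn] with x hxc
    by_cases hx : x ∈ Ioi c
    · have hx0 : (0 : ℝ) < x := lt_trans hc hx
      rw [indicator_of_mem hx, indicator_of_mem (show x ∈ Ioi (0 : ℝ) from hx0)]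
      refine le_trans (mul_le_mul_right (hD x hx0) _) (le_of_eq ?_)
      rw [← ENNReal.ofReal_mul (by positivity), ← ENNReal.ofReal_mul hDp.le]
      congr 1
      have : -(1 + d) - 1 = (-d - 1) - 1 := by ring
      rw [this, Real.rpow_sub_one hx0.ne' (-d - 1)]
      field_simp
    · have : x < c := lt_of_le_of_ne (not_lt.1 hx) hxc
      refine le_trans (indicator_le_self _ _ x) ?_
      rw [hz x this, mul_zero]; exact zero_le
  refine le_trans (mul_le_mul_right hI _) (le_of_eq ?_)
  rw [← ENNReal.ofReal_mul (by positivity)]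
  congr 1
  field_simp

/-- generalized Stieltjes transform -/
def Phi (m : ℝ) (w : ℝ → ℝ≥0∞) (t : ℝ) : ℝ≥0∞ :=
  ∫⁻ s in Ioi (0 : ℝ), w s * ENNReal.ofReal ((s + t) ^ (-m))

theorem Phi_measurable (m : ℝ) (w : ℝ → ℝ≥0∞) (hw : Measurable w) : Measurable (Phi m w) := by
  unfold Phi
  apply Measurable.lintegral_prod_right'
    (f := fun z : ℝ × ℝ => w z.2 * ENNReal.ofReal ((z.2 + z.1) ^ (-m)))
  fun_prop

theorem aux_mul_rpow (c x : ℝ≥0∞) (b : ℝ) (h0 : c ≠ 0) (ht : c ≠ ⊤) :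
    (c * x) ^ b = c ^ b * x ^ b := by
  rw [ENNReal.mul_rpow_eq_ite, if_neg]
  rintro ⟨h | h, _⟩
  · exact h0 h.1
  · exact ht h.1

theorem Phi_mono (m : ℝ) (hm : 0 < m) (w : ℝ → ℝ≥0∞) (s t : ℝ) (hs : 0 < s) (ht : 0 < t) :
    Phi m w t ≤ ENNReal.ofReal (((s + t) / t) ^ m) * Phi m w s := by
  unfold Phi
  rw [← lintegral_const_mul' _ _ ENNReal.ofReal_ne_top]
  refine setLIntegral_mono' measurableSet_Ioi fun x hx => ?_
  have hx : 0 < x := hx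
  rw [mul_left_comm]
  gcongr
  rw [← ENNReal.ofReal_mul (by positivity)]
  apply ENNReal.ofReal_le_ofReal
  rw [Real.rpow_neg (by positivity), Real.rpow_neg (by positivity), ← Real.inv_rpow (by positivity),
    ← Real.inv_rpow (by positivity), ← Real.mul_rpow (by positivity) (by positivity)]
  apply Real.rpow_le_rpow (by positivity) _ hm.le
  rw [← one_div, ← one_div, div_mul_div_comm, div_le_div_iff₀ (by positivity) (by positivity)]
  nlinarith [mul_pos hs hx, mul_pos hs ht, mul_pos hx ht]

theorem aux_density (m k s : ℝ) (hk : 0 ≤ k) (_hs : 0 < s) (w : ℝ → ℝ≥0∞) (d : ℝ → ℝ)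
    (E : Set ℝ) (hE : MeasurableSet E) (hE0 : E ⊆ Ioi 0)
    (h : ∀ x ∈ E, d x ≤ k * (x + s) ^ (-m)) :
    ((volume.restrict (Ioi (0 : ℝ))).withDensity (fun x => w x * ENNReal.ofReal (d x))) E ≤
      ENNReal.ofReal k * Phi m w s := by
  rw [withDensity_apply _ hE, Measure.restrict_restrict hE, inter_eq_left.2 hE0]
  unfold Phi
  rw [← lintegral_const_mul' _ _ ENNReal.ofReal_ne_top]
  refine le_trans (setLIntegral_mono' hE fun x hx => ?_) (lintegral_mono_set hE0)
  rw [mul_left_comm, ← ENNReal.ofReal_mul hk]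
  gcongr
  exact h x hx

theorem aux_zero (f : ℝ → ℝ≥0∞) :
    ((volume.restrict (Ioi (0 : ℝ))).withDensity f) (Iic 0) = 0 := by
  rw [withDensity_apply _ measurableSet_Iic, Measure.restrict_restrict measurableSet_Iic]
  have : Iic (0 : ℝ) ∩ Ioi 0 = ∅ := by
    ext x; simp
  rw [this]; exact setLIntegral_empty _

theorem aux_level1 (ω : Measure ℝ) (h0 : ω (Iic 0) = 0) (Ψ : ℝ → ℝ≥0∞) (D t : ℝ) (hD : 0 < D)
    (h1 : ∀ s, 0 < s → s ≤ t → ω (Ioc 0 s) ≤ ENNReal.ofReal D * Ψ s)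
    (h2 : ∀ s, 0 < s → t < s → ω (Ici s) ≤ ENNReal.ofReal D * Ψ s) (x : ℝ) (hx : 0 < x) :
    ω {s | Ψ s ≤ ENNReal.ofReal x} ≤ ENNReal.ofReal (2 * D * x) := by
  have e : ENNReal.ofReal (2 * D * x) = 0 + (ENNReal.ofReal D * ENNReal.ofReal x +
      ENNReal.ofReal D * ENNReal.ofReal x) := by
    rw [← ENNReal.ofReal_mul hD.le, ← ENNReal.ofReal_add (by positivity) (by positivity), zero_add]
    congr 1; ring
  rw [e]
  refine le_trans (measure_mono (t := Iic 0 ∪ ({s | (0 < s ∧ s ≤ t) ∧ Ψ s ≤ ENNReal.ofReal x} ∪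
    {s | (0 < s ∧ t < s) ∧ Ψ s ≤ ENNReal.ofReal x})) ?_) ?_
  · intro s hs
    simp only [mem_ofPred_eq, mem_union, mem_Iic] at hs ⊢
    rcases le_or_gt s 0 with h | h
    · exact Or.inl h
    · rcases le_or_gt s t with h' | h'
      · exact Or.inr (Or.inl ⟨⟨h, h'⟩, hs⟩)
      · exact Or.inr (Or.inr ⟨⟨h, h'⟩, hs⟩)
  refine le_trans (measure_union_le _ _) (add_le_add h0.le (le_trans (measure_union_le _ _)
    (add_le_add ?_ ?_)))
  · apply aux_meas_Iic
    intro s hs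
    simp only [mem_ofPred_eq] at hs
    refine le_trans (measure_mono ?_) (le_trans (h1 s hs.1.1 hs.1.2) (mul_le_mul_right hs.2 _))
    intro y hy
    simp only [mem_ofPred_eq, mem_inter_iff, mem_Iic] at hy
    exact ⟨hy.1.1.1, hy.2⟩
  · apply aux_meas_Ici
    intro s hs
    simp only [mem_ofPred_eq] at hs
    refine le_trans (measure_mono ?_) (le_trans (h2 s hs.1.1 hs.1.2) (mul_le_mul_right hs.2 _))
    exact inter_subset_right

theorem aux_level2 (ω : Measure ℝ) (h0 : ω (Iic 0) = 0) (Ψ : ℝ → ℝ≥0∞) (D t : ℝ) (hD : 0 < D)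
    (h1 : ∀ s, 0 < s → s ≤ t → ω (Icc s t) ≤ ENNReal.ofReal D * Ψ s)
    (h2 : ∀ s, 0 < s → t < s → ω (Ioc t s) ≤ ENNReal.ofReal D * Ψ s) (x : ℝ) (hx : 0 < x) :
    ω {s | Ψ s ≤ ENNReal.ofReal x} ≤ ENNReal.ofReal (2 * D * x) := by
  have e : ENNReal.ofReal (2 * D * x) = 0 + (ENNReal.ofReal D * ENNReal.ofReal x +
      ENNReal.ofReal D * ENNReal.ofReal x) := by
    rw [← ENNReal.ofReal_mul hD.le, ← ENNReal.ofReal_add (by positivity) (by positivity), zero_add]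
    congr 1; ring
  rw [e]
  refine le_trans (measure_mono (t := Iic 0 ∪ ({s | (0 < s ∧ s ≤ t) ∧ Ψ s ≤ ENNReal.ofReal x} ∪
    {s | (0 < s ∧ t < s) ∧ Ψ s ≤ ENNReal.ofReal x})) ?_) ?_
  · intro s hs
    simp only [mem_ofPred_eq, mem_union, mem_Iic] at hs ⊢
    rcases le_or_gt s 0 with h | h
    · exact Or.inl h
    · rcases le_or_gt s t with h' | h'
      · exact Or.inr (Or.inl ⟨⟨h, h'⟩, hs⟩)
      · exact Or.inr (Or.inr ⟨⟨h, h'⟩, hs⟩)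
  refine le_trans (measure_union_le _ _) (add_le_add h0.le (le_trans (measure_union_le _ _)
    (add_le_add ?_ ?_)))
  · apply aux_meas_Ici
    intro s hs
    simp only [mem_ofPred_eq] at hs
    refine le_trans (measure_mono ?_) (le_trans (h1 s hs.1.1 hs.1.2) (mul_le_mul_right hs.2 _))
    intro y hy
    simp only [mem_ofPred_eq, mem_inter_iff, mem_Ici] at hy
    exact ⟨hy.2, hy.1.1.2⟩
  · apply aux_meas_Iic
    intro s hs
    simp only [mem_ofPred_eq] at hs
    refine le_trans (measure_mono ?_) (le_trans (h2 s hs.1.1 hs.1.2) (mul_le_mul_right hs.2 _))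
    intro y hy
    simp only [mem_ofPred_eq, mem_inter_iff, mem_Iic] at hy
    exact ⟨hy.1.1.2, hy.2⟩

/-- the measure `ω_t` -/
def om (m : ℝ) (w : ℝ → ℝ≥0∞) (t : ℝ) : Measure ℝ :=
  (volume.restrict (Ioi (0 : ℝ))).withDensity (fun x => w x * ENNReal.ofReal ((x + t) ^ (-m)))

/-- the measure `ω'_t` -/
def om2 (m : ℝ) (w : ℝ → ℝ≥0∞) (t : ℝ) : Measure ℝ :=
  (volume.restrict (Ioi (0 : ℝ))).withDensity
    (fun x => w x * ENNReal.ofReal (((x + t) / (x * t)) ^ m))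

instance om_sf (m : ℝ) (w : ℝ → ℝ≥0∞) (t : ℝ) : SFinite (om m w t) := by
  unfold om; infer_instance

instance om2_sf (m : ℝ) (w : ℝ → ℝ≥0∞) (t : ℝ) : SFinite (om2 m w t) := by
  unfold om2; infer_instance

theorem om_univ (m : ℝ) (w : ℝ → ℝ≥0∞) (t : ℝ) : om m w t univ = Phi m w t := by
  unfold om Phi
  rw [withDensity_apply _ MeasurableSet.univ, Measure.restrict_univ]

theorem om_level (m : ℝ) (hm : 0 < m) (w : ℝ → ℝ≥0∞) (t : ℝ) (ht : 0 < t) (x : ℝ) (hx : 0 < x) :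
    om m w t {s | ENNReal.ofReal ((s / (s + t)) ^ m) * Phi m w s ≤ ENNReal.ofReal x} ≤
      ENNReal.ofReal (2 * 4 ^ m * x) := by
  have main : ∀ s y : ℝ, 0 < s → 0 < y → (s + t) * (y + s) ≤ 4 * s * (y + t) →
      (y + t) ^ (-m) ≤ (4 ^ m * (s / (s + t)) ^ m) * (y + s) ^ (-m) := by
    intro s y hs hy h
    rw [Real.rpow_neg (by positivity), Real.rpow_neg (by positivity),
      ← Real.inv_rpow (by positivity), ← Real.inv_rpow (by positivity),
      ← Real.mul_rpow (by positivity) (by positivity),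
      ← Real.mul_rpow (by positivity) (by positivity)]
    apply Real.rpow_le_rpow (by positivity) _ hm.le
    rw [← one_div, ← one_div, ← mul_div_assoc 4, div_mul_div_comm,
      div_le_div_iff₀ (by positivity) (by positivity)]
    linarith
  refine aux_level1 _ (aux_zero _) _ (4 ^ m) t (by positivity) ?_ ?_ x hx
  · intro s hs hst
    rw [← mul_assoc, ← ENNReal.ofReal_mul (by positivity)]
    refine aux_density m _ s (by positivity) hs w _ _ measurableSet_Ioc (fun y hy => hy.1) ?_
    intro y hy
    have hy0 : 0 < y := hy.1
    refine main s y hs hy0 ?_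
    have : y ≤ s := hy.2
    nlinarith [mul_pos hs hy0, mul_pos hs ht, mul_le_mul (add_le_add_left hst t) (add_le_add_left this s) (by positivity) (by positivity)]
  · intro s hs hst
    rw [← mul_assoc, ← ENNReal.ofReal_mul (by positivity)]
    refine aux_density m _ s (by positivity) hs w _ _ measurableSet_Ici
      (fun y hy => lt_of_lt_of_le hs hy) ?_
    intro y hy
    have hy1 : s ≤ y := hy
    have hy0 : 0 < y := by linarith
    refine main s y hs hy0 ?_
    nlinarith [mul_pos hs hy0, mul_pos hs ht, mul_le_mul (add_le_add_right hst.le s) (add_le_add_right hy1 y) (by positivity) (by positivity)]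

theorem om2_level (m : ℝ) (hm : 0 < m) (w : ℝ → ℝ≥0∞) (t : ℝ) (ht : 0 < t) (x : ℝ) (hx : 0 < x) :
    om2 m w t {s | ENNReal.ofReal (((s + t) / t) ^ m) * Phi m w s ≤ ENNReal.ofReal x} ≤
      ENNReal.ofReal (2 * 4 ^ m * x) := by
  have main : ∀ s y : ℝ, 0 < s → 0 < y → (y + t) * (y + s) ≤ 4 * y * (s + t) →
      ((y + t) / (y * t)) ^ m ≤ (4 ^ m * ((s + t) / t) ^ m) * (y + s) ^ (-m) := by
    intro s y hs hy h
    rw [Real.rpow_neg (by positivity), ← Real.inv_rpow (by positivity),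
      ← Real.mul_rpow (by positivity) (by positivity),
      ← Real.mul_rpow (by positivity) (by positivity)]
    apply Real.rpow_le_rpow (by positivity) _ hm.le
    rw [← one_div, ← mul_div_assoc 4, div_mul_div_comm,
      div_le_div_iff₀ (by positivity) (by positivity)]
    nlinarith
  refine aux_level2 _ (aux_zero _) _ (4 ^ m) t (by positivity) ?_ ?_ x hx
  · intro s hs hst
    rw [← mul_assoc, ← ENNReal.ofReal_mul (by positivity)]
    refine aux_density m _ s (by positivity) hs w _ _ measurableSet_Icc
      (fun y hy => lt_of_lt_of_le hs hy.1) ?_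
    intro y hy
    have hy1 : s ≤ y := hy.1
    have hy2 : y ≤ t := hy.2
    have hy0 : 0 < y := by linarith
    refine main s y hs hy0 ?_
    nlinarith [mul_pos hs hy0, mul_pos hs ht, mul_le_mul (add_le_add_left hy2 t) (add_le_add_right hy1 y) (by positivity) (by positivity)]
  · intro s hs hst
    rw [← mul_assoc, ← ENNReal.ofReal_mul (by positivity)]
    refine aux_density m _ s (by positivity) hs w _ _ measurableSet_Ioc
      (fun y hy => lt_trans ht hy.1) ?_
    intro y hy
    have hy1 : t < y := hy.1
    have hy2 : y ≤ s := hy.2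
    have hy0 : 0 < y := by linarith
    refine main s y hs hy0 ?_
    nlinarith [mul_pos hs hy0, mul_pos hs ht, mul_le_mul (add_le_add_right hy1.le y) (add_le_add_left hy2 s) (by positivity) (by positivity)]

/-- kernel `κ` -/
theorem om_int (m : ℝ) (w : ℝ → ℝ≥0∞) (hw : Measurable w) (t : ℝ) (ht : 0 < t) (b : ℝ) :
    ∫⁻ s, (ENNReal.ofReal ((s / (s + t)) ^ m) * Phi m w s) ^ b ∂(om m w t) =
      ∫⁻ s in Ioi (0 : ℝ), w s * ENNReal.ofReal (s ^ (m * b) * (s + t) ^ (-(m * (b + 1)))) *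
        Phi m w s ^ b := by
  have hΦ := Phi_measurable m w hw
  unfold om
  rw [lintegral_withDensity_eq_lintegral_mul _ (by fun_prop) (by fun_prop)]
  refine setLIntegral_congr_fun measurableSet_Ioi fun s hs => ?_
  have hs : 0 < s := hs
  simp only [Pi.mul_apply]
  rw [aux_mul_rpow _ _ _ (by simpa using by positivity) ENNReal.ofReal_ne_top, ← mul_assoc,
    mul_assoc (w s)]
  congr 2
  rw [ENNReal.ofReal_rpow_of_pos (by positivity), ← ENNReal.ofReal_mul (by positivity)]
  congr 1
  rw [← Real.rpow_mul (by positivity), Real.div_rpow hs.le (by positivity), mul_div_left_comm,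
    ← Real.rpow_sub (by positivity)]
  congr 2; ring

theorem Phi_G (m : ℝ) (hm : 0 < m) (b : ℝ) (hb : 0 < b) : ∃ C : ℝ, 0 < C ∧
    ∀ w : ℝ → ℝ≥0∞, Measurable w → ∀ t : ℝ, 0 < t →
    Phi m w t ^ (b + 1) ≤ ENNReal.ofReal C *
      ∫⁻ s in Ioi (0 : ℝ), w s * ENNReal.ofReal (s ^ (m * b) * (s + t) ^ (-(m * (b + 1)))) *
        Phi m w s ^ b := by
  refine ⟨2 * (2 * (2 * 4 ^ m)) ^ b, by positivity, fun w hw t ht => ?_⟩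
  have hΦ := Phi_measurable m w hw
  rw [← om_int m w hw t ht b, ← om_univ m w t]
  exact aux_lower_s7 (om m w t) _ (by fun_prop) (2 * 4 ^ m) (by positivity)
    (fun x hx => om_level m hm w t ht x hx) b hb

theorem Phi_G' (m : ℝ) (hm : 0 < m) (b : ℝ) (hb : 0 < b) (w : ℝ → ℝ≥0∞) (hw : Measurable w)
    (t : ℝ) (ht : 0 < t) :
    ∫⁻ s in Ioi (0 : ℝ), w s * ENNReal.ofReal (s ^ (m * b) * (s + t) ^ (-(m * (b + 1)))) *
        Phi m w s ^ b ≤ Phi m w t ^ (b + 1) := by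
  have hΦ := Phi_measurable m w hw
  rw [← om_int m w hw t ht b, add_comm b 1, ENNReal.rpow_add_of_nonneg _ _ zero_le_one hb.le,
    ENNReal.rpow_one, mul_comm]
  nth_rw 2 [← om_univ m w t]
  rw [← lintegral_const]
  refine lintegral_mono_ae ?_
  have : ∀ᵐ s ∂(om m w t), s ∉ Iic (0 : ℝ) := by
    simp only [ae_iff, not_not]; exact aux_zero _
  filter_upwards [this] with s hs
  have hs : 0 < s := by simpa using hs
  refine ENNReal.rpow_le_rpow ?_ hb.le
  refine le_trans (mul_le_mul_right (Phi_mono m hm w t s ht hs) _) ?_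
  rw [← mul_assoc, ← ENNReal.ofReal_mul (by positivity), ← Real.mul_rpow (by positivity) (by positivity)]
  have : s / (s + t) * ((t + s) / s) = 1 := by field_simp; ring
  rw [this]; simp

theorem Phi_Gneg (m : ℝ) (hm : 0 < m) (d : ℝ) (hd : 0 < d) (hd1 : d < 1) : ∃ C : ℝ, 0 < C ∧
    ∀ w : ℝ → ℝ≥0∞, Measurable w → ∀ t : ℝ, 0 < t →
      ∫⁻ s in Ioi (0 : ℝ), w s * ENNReal.ofReal (s ^ (m * (-d)) * (s + t) ^ (-(m * (-d + 1)))) *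
        Phi m w s ^ (-d) ≤ ENNReal.ofReal C * Phi m w t ^ (1 - d) := by
  have : 0 < 1 - d := by linarith
  refine ⟨d * (2 * 4 ^ m) / (1 - d) + 1, by positivity, fun w hw t ht => ?_⟩
  have hΦ := Phi_measurable m w hw
  rw [← om_int m w hw t ht (-d), ← om_univ m w t]
  exact aux_upper_b (om m w t) _ (by fun_prop) (2 * 4 ^ m) (by positivity)
    (fun x hx => om_level m hm w t ht x hx) d hd hd1

theorem Phi_N (m : ℝ) (hm : 0 < m) : ∃ C : ℝ, 0 < C ∧
    ∀ w : ℝ → ℝ≥0∞, Measurable w → ∀ t : ℝ, 0 < t → Phi m w t ≠ 0 → Phi m w t ≠ ⊤ →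
      ∫⁻ s in Ioi (0 : ℝ), w s * ENNReal.ofReal (s ^ (-m) * (s + t) ^ (-1 : ℝ)) *
        Phi m w s ^ (-(1 + 1 / m)) ≤
      ENNReal.ofReal C * (ENNReal.ofReal (t ^ (-1 : ℝ)) * Phi m w t ^ (-(1 / m))) := by
  refine ⟨(1 + 1 / m) * (2 * 4 ^ m) / (1 / m), by positivity, fun w hw t ht h0 htop => ?_⟩
  have hΦ := Phi_measurable m w hw
  set c := (Phi m w t).toReal with hc
  have hcp : 0 < c := ENNReal.toReal_pos h0 htop
  have hce : Phi m w t = ENNReal.ofReal c := (ENNReal.ofReal_toReal htop).symm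
  have h := aux_upper_c (om2 m w t) (fun s => ENNReal.ofReal (((s + t) / t) ^ m) * Phi m w s)
    (by fun_prop) (2 * 4 ^ m) (by positivity)
    (fun x hx => om2_level m hm w t ht x hx) (1 / m) (by positivity) c hcp ?_
  · have e : ∫⁻ s, (ENNReal.ofReal (((s + t) / t) ^ m) * Phi m w s) ^ (-(1 + 1 / m)) ∂(om2 m w t) =
        ENNReal.ofReal t * ∫⁻ s in Ioi (0 : ℝ), w s * ENNReal.ofReal (s ^ (-m) * (s + t) ^ (-1 : ℝ)) *
        Phi m w s ^ (-(1 + 1 / m)) := by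
      unfold om2
      rw [lintegral_withDensity_eq_lintegral_mul _ (by fun_prop) (by fun_prop),
        ← lintegral_const_mul' _ _ ENNReal.ofReal_ne_top]
      refine setLIntegral_congr_fun measurableSet_Ioi fun s hs => ?_
      have hs : 0 < s := hs
      simp only [Pi.mul_apply]
      rw [aux_mul_rpow _ _ _ (by simpa using by positivity) ENNReal.ofReal_ne_top, ← mul_assoc,
        mul_assoc (w s), ← mul_assoc (ENNReal.ofReal t), mul_left_comm (ENNReal.ofReal t)]
      congr 2
      rw [ENNReal.ofReal_rpow_of_pos (by positivity), ← ENNReal.ofReal_mul (by positivity),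
        ← ENNReal.ofReal_mul (by positivity)]
      congr 1
      rw [← Real.rpow_mul (by positivity)]
      have e1 : m * (-(1 + 1 / m)) = -m - 1 := by field_simp; ring
      rw [e1, Real.div_rpow (by positivity) (by positivity), Real.div_rpow (by positivity) (by positivity),
        Real.mul_rpow hs.le ht.le, Real.rpow_sub_one (by positivity), Real.rpow_sub_one (by positivity),
        Real.rpow_neg_one, Real.rpow_neg (by positivity), Real.rpow_neg (by positivity), Real.rpow_neg (by positivity)]
      field_simp
    rw [e] at h
    rw [hce, ENNReal.ofReal_rpow_of_pos hcp, ← ENNReal.ofReal_mul (by positivity),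
      ← ENNReal.ofReal_mul (by positivity)]
    set I := ∫⁻ s in Ioi (0 : ℝ), w s * ENNReal.ofReal (s ^ (-m) * (s + t) ^ (-1 : ℝ)) *
        Phi m w s ^ (-(1 + 1 / m))
    calc I = ENNReal.ofReal (t ^ (-1 : ℝ)) * (ENNReal.ofReal t * I) := by
          rw [← mul_assoc, ← ENNReal.ofReal_mul (by positivity), Real.rpow_neg_one,
            inv_mul_cancel₀ ht.ne']; simp
      _ ≤ _ := mul_le_mul_right h _
      _ = _ := by
          rw [← ENNReal.ofReal_mul (by positivity)]
          congr 1; ring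
  · have : ∀ᵐ s ∂(om2 m w t), s ∉ Iic (0 : ℝ) := by
      simp only [ae_iff, not_not]; exact aux_zero _
    filter_upwards [this] with s hs
    have hs : 0 < s := by simpa using hs
    rw [← hce]
    exact Phi_mono m hm w s t hs ht

def Uf (q : ℝ) (u : ℝ → ℝ≥0∞) (t : ℝ) : ℝ≥0∞ := ENNReal.ofReal (t ^ q) * Phi q u t

theorem Uf_measurable (q : ℝ) (u : ℝ → ℝ≥0∞) (hu : Measurable u) : Measurable (Uf q u) := by
  have := Phi_measurable q u hu
  unfold Uf
  fun_prop

def Aint (p q m r : ℝ) (u σ : ℝ → ℝ≥0∞) : ℝ≥0∞ :=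
  ∫⁻ t in Ioi (0 : ℝ), u t * (Uf q u t ^ (r / p) * Phi m σ t ^ (r / m))

def Bint (q m r : ℝ) (u σ : ℝ → ℝ≥0∞) : ℝ≥0∞ :=
  ∫⁻ s in Ioi (0 : ℝ), σ s * (ENNReal.ofReal (s ^ (-m)) * (Uf q u s ^ (r / q) *
    Phi m σ s ^ (r - r / q)))

theorem expo (p q m r : ℝ) (hq : 1 < q) (hqp : q < p) (hm : m = p / (p - 1))
    (hr : r = p * q / (p - q)) : 1 < m ∧ 0 < r ∧ r / q = r / p + 1 ∧ r / m = r - r / q + 1 ∧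
      m / p = m - 1 ∧ 0 < r - r / q ∧ 1 / p + 1 / m = 1 ∧ q / r = (p - q) / p := by
  have h1 : 0 < p - 1 := by linarith
  have h2 : 0 < p - q := by linarith
  have h3 : 0 < p := by linarith
  have h4 : 0 < q := by linarith
  have hr0 : 0 < r := by rw [hr]; positivity
  have hrq : r - r / q = p * (q - 1) / (p - q) := by rw [hr]; field_simp
  refine ⟨?_, hr0, ?_, ?_, ?_, ?_, ?_, ?_⟩
  · rw [hm, lt_div_iff₀ h1]; linarith
  · rw [hr]; field_simp; ring
  · rw [hrq, hr, hm]; field_simp; ring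
  · rw [hm]; field_simp; ring
  · rw [hrq]; have : 0 < q - 1 := by linarith
    positivity
  · rw [hm]; field_simp; ring
  · rw [hr]; field_simp

theorem claimBA (p q m r : ℝ) (hq : 1 < q) (hqp : q < p) (hm : m = p / (p - 1))
    (hr : r = p * q / (p - q)) : ∃ C : ℝ, 0 < C ∧ ∀ u σ : ℝ → ℝ≥0∞, Measurable u → Measurable σ →
      Bint q m r u σ ≤ ENNReal.ofReal C * Aint p q m r u σ := by
  obtain ⟨hm1, hr0, e1, e2, e3, hb, e4, -⟩ := expo p q m r hq hqp hm hr
  have hq0 : 0 < q := by linarith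
  have hp0 : 0 < p := by linarith
  obtain ⟨C, hC, hG⟩ := Phi_G q hq0 (r / p) (by positivity)
  have e5 : q * (r / p + 1) = r := by rw [← e1]; field_simp
  have e6 : m * (r - r / q + 1) = r := by rw [← e2]; field_simp
  refine ⟨C, hC, fun u σ hu hσ => ?_⟩
  have hPu := Phi_measurable q u hu
  have hPs := Phi_measurable m σ hσ
  set F : ℝ → ℝ → ℝ≥0∞ := fun s x => (σ s * ENNReal.ofReal (s ^ (-m)) * ENNReal.ofReal (s ^ r) *
    Phi m σ s ^ (r - r / q)) * (u x * ENNReal.ofReal (x ^ (q * (r / p)) * (x + s) ^ (-r)) *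
      Phi q u x ^ (r / p)) with hF
  have hFm : Measurable (Function.uncurry F) := by
    simp only [hF, Function.uncurry_def]
    fun_prop
  have h1 : Bint q m r u σ ≤ ENNReal.ofReal C * ∫⁻ s in Ioi (0 : ℝ), ∫⁻ x in Ioi (0 : ℝ), F s x := by
    rw [← lintegral_const_mul' _ _ ENNReal.ofReal_ne_top]
    refine setLIntegral_mono' measurableSet_Ioi fun s hs => ?_
    have hs : 0 < s := hs
    have h := hG u hu s hs
    rw [e5] at h
    simp only [hF]
    rw [lintegral_const_mul _ (by fun_prop)]
    unfold Uf
    rw [aux_mul_rpow _ _ _ (by simpa using by positivity) ENNReal.ofReal_ne_top,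
      ENNReal.ofReal_rpow_of_pos (by positivity), ← Real.rpow_mul hs.le]
    have : q * (r / q) = r := by field_simp
    rw [this, e1]
    calc _ ≤ σ s * (ENNReal.ofReal (s ^ (-m)) * (ENNReal.ofReal (s ^ r) * (ENNReal.ofReal C *
        ∫⁻ x in Ioi (0 : ℝ), u x * ENNReal.ofReal (x ^ (q * (r / p)) * (x + s) ^ (-r)) *
        Phi q u x ^ (r / p)) * Phi m σ s ^ (r - (r / p + 1)))) := by gcongr
      _ = _ := by ring
  refine le_trans h1 ?_
  gcongr
  rw [lintegral_lintegral_swap hFm.aemeasurable]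
  unfold Aint
  refine setLIntegral_mono' measurableSet_Ioi fun x hx => ?_
  have hx : 0 < x := hx
  have h2 := Phi_G' m (by linarith) (r - r / q) hb σ hσ x hx
  rw [e6] at h2
  rw [e2]
  calc ∫⁻ s in Ioi (0 : ℝ), F s x = ∫⁻ s in Ioi (0 : ℝ), (u x * Uf q u x ^ (r / p)) *
        (σ s * ENNReal.ofReal (s ^ (m * (r - r / q)) * (s + x) ^ (-r)) * Phi m σ s ^ (r - r / q)) := by
        refine setLIntegral_congr_fun measurableSet_Ioi fun s hs => ?_
        have hs : 0 < s := hs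
        simp only [hF]
        unfold Uf
        rw [aux_mul_rpow _ _ _ (by simpa using by positivity) ENNReal.ofReal_ne_top,
          ENNReal.ofReal_rpow_of_pos (by positivity), ← Real.rpow_mul hx.le]
        have : m * (r - r / q) = -m + r := by linarith
        rw [this, Real.rpow_add hs, ENNReal.ofReal_mul (by positivity),
          ENNReal.ofReal_mul (by positivity), ENNReal.ofReal_mul (by positivity), add_comm x s]
        ring
    _ = (u x * Uf q u x ^ (r / p)) * ∫⁻ s in Ioi (0 : ℝ),
        (σ s * ENNReal.ofReal (s ^ (m * (r - r / q)) * (s + x) ^ (-r)) * Phi m σ s ^ (r - r / q)) := by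
        rw [lintegral_const_mul _ (by fun_prop)]
    _ ≤ (u x * Uf q u x ^ (r / p)) * Phi m σ x ^ (r - r / q + 1) := by gcongr
    _ = _ := by ring

theorem pp (p m : ℝ) (hp : 1 < p) (hm : m = p / (p - 1)) : ∃ C : ℝ, 0 < C ∧
    ∀ σ g : ℝ → ℝ≥0∞, Measurable σ → Measurable g →
      (∀ t, 0 < t → Phi m σ t ≠ 0 ∧ Phi m σ t ≠ ⊤) →
      ∫⁻ t in Ioi (0 : ℝ), σ t * (ENNReal.ofReal (t ^ (-m)) * (Phi m σ t ^ (-p) *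
        Phi 1 (fun s => σ s * g s) t ^ p)) ≤
      ENNReal.ofReal C * ∫⁻ s in Ioi (0 : ℝ), g s ^ p * σ s := by
  have hp1 : 0 < p - 1 := by linarith
  have hp0 : 0 < p := by linarith
  have hm0 : 0 < m := by rw [hm]; positivity
  have e4 : 1 / p + 1 / m = 1 := by rw [hm]; field_simp; ring
  have em : 1 / m = 1 - 1 / p := by linarith
  obtain ⟨C1, hC1, hG⟩ := Phi_Gneg m hm0 (1 / p) (by positivity)
    (by rw [div_lt_one hp0]; exact hp)
  obtain ⟨C2, hC2, hN⟩ := Phi_N m hm0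
  refine ⟨C1 ^ (p - 1) * C2, by positivity, fun σ g hσ hg hV => ?_⟩
  have hPs := Phi_measurable m σ hσ
  set h1 : ℝ → ℝ≥0∞ := fun s => ENNReal.ofReal (s ^ (m * (-(1 / p)))) * Phi m σ s ^ (-(1 / p))
    with hh1
  have hh1m : Measurable h1 := by fun_prop
  have hh10 : ∀ s, 0 < s → h1 s ≠ 0 ∧ h1 s ≠ ⊤ := by
    intro s hs
    obtain ⟨v0, v1⟩ := hV s hs
    refine ⟨mul_ne_zero (by simpa using by positivity) ?_, ENNReal.mul_ne_top ENNReal.ofReal_ne_top ?_⟩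
    · exact (ENNReal.rpow_pos (pos_iff_ne_zero.2 v0) v1).ne'
    · exact ENNReal.rpow_ne_top_of_ne_zero v0 v1
  set F : ℝ → ℝ → ℝ≥0∞ := fun t s => (σ t * ENNReal.ofReal (t ^ (-m) * (t + s) ^ (-1 : ℝ)) *
        Phi m σ t ^ (-(1 + 1 / m))) * (σ s * (g s ^ p * h1 s ^ (1 - p))) with hF
  have hFm : Measurable (Function.uncurry F) := by
    simp only [hF, Function.uncurry_def]
    fun_prop
  have schur : ∀ t, 0 < t → Phi 1 (fun s => σ s * g s) t ^ p ≤
      (∫⁻ s in Ioi (0 : ℝ), σ s * ENNReal.ofReal ((s + t) ^ (-1 : ℝ)) * (g s ^ p * h1 s ^ (1 - p))) *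
        (ENNReal.ofReal (C1 ^ (p - 1)) * Phi m σ t ^ ((p - 1) / m)) := by
    intro t ht
    have hH := ENNReal.lintegral_mul_norm_pow_le (μ := volume.restrict (Ioi (0 : ℝ)))
      (f := fun s => σ s * ENNReal.ofReal ((s + t) ^ (-1 : ℝ)) * (g s ^ p * h1 s ^ (1 - p)))
      (g := fun s => σ s * ENNReal.ofReal ((s + t) ^ (-1 : ℝ)) * h1 s)
      (by fun_prop) (by fun_prop) (p := 1 / p) (q := 1 / m) (by positivity) (by positivity) e4
    have hL : Phi 1 (fun s => σ s * g s) t = ∫⁻ s in Ioi (0 : ℝ),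
        (σ s * ENNReal.ofReal ((s + t) ^ (-1 : ℝ)) * (g s ^ p * h1 s ^ (1 - p))) ^ (1 / p) *
        (σ s * ENNReal.ofReal ((s + t) ^ (-1 : ℝ)) * h1 s) ^ (1 / m) := by
      unfold Phi
      refine setLIntegral_congr_fun measurableSet_Ioi fun s hs => ?_
      have hs : 0 < s := hs
      obtain ⟨z0, z1⟩ := hh10 s hs
      have i1 : (0 : ℝ) ≤ 1 / p := by positivity
      have i2 : (0 : ℝ) ≤ 1 / m := by positivity
      simp only
      rw [ENNReal.mul_rpow_of_nonneg _ _ i1, ENNReal.mul_rpow_of_nonneg _ _ i2,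
        ENNReal.mul_rpow_of_nonneg (g s ^ p) _ i1, ← ENNReal.rpow_mul, ← ENNReal.rpow_mul]
      have a1 : p * (1 / p) = 1 := by field_simp
      have a2 : (1 - p) * (1 / p) = - (1 / m) := by rw [em]; field_simp; ring
      rw [a1, a2, ENNReal.rpow_one]
      set X := σ s * ENNReal.ofReal ((s + t) ^ (-1 : ℝ))
      have a3 : X ^ (1 / p) * X ^ (1 / m) = X := by
        rw [← ENNReal.rpow_add_of_nonneg _ _ i1 i2, e4, ENNReal.rpow_one]
      have a4 : h1 s ^ (-(1 / m)) * h1 s ^ (1 / m) = 1 := by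
        rw [← ENNReal.rpow_add _ _ z0 z1]; simp
      calc _ = X * g s := by ring
        _ = (X ^ (1 / p) * X ^ (1 / m)) * g s * (h1 s ^ (-(1 / m)) * h1 s ^ (1 / m)) := by
            rw [a3, a4, mul_one]
        _ = _ := by ring
    rw [← hL] at hH
    have hI : ∫⁻ s in Ioi (0 : ℝ), σ s * ENNReal.ofReal ((s + t) ^ (-1 : ℝ)) * h1 s ≤
        ENNReal.ofReal C1 * Phi m σ t ^ (1 / m) := by
      rw [em]
      refine le_trans (le_of_eq ?_) (hG σ hσ t ht)
      refine setLIntegral_congr_fun measurableSet_Ioi fun s hs => ?_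
      have hs : 0 < s := hs
      have : m * (-(1 / p) + 1) = 1 := by
        have : -(1 / p) + 1 = 1 / m := by rw [em]; ring
        rw [this]; field_simp
      simp only [hh1]
      rw [this, ENNReal.ofReal_mul (by positivity)]
      ring
    calc Phi 1 (fun s => σ s * g s) t ^ p ≤ _ := ENNReal.rpow_le_rpow hH hp0.le
      _ ≤ (_ * (ENNReal.ofReal C1 * Phi m σ t ^ (1 / m)) ^ (1 / m)) ^ p := by
          gcongr
      _ = _ := by
          rw [ENNReal.mul_rpow_of_nonneg _ _ hp0.le, ← ENNReal.rpow_mul, ← ENNReal.rpow_mul,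
            ENNReal.mul_rpow_of_nonneg _ _ (by positivity), ← ENNReal.rpow_mul,
            ENNReal.ofReal_rpow_of_pos hC1]
          have a1 : 1 / p * p = 1 := by field_simp
          have a2 : 1 / m * p = p - 1 := by rw [em]; field_simp
          rw [a1, a2, ENNReal.rpow_one, one_div_mul_eq_div]
  calc _ ≤ ∫⁻ t in Ioi (0 : ℝ), ENNReal.ofReal (C1 ^ (p - 1)) * ∫⁻ s in Ioi (0 : ℝ), F t s := by
        refine setLIntegral_mono' measurableSet_Ioi fun t ht => ?_
        have ht : 0 < t := ht
        obtain ⟨v0, v1⟩ := hV t ht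
        have e7 : Phi m σ t ^ (-(1 + 1 / m)) = Phi m σ t ^ (-p) * Phi m σ t ^ ((p - 1) / m) := by
          rw [← ENNReal.rpow_add _ _ v0 v1]
          congr 1
          rw [div_eq_mul_one_div (p - 1) m, em]; field_simp; ring
        have e8 : ∫⁻ s in Ioi (0 : ℝ), F t s = (σ t * ENNReal.ofReal (t ^ (-m)) *
            Phi m σ t ^ (-(1 + 1 / m))) * ∫⁻ s in Ioi (0 : ℝ),
              σ s * ENNReal.ofReal ((s + t) ^ (-1 : ℝ)) * (g s ^ p * h1 s ^ (1 - p)) := by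
          rw [← lintegral_const_mul _ (by fun_prop)]
          refine setLIntegral_congr_fun measurableSet_Ioi fun s hs => ?_
          simp only [hF]
          rw [ENNReal.ofReal_mul (by positivity), add_comm t s]
          ring
        rw [e8, e7]
        refine le_trans (mul_le_mul_right (mul_le_mul_right (mul_le_mul_right (schur t ht) _) _) _)
          (le_of_eq ?_)
        ring
    _ = ENNReal.ofReal (C1 ^ (p - 1)) * ∫⁻ s in Ioi (0 : ℝ), ∫⁻ t in Ioi (0 : ℝ), F t s := by
        rw [lintegral_const_mul' _ _ ENNReal.ofReal_ne_top, lintegral_lintegral_swap hFm.aemeasurable]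
    _ ≤ ENNReal.ofReal (C1 ^ (p - 1)) * ∫⁻ s in Ioi (0 : ℝ), ENNReal.ofReal C2 * (g s ^ p * σ s) := by
        refine mul_le_mul_right (setLIntegral_mono' measurableSet_Ioi fun s hs => ?_) _
        have hs : 0 < s := hs
        obtain ⟨z0, z1⟩ := hh10 s hs
        obtain ⟨v0, v1⟩ := hV s hs
        simp only [hF]
        rw [lintegral_mul_const _ (by fun_prop)]
        have e9 : ENNReal.ofReal (s ^ (-1 : ℝ)) * Phi m σ s ^ (-(1 / m)) = h1 s ^ (p - 1) := by
          simp only [hh1]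
          rw [aux_mul_rpow _ _ _ (by simpa using by positivity) ENNReal.ofReal_ne_top,
            ENNReal.ofReal_rpow_of_pos (by positivity), ← Real.rpow_mul hs.le, ← ENNReal.rpow_mul]
          have a2 : -(1 / p) * (p - 1) = - (1 / m) := by rw [em]; field_simp
          have a1 : m * (-(1 / p)) * (p - 1) = -1 := by
            rw [mul_assoc, a2]; field_simp
          rw [a1, a2]
        have := hN σ hσ s hs v0 v1
        rw [e9] at this
        refine le_trans (mul_le_mul_left this _) (le_of_eq ?_)
        have a4 : h1 s ^ (p - 1) * h1 s ^ (1 - p) = 1 := by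
          rw [← ENNReal.rpow_add _ _ z0 z1]; simp
        calc _ = ENNReal.ofReal C2 * (g s ^ p * σ s) * (h1 s ^ (p - 1) * h1 s ^ (1 - p)) := by ring
          _ = _ := by rw [a4, mul_one]
    _ = _ := by
        rw [lintegral_const_mul' _ _ ENNReal.ofReal_ne_top, ← mul_assoc,
          ← ENNReal.ofReal_mul (by positivity)]

theorem upper (p q m r : ℝ) (hq : 1 < q) (hqp : q < p) (hm : m = p / (p - 1))
    (hr : r = p * q / (p - q)) : ∃ C : ℝ, 0 < C ∧
    ∀ u σ g : ℝ → ℝ≥0∞, Measurable u → Measurable σ → Measurable g →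
      (∀ t, 0 < t → Phi m σ t ≠ 0 ∧ Phi m σ t ≠ ⊤) →
      ∫⁻ t in Ioi (0 : ℝ), Phi 1 (fun s => σ s * g s) t ^ q * u t ≤
        ENNReal.ofReal C * (Aint p q m r u σ ^ (q / r) *
          (∫⁻ s in Ioi (0 : ℝ), g s ^ p * σ s) ^ (q / p)) := by
  obtain ⟨hm1, hr0, e1, e2, e3, hb, e4, e10⟩ := expo p q m r hq hqp hm hr
  have hq0 : 0 < q := by linarith
  have hp0 : 0 < p := by linarith
  have hq1 : 0 < q - 1 := by linarith
  have hpq : 0 < p - q := by linarith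
  obtain ⟨C1, hC1, hG⟩ := Phi_G 1 one_pos (q - 1) hq1
  obtain ⟨C2, hC2, hpp⟩ := pp p m (by linarith) hm
  obtain ⟨C3, hC3, hBA⟩ := claimBA p q m r hq hqp hm hr
  refine ⟨C1 * C2 ^ ((q - 1) / p) * C3 ^ (q / r), by positivity, fun u σ g hu hσ hg hV => ?_⟩
  have hPs := Phi_measurable m σ hσ
  have hPu := Phi_measurable q u hu
  have hUm := Uf_measurable q u hu
  have hS := Phi_measurable 1 (fun s => σ s * g s) (by fun_prop)
  set S := Phi 1 (fun s => σ s * g s) with hSdef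
  set N := ∫⁻ s in Ioi (0 : ℝ), g s ^ p * σ s with hN
  set F : ℝ → ℝ → ℝ≥0∞ := fun t s => u t * (σ s * g s * ENNReal.ofReal (s ^ (q - 1) * (s + t) ^ (-q)) *
    S s ^ (q - 1)) with hF
  have hFm : Measurable (Function.uncurry F) := by
    simp only [hF, Function.uncurry_def]
    fun_prop
  have st1 : ∫⁻ t in Ioi (0 : ℝ), S t ^ q * u t ≤ ENNReal.ofReal C1 *
      ∫⁻ s in Ioi (0 : ℝ), σ s * g s * S s ^ (q - 1) * ENNReal.ofReal (s ^ (q - 1)) * Phi q u s := by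
    calc _ ≤ ∫⁻ t in Ioi (0 : ℝ), ENNReal.ofReal C1 * ∫⁻ s in Ioi (0 : ℝ), F t s := by
          refine setLIntegral_mono' measurableSet_Ioi fun t ht => ?_
          have h := hG (fun s => σ s * g s) (by fun_prop) t ht
          rw [one_mul, one_mul, sub_add_cancel, ← hSdef] at h
          simp only [hF]
          rw [lintegral_const_mul _ (by fun_prop), mul_left_comm, mul_comm (S t ^ q)]
          gcongr
      _ = ENNReal.ofReal C1 * ∫⁻ s in Ioi (0 : ℝ), ∫⁻ t in Ioi (0 : ℝ), F t s := by
          rw [lintegral_const_mul' _ _ ENNReal.ofReal_ne_top, lintegral_lintegral_swap hFm.aemeasurable]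
      _ = _ := by
          congr 1
          refine setLIntegral_congr_fun measurableSet_Ioi fun s hs => ?_
          have hs : 0 < s := hs
          unfold Phi
          rw [← lintegral_const_mul _ (by fun_prop)]
          refine setLIntegral_congr_fun measurableSet_Ioi fun t ht => ?_
          simp only [hF]
          rw [ENNReal.ofReal_mul (by positivity), add_comm s t]
          ring
  have i1 : (0 : ℝ) ≤ 1 / p := by positivity
  have i2 : (0 : ℝ) ≤ (q - 1) / p := by positivity
  have i3 : (0 : ℝ) ≤ (p - q) / p := by positivity
  have st2 := ENNReal.lintegral_prod_norm_pow_le (μ := volume.restrict (Ioi (0 : ℝ)))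
    (Finset.univ : Finset (Fin 3))
    (f := ![fun s => g s ^ p * σ s,
      fun t => σ t * (ENNReal.ofReal (t ^ (-m)) * (Phi m σ t ^ (-p) * S t ^ p)),
      fun s => σ s * (ENNReal.ofReal (s ^ (-m)) * (Uf q u s ^ (r / q) *
        Phi m σ s ^ (r - r / q)))])
    (by
      intro i _
      fin_cases i
      · simp; fun_prop
      · simp; fun_prop
      · simp; fun_prop)
    (p := ![1 / p, (q - 1) / p, (p - q) / p])
    (by simp [Fin.sum_univ_three]; field_simp; ring)
    (by
      intro i _
      fin_cases i
      · exact i1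
      · exact i2
      · exact i3)
  simp only [Fin.prod_univ_three, Matrix.cons_val_zero, Matrix.cons_val_one, Matrix.cons_val] at st2
  have st3 : ∫⁻ s in Ioi (0 : ℝ), σ s * g s * S s ^ (q - 1) * ENNReal.ofReal (s ^ (q - 1)) * Phi q u s
      ≤ N ^ (1 / p) * (ENNReal.ofReal C2 * N) ^ ((q - 1) / p) *
        (ENNReal.ofReal C3 * Aint p q m r u σ) ^ ((p - q) / p) := by
    refine le_trans (le_of_eq ?_) (le_trans st2 ?_)
    · refine setLIntegral_congr_fun measurableSet_Ioi fun s hs => ?_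
      have hs : 0 < s := hs
      obtain ⟨v0, v1⟩ := hV s hs
      have b1 : (g s ^ p * σ s) ^ (1 / p) = g s * σ s ^ (1 / p) := by
        rw [ENNReal.mul_rpow_of_nonneg _ _ i1, ← ENNReal.rpow_mul]
        have : p * (1 / p) = 1 := by field_simp
        rw [this, ENNReal.rpow_one]
      have b2 : (σ s * (ENNReal.ofReal (s ^ (-m)) * (Phi m σ s ^ (-p) * S s ^ p))) ^ ((q - 1) / p) =
          σ s ^ ((q - 1) / p) * (ENNReal.ofReal (s ^ (-m * ((q - 1) / p))) *
            (Phi m σ s ^ (-(q - 1)) * S s ^ (q - 1))) := by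
        rw [ENNReal.mul_rpow_of_nonneg _ _ i2, ENNReal.mul_rpow_of_nonneg _ _ i2,
          ENNReal.mul_rpow_of_nonneg _ _ i2, ← ENNReal.rpow_mul, ← ENNReal.rpow_mul,
          ENNReal.ofReal_rpow_of_pos (by positivity), ← Real.rpow_mul hs.le]
        have c1 : p * ((q - 1) / p) = q - 1 := by field_simp
        rw [neg_mul p, c1]
      have b3 : (σ s * (ENNReal.ofReal (s ^ (-m)) * (Uf q u s ^ (r / q) *
          Phi m σ s ^ (r - r / q)))) ^ ((p - q) / p) =
          σ s ^ ((p - q) / p) * (ENNReal.ofReal (s ^ (-m * ((p - q) / p))) *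
            (Uf q u s * Phi m σ s ^ (q - 1))) := by
        rw [ENNReal.mul_rpow_of_nonneg _ _ i3, ENNReal.mul_rpow_of_nonneg _ _ i3,
          ENNReal.mul_rpow_of_nonneg _ _ i3, ← ENNReal.rpow_mul, ← ENNReal.rpow_mul,
          ENNReal.ofReal_rpow_of_pos (by positivity), ← Real.rpow_mul hs.le]
        have c1 : r / q * ((p - q) / p) = 1 := by rw [← e10]; field_simp
        have c2 : (r - r / q) * ((p - q) / p) = q - 1 := by rw [← e10]; field_simp
        rw [c1, c2, ENNReal.rpow_one]
      rw [b1, b2, b3]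
      have c3 : σ s ^ (1 / p) * σ s ^ ((q - 1) / p) * σ s ^ ((p - q) / p) = σ s := by
        rw [← ENNReal.rpow_add_of_nonneg _ _ i1 i2, ← ENNReal.rpow_add_of_nonneg _ _ (by positivity) i3]
        have : 1 / p + (q - 1) / p + (p - q) / p = 1 := by field_simp; ring
        rw [this, ENNReal.rpow_one]
      have c4 : Phi m σ s ^ (-(q - 1)) * Phi m σ s ^ (q - 1) = 1 := by
        rw [← ENNReal.rpow_add _ _ v0 v1]; simp
      have c5 : ENNReal.ofReal (s ^ (-m * ((q - 1) / p))) * ENNReal.ofReal (s ^ (-m * ((p - q) / p)))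
          * ENNReal.ofReal (s ^ q) = ENNReal.ofReal (s ^ (q - 1)) := by
        rw [← ENNReal.ofReal_mul (by positivity), ← ENNReal.ofReal_mul (by positivity),
          ← Real.rpow_add hs, ← Real.rpow_add hs]
        congr 2
        have : m / p * (p - 1) = 1 := by
          rw [hm]
          have : p - 1 ≠ 0 := by linarith
          field_simp
        have h' : -m * ((q - 1) / p) + -m * ((p - q) / p) = -(m / p * (p - 1)) := by
          field_simp; ring
        rw [h', this]; ring
      unfold Uf
      calc _ = (σ s) * g s * S s ^ (q - 1) * (ENNReal.ofReal (s ^ (q - 1))) * Phi q u s * 1 := by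
            rw [mul_one]
        _ = _ := by
            rw [← c5, ← c4]
            nth_rw 1 [← c3]
            ring
    · gcongr
      · exact hpp σ g hσ hg hV
      · exact hBA u σ hu hσ
  refine le_trans st1 (le_trans (mul_le_mul_right st3 _) (le_of_eq ?_))
  rw [← e10, ENNReal.mul_rpow_of_nonneg _ _ i2, ENNReal.mul_rpow_of_nonneg _ _ (by positivity),
    ENNReal.ofReal_rpow_of_pos hC2, ENNReal.ofReal_rpow_of_pos hC3, ENNReal.ofReal_mul (by positivity),
    ENNReal.ofReal_mul (by positivity)]
  have : N ^ (q / p) = N ^ (1 / p) * N ^ ((q - 1) / p) := by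
    rw [← ENNReal.rpow_add_of_nonneg _ _ i1 i2]; congr 1; field_simp; ring
  rw [this]; ring

theorem lower (p q m r : ℝ) (hq : 1 < q) (hqp : q < p) (hm : m = p / (p - 1))
    (hr : r = p * q / (p - q)) : ∃ c : ℝ, 0 < c ∧
    ∀ u σ : ℝ → ℝ≥0∞, Measurable u → Measurable σ → ∀ K : ℝ≥0∞, 
      (∀ g : ℝ → ℝ≥0∞, Measurable g →
        (∫⁻ t in Ioi (0 : ℝ), Phi 1 (fun s => σ s * g s) t ^ q * u t) ^ (1 / q) ≤
          K * (∫⁻ s in Ioi (0 : ℝ), g s ^ p * σ s) ^ (1 / p)) →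
      Aint p q m r u σ ≠ ⊤ → ENNReal.ofReal c * Aint p q m r u σ ^ (1 / q - 1 / p) ≤ K := by
  obtain ⟨hm1, hr0, e1, e2, e3, hb, e4, e10⟩ := expo p q m r hq hqp hm hr
  have hq0 : 0 < q := by linarith
  have hp0 : 0 < p := by linarith
  have hm0 : 0 < m := by linarith
  have hq1 : 0 < q - 1 := by linarith
  have hpq : 0 < p - q := by linarith
  set β := (r - r / q) / p with hβ
  have hβ0 : 0 < β := by positivity
  obtain ⟨C1, hC1, hBA⟩ := claimBA p q m r hq hqp hm hr
  obtain ⟨C2, hC2, hG⟩ := Phi_G m hm0 β hβ0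
  have hC : 0 < C2 * C1 ^ (1 / p) := by positivity
  refine ⟨(C2 * C1 ^ (1 / p))⁻¹, by positivity, fun u σ hu hσ K hK hA => ?_⟩
  set A := Aint p q m r u σ with hAd
  have hPs := Phi_measurable m σ hσ
  have hUm := Uf_measurable q u hu
  set α := r / (p * q) with hα
  have hα0 : 0 < α := by positivity
  set g : ℝ → ℝ≥0∞ := fun s => ENNReal.ofReal (s ^ (1 - m)) * (Uf q u s ^ α * Phi m σ s ^ β) with hg
  have hgm : Measurable g := by fun_prop
  have hB : ∫⁻ s in Ioi (0 : ℝ), g s ^ p * σ s ≤ ENNReal.ofReal C1 * A := by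
    refine le_trans (le_of_eq ?_) (hBA u σ hu hσ)
    unfold Bint
    refine setLIntegral_congr_fun measurableSet_Ioi fun s hs => ?_
    have hs : 0 < s := hs
    simp only [hg]
    rw [ENNReal.mul_rpow_of_nonneg _ _ hp0.le, ENNReal.mul_rpow_of_nonneg _ _ hp0.le,
      ← ENNReal.rpow_mul, ← ENNReal.rpow_mul, ENNReal.ofReal_rpow_of_pos (by positivity),
      ← Real.rpow_mul hs.le]
    have c1 : (1 - m) * p = -m := by
      have : 1 - m = -(m / p) := by linarith
      rw [this]; field_simp
    have c2 : α * p = r / q := by rw [hα]; field_simp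
    have c3 : β * p = r - r / q := by rw [hβ]; field_simp
    rw [c1, c2, c3]; ring
  have d1 : m * (β + 1) = r / q := by
    rw [hβ]
    have : m * ((r - r / q) / p + 1) = (m / p) * (r - r / q) + m := by field_simp
    rw [this, e3]
    have : m * (r - r / q + 1) = r := by rw [← e2]; field_simp
    linarith
  have d2 : m * β - r / p = 1 - m := by linarith [mul_add m β 1]
  have hS : ∀ t, 0 < t → Uf q u t ^ α * Phi m σ t ^ (β + 1) ≤
      ENNReal.ofReal C2 * Phi 1 (fun s => σ s * g s) t := by
    intro t ht
    have h := hG σ hσ t ht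
    have key : Uf q u t ^ α * (∫⁻ s in Ioi (0 : ℝ), σ s * ENNReal.ofReal (s ^ (m * β) *
        (s + t) ^ (-(m * (β + 1)))) * Phi m σ s ^ β) ≤ Phi 1 (fun s => σ s * g s) t := by
        rw [← lintegral_const_mul (Uf q u t ^ α) (by fun_prop)]
        show _ ≤ ∫⁻ s in Ioi (0 : ℝ), σ s * g s * ENNReal.ofReal ((s + t) ^ (-1 : ℝ))
        refine setLIntegral_mono' measurableSet_Ioi fun s hs => ?_
        have hs : 0 < s := hs
        have hU : Uf q u t ≤ ENNReal.ofReal (((s + t) / s) ^ q) * Uf q u s := by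
          unfold Uf
          refine le_trans (mul_le_mul_right (Phi_mono q hq0 u s t hs ht) _) (le_of_eq ?_)
          rw [← mul_assoc, ← mul_assoc, ← ENNReal.ofReal_mul (by positivity),
            ← ENNReal.ofReal_mul (by positivity), ← Real.mul_rpow (by positivity) (by positivity),
            ← Real.mul_rpow (by positivity) (by positivity)]
          congr 3
          field_simp
        have hU2 : Uf q u t ^ α ≤ ENNReal.ofReal (((s + t) / s) ^ (r / p)) * Uf q u s ^ α := by
          refine le_trans (ENNReal.rpow_le_rpow hU hα0.le) (le_of_eq ?_)
          rw [ENNReal.mul_rpow_of_nonneg _ _ hα0.le, ENNReal.ofReal_rpow_of_pos (by positivity),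
            ← Real.rpow_mul (by positivity)]
          have : q * α = r / p := by rw [hα]; field_simp
          rw [this]
        refine le_trans (mul_le_mul_left hU2 _) (le_of_eq ?_)
        simp only [hg]
        rw [d1]
        have d3 : ENNReal.ofReal (((s + t) / s) ^ (r / p)) *
            ENNReal.ofReal (s ^ (m * β) * (s + t) ^ (-(r / q))) =
            ENNReal.ofReal (s ^ (1 - m)) * ENNReal.ofReal ((s + t) ^ (-1 : ℝ)) := by
          rw [← ENNReal.ofReal_mul (by positivity), ← ENNReal.ofReal_mul (by positivity)]
          congr 1
          rw [← d2, Real.rpow_sub hs, Real.div_rpow (by positivity) hs.le]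
          have : (-1 : ℝ) = r / p + -(r / q) := by rw [e1]; ring
          rw [this, Real.rpow_add (by positivity)]
          field_simp
        rw [show ∀ X Y Z W T : ℝ≥0∞, X * Y * (Z * W * T) = (X * W) * (Y * Z * T) from
          fun X Y Z W T => by ring, d3]
        ring
    refine le_trans (mul_le_mul_right h _) ?_
    rw [mul_left_comm]
    exact mul_le_mul_right key _
  have hAle : A ≤ ENNReal.ofReal (C2 ^ q) *
      ∫⁻ t in Ioi (0 : ℝ), Phi 1 (fun s => σ s * g s) t ^ q * u t := by
    rw [← lintegral_const_mul' _ _ ENNReal.ofReal_ne_top]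
    refine setLIntegral_mono' measurableSet_Ioi fun t ht => ?_
    have h := ENNReal.rpow_le_rpow (hS t ht) hq0.le
    rw [ENNReal.mul_rpow_of_nonneg _ _ hq0.le, ENNReal.mul_rpow_of_nonneg _ _ hq0.le,
      ← ENNReal.rpow_mul, ← ENNReal.rpow_mul, ENNReal.ofReal_rpow_of_pos hC2] at h
    have c1 : α * q = r / p := by rw [hα]; field_simp
    have c2 : (β + 1) * q = r / m := by
      have : β + 1 = r / q / m := by rw [← d1]; field_simp
      rw [this]; field_simp
    rw [c1, c2] at h
    rw [mul_comm (u t), ← mul_assoc]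
    gcongr
  by_cases hA0 : A = 0
  · rw [hA0, ENNReal.zero_rpow_of_pos, mul_zero]
    · exact zero_le
    · rw [sub_pos]; exact one_div_lt_one_div_of_lt hq0 hqp
  have h1 : A ^ (1 / q) ≤ ENNReal.ofReal (C2 * C1 ^ (1 / p)) * (K * A ^ (1 / p)) := by
    refine le_trans (ENNReal.rpow_le_rpow hAle (by positivity)) ?_
    rw [ENNReal.mul_rpow_of_nonneg _ _ (by positivity), ENNReal.ofReal_rpow_of_pos (by positivity),
      ← Real.rpow_mul hC2.le]
    have : q * (1 / q) = 1 := by field_simp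
    rw [this, Real.rpow_one]
    refine le_trans (mul_le_mul_right (hK g hgm) _) ?_
    refine le_trans (mul_le_mul_right (mul_le_mul_right
      (ENNReal.rpow_le_rpow hB (by positivity)) _) _) (le_of_eq ?_)
    rw [ENNReal.mul_rpow_of_nonneg _ _ (by positivity), ENNReal.ofReal_rpow_of_pos hC1,
      ENNReal.ofReal_mul hC2.le]
    ring
  have h2 : A ^ (1 / q - 1 / p) ≤ ENNReal.ofReal (C2 * C1 ^ (1 / p)) * K := by
    rw [sub_eq_add_neg, ENNReal.rpow_add _ _ hA0 hA]
    refine le_trans (mul_le_mul_left h1 _) (le_of_eq ?_)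
    have : A ^ (1 / p) * A ^ (-(1 / p)) = 1 := by
      rw [← ENNReal.rpow_add _ _ hA0 hA]; simp
    rw [mul_assoc, mul_assoc, this, mul_one]
  refine le_trans (mul_le_mul_right h2 _) (le_of_eq ?_)
  rw [← mul_assoc, ← ENNReal.ofReal_mul (by positivity), inv_mul_cancel₀ hC.ne']
  simp

theorem Phi_ne_zero (m : ℝ) (w : ℝ → ℝ≥0∞) (hw : Measurable w) (h : ∀ s, 0 < s → w s ≠ 0)
    (t : ℝ) (ht : 0 < t) : Phi m w t ≠ 0 := by
  unfold Phi
  refine ne_of_gt ?_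
  rw [setLIntegral_pos_iff (by fun_prop)]
  have : Ioi (0 : ℝ) ⊆ Function.support (fun s => w s * ENNReal.ofReal ((s + t) ^ (-m))) ∩ Ioi 0 := by
    intro s hs
    have hs' : 0 < s := hs
    refine ⟨?_, hs⟩
    rw [Function.mem_support]
    refine mul_ne_zero (h s hs') ?_
    simpa using by positivity
  refine lt_of_lt_of_le ?_ (measure_mono this)
  simp

theorem Phi_congr (m : ℝ) (w w2 : ℝ → ℝ≥0∞) (h : ∀ s, 0 < s → w s = w2 s) (t : ℝ) :
    Phi m w t = Phi m w2 t := by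
  unfold Phi
  refine setLIntegral_congr_fun measurableSet_Ioi fun s hs => ?_
  simp only [h s hs]

theorem Phi_le (m : ℝ) (hm : 0 < m) (w : ℝ → ℝ≥0∞) (a b t : ℝ) (N : ℝ≥0∞) (ha : 0 < a) (ht : 0 < t)
    (h : ∀ s, w s ≤ (Ioo a b).indicator (fun _ => N) s) :
    Phi m w t ≤ N * ENNReal.ofReal (a ^ (-m)) * volume (Ioo a b) := by
  unfold Phi
  calc _ ≤ ∫⁻ s in Ioi (0 : ℝ), (Ioo a b).indicator (fun _ => N * ENNReal.ofReal (a ^ (-m))) s := by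
        refine setLIntegral_mono' measurableSet_Ioi fun s hs => ?_
        refine le_trans (mul_le_mul_left (h s) _) ?_
        by_cases hsE : s ∈ Ioo a b
        · rw [indicator_of_mem hsE, indicator_of_mem hsE]
          gcongr N * ENNReal.ofReal ?_
          exact Real.rpow_le_rpow_of_nonpos ha (by linarith [hsE.1]) (by linarith)
        · rw [indicator_of_notMem hsE, zero_mul]; exact zero_le
    _ ≤ ∫⁻ s, (Ioo a b).indicator (fun _ => N * ENNReal.ofReal (a ^ (-m))) s :=
        setLIntegral_le_lintegral _ _
    _ = _ := by rw [lintegral_indicator measurableSet_Ioo, setLIntegral_const]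

theorem Aint_fin (p q m r : ℝ) (hp : 0 < p) (hq : 0 < q) (hm : 0 < m) (hr : 0 < r)
    (u σ : ℝ → ℝ≥0∞) (a b : ℝ) (N : ℝ≥0∞) (hN : N ≠ ⊤) (ha : 0 < a)
    (hu : ∀ s, u s ≤ (Ioo a b).indicator (fun _ => N) s)
    (hσ : ∀ s, σ s ≤ (Ioo a b).indicator (fun _ => N) s) : Aint p q m r u σ ≠ ⊤ := by
  set M1 := (ENNReal.ofReal (b ^ q) * (N * ENNReal.ofReal (a ^ (-q)) * volume (Ioo a b))) ^ (r / p)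
    with hM1
  set M2 := (N * ENNReal.ofReal (a ^ (-m)) * volume (Ioo a b)) ^ (r / m) with hM2
  have hv : volume (Ioo a b) ≠ ⊤ := by simp
  have h1 : M1 ≠ ⊤ := by
    refine ENNReal.rpow_ne_top_of_nonneg (by positivity) ?_
    exact ENNReal.mul_ne_top ENNReal.ofReal_ne_top (ENNReal.mul_ne_top
      (ENNReal.mul_ne_top hN ENNReal.ofReal_ne_top) hv)
  have h2 : M2 ≠ ⊤ := by
    refine ENNReal.rpow_ne_top_of_nonneg (by positivity) ?_
    exact (ENNReal.mul_ne_top (ENNReal.mul_ne_top hN ENNReal.ofReal_ne_top) hv)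
  have h3 : Aint p q m r u σ ≤ N * (M1 * M2) * volume (Ioo a b) := by
    unfold Aint
    calc _ ≤ ∫⁻ s in Ioi (0 : ℝ), (Ioo a b).indicator (fun _ => N * (M1 * M2)) s := by
          refine setLIntegral_mono' measurableSet_Ioi fun s hs => ?_
          have hs' : 0 < s := hs
          refine le_trans (mul_le_mul_left (hu s) _) ?_
          by_cases hsE : s ∈ Ioo a b
          · rw [indicator_of_mem hsE, indicator_of_mem hsE]
            refine mul_le_mul_right (mul_le_mul' ?_ ?_) _
            · refine ENNReal.rpow_le_rpow ?_ (by positivity)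
              unfold Uf
              refine mul_le_mul' ?_ (Phi_le q hq u a b s N ha hs' hu)
              refine ENNReal.ofReal_le_ofReal ?_
              exact Real.rpow_le_rpow hs'.le hsE.2.le hq.le
            · exact ENNReal.rpow_le_rpow (Phi_le m hm σ a b s N ha hs' hσ) (by positivity)
          · rw [indicator_of_notMem hsE, zero_mul]; exact zero_le
      _ ≤ ∫⁻ s, (Ioo a b).indicator (fun _ => N * (M1 * M2)) s :=
          setLIntegral_le_lintegral _ _
      _ = _ := by rw [lintegral_indicator measurableSet_Ioo, setLIntegral_const]
  refine ne_top_of_le_ne_top ?_ h3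
  exact ENNReal.mul_ne_top (ENNReal.mul_ne_top hN (ENNReal.mul_ne_top h1 h2)) hv

/-- truncation sets -/
def trE (u σ : ℝ → ℝ≥0∞) (n : ℕ) : Set ℝ :=
  Ioo (1 / ((n : ℝ) + 1)) ((n : ℝ) + 1) ∩ ({s | u s ≤ (n : ℝ≥0∞)} ∩ {s | σ s ≤ (n : ℝ≥0∞)})

theorem trE_meas (u σ : ℝ → ℝ≥0∞) (hu : Measurable u) (hσ : Measurable σ) (n : ℕ) :
    MeasurableSet (trE u σ n) :=
  measurableSet_Ioo.inter ((measurableSet_le hu measurable_const).inter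
    (measurableSet_le hσ measurable_const))

theorem trE_mono (u σ : ℝ → ℝ≥0∞) : Monotone (trE u σ) := by
  intro i j hij
  have h1 : (i : ℝ) ≤ j := by exact_mod_cast hij
  have h2 : (i : ℝ≥0∞) ≤ j := by exact_mod_cast hij
  rintro s ⟨⟨a1, a2⟩, a3, a4⟩
  refine ⟨⟨lt_of_le_of_lt ?_ a1, by linarith⟩, le_trans a3 h2, le_trans a4 h2⟩
  exact one_div_le_one_div_of_le (by positivity) (by linarith)

theorem trE_ev (u σ : ℝ → ℝ≥0∞) (s : ℝ) (hs : 0 < s) (hu : u s ≠ ⊤) (hσ : σ s ≠ ⊤) :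
    ∀ᶠ n in atTop, s ∈ trE u σ n := by
  obtain ⟨n1, h1⟩ := exists_nat_gt s
  obtain ⟨n2, h2⟩ := exists_nat_one_div_lt hs
  obtain ⟨n3, h3⟩ := ENNReal.exists_nat_gt hu
  obtain ⟨n4, h4⟩ := ENNReal.exists_nat_gt hσ
  refine eventually_atTop.2 ⟨max (max n1 n2) (max n3 n4), fun n hn => ?_⟩
  have k1 : n1 ≤ n := le_trans (le_trans (le_max_left _ _) (le_max_left _ _)) hn
  have k2 : n2 ≤ n := le_trans (le_trans (le_max_right _ _) (le_max_left _ _)) hn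
  have k3 : n3 ≤ n := le_trans (le_trans (le_max_left _ _) (le_max_right _ _)) hn
  have k4 : n4 ≤ n := le_trans (le_trans (le_max_right _ _) (le_max_right _ _)) hn
  have k1' : (n1 : ℝ) ≤ n := by exact_mod_cast k1
  have k2' : (n2 : ℝ) ≤ n := by exact_mod_cast k2
  have k3' : (n3 : ℝ≥0∞) ≤ n := by exact_mod_cast k3
  have k4' : (n4 : ℝ≥0∞) ≤ n := by exact_mod_cast k4
  refine ⟨⟨lt_of_le_of_lt ?_ h2, by linarith⟩, le_trans h3.le k3', le_trans h4.le k4'⟩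
  exact one_div_le_one_div_of_le (by positivity) (by linarith)

theorem ind_mono (E : ℕ → Set ℝ) (hE : Monotone E) (w : ℝ → ℝ≥0∞) (s : ℝ) :
    Monotone fun n => (E n).indicator w s := by
  intro i j hij
  exact indicator_le_indicator_of_subset (hE hij) (fun _ => zero_le) s

theorem ind_tend (E : ℕ → Set ℝ) (w : ℝ → ℝ≥0∞) (s : ℝ) (h : ∀ᶠ n in atTop, s ∈ E n) :
    Tendsto (fun n => (E n).indicator w s) atTop (nhds (w s)) := by
  refine tendsto_const_nhds.congr' ?_
  filter_upwards [h] with n hn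
  rw [indicator_of_mem hn]

theorem Phi_mono_w (m : ℝ) (w w2 : ℝ → ℝ≥0∞) (h : ∀ s, w s ≤ w2 s) (t : ℝ) :
    Phi m w t ≤ Phi m w2 t :=
  lintegral_mono fun s => mul_le_mul_left (h s) _

theorem Phi_tend (m : ℝ) (E : ℕ → Set ℝ) (hE : Monotone E) (hEm : ∀ n, MeasurableSet (E n))
    (hev : ∀ s, 0 < s → ∀ᶠ n in atTop, s ∈ E n) (w : ℝ → ℝ≥0∞) (hw : Measurable w) (t : ℝ) :
    Tendsto (fun n => Phi m ((E n).indicator w) t) atTop (nhds (Phi m w t)) := by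
  unfold Phi
  refine lintegral_tendsto_of_tendsto_of_monotone ?_ ?_ ?_
  · intro n
    have := hw.indicator (hEm n)
    fun_prop
  · refine Eventually.of_forall fun s i j hij => ?_
    exact mul_le_mul_left (ind_mono E hE w s hij) _
  · rw [ae_restrict_iff' measurableSet_Ioi]
    refine Eventually.of_forall fun s hs => ?_
    exact ENNReal.Tendsto.mul_const (ind_tend E w s (hev s hs)) (Or.inr ENNReal.ofReal_ne_top)

theorem lower2 (p q m r : ℝ) (hq : 1 < q) (hqp : q < p) (hm : m = p / (p - 1))
    (hr : r = p * q / (p - q)) : ∃ c : ℝ, 0 < c ∧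
    ∀ u σ : ℝ → ℝ≥0∞, Measurable u → Measurable σ →
      (∀ t, 0 < t → u t ≠ 0 ∧ u t ≠ ⊤) → (∀ t, 0 < t → σ t ≠ 0 ∧ σ t ≠ ⊤) → ∀ K : ℝ≥0∞,
      (∀ g : ℝ → ℝ≥0∞, Measurable g →
        (∫⁻ t in Ioi (0 : ℝ), Phi 1 (fun s => σ s * g s) t ^ q * u t) ^ (1 / q) ≤
          K * (∫⁻ s in Ioi (0 : ℝ), g s ^ p * σ s) ^ (1 / p)) →
      ENNReal.ofReal c * Aint p q m r u σ ^ (1 / q - 1 / p) ≤ K := by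
  obtain ⟨hm1, hr0, -⟩ := expo p q m r hq hqp hm hr
  have hq0 : 0 < q := by linarith
  have hp0 : 0 < p := by linarith
  have hm0 : 0 < m := by linarith
  obtain ⟨c, hc, H⟩ := lower p q m r hq hqp hm hr
  refine ⟨c, hc, fun u σ hu hσ hu0 hσ0 K hK => ?_⟩
  set E := trE u σ with hE
  have hEm : ∀ n, MeasurableSet (E n) := trE_meas u σ hu hσ
  have hEmono : Monotone E := trE_mono u σ
  have hev : ∀ s, 0 < s → ∀ᶠ n in atTop, s ∈ E n := fun s hs =>
    trE_ev u σ s hs (hu0 s hs).2 (hσ0 s hs).2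
  have hn : ∀ n, ENNReal.ofReal c *
      Aint p q m r ((E n).indicator u) ((E n).indicator σ) ^ (1 / q - 1 / p) ≤ K := by
    intro n
    refine H _ _ (hu.indicator (hEm n)) (hσ.indicator (hEm n)) K ?_ ?_
    · intro g hg
      have h := hK ((E n).indicator g) (hg.indicator (hEm n))
      have e1 : (fun s => σ s * (E n).indicator g s) = fun s => (E n).indicator σ s * g s := by
        funext s
        by_cases hs : s ∈ E n
        · simp [hs]
        · simp [hs]
      have e2 : (fun s => (E n).indicator g s ^ p * σ s) = fun s => g s ^ p * (E n).indicator σ s := by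
        funext s
        by_cases hs : s ∈ E n
        · simp [hs]
        · simp [hs, hp0]
      rw [e1, e2] at h
      refine le_trans (ENNReal.rpow_le_rpow (lintegral_mono fun t => ?_) (by positivity)) h
      exact mul_le_mul_right (indicator_le_self' (fun _ _ => zero_le) t) _
    · have key : ∀ w : ℝ → ℝ≥0∞, (∀ s ∈ E n, w s ≤ n) → ∀ s, (E n).indicator w s ≤
          (Ioo (1 / ((n : ℝ) + 1)) ((n : ℝ) + 1)).indicator (fun _ => (n : ℝ≥0∞)) s := by
        intro w hw s
        by_cases hs : s ∈ E n
        · rw [indicator_of_mem hs, indicator_of_mem hs.1]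
          exact hw s hs
        · rw [indicator_of_notMem hs]; exact zero_le
      exact Aint_fin p q m r hp0 hq0 hm0 hr0 _ _ (1 / ((n : ℝ) + 1)) ((n : ℝ) + 1) n
        (ENNReal.natCast_ne_top n) (by positivity) (key u fun s hs => hs.2.1)
        (key σ fun s hs => hs.2.2)
  have hlim : Tendsto (fun n => Aint p q m r ((E n).indicator u) ((E n).indicator σ)) atTop
      (nhds (Aint p q m r u σ)) := by
    unfold Aint
    refine lintegral_tendsto_of_tendsto_of_monotone ?_ ?_ ?_
    · intro n
      have h1 := hu.indicator (hEm n)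
      have h2 := Uf_measurable q _ h1
      have h3 := Phi_measurable m _ (hσ.indicator (hEm n))
      fun_prop
    · refine Eventually.of_forall fun t i j hij => ?_
      refine mul_le_mul' (ind_mono E hEmono u t hij) (mul_le_mul' ?_ ?_)
      · refine ENNReal.rpow_le_rpow ?_ (by positivity)
        exact mul_le_mul_right (Phi_mono_w q _ _ (fun s => ind_mono E hEmono u s hij) t) _
      · refine ENNReal.rpow_le_rpow ?_ (by positivity)
        exact Phi_mono_w m _ _ (fun s => ind_mono E hEmono σ s hij) t
    · rw [ae_restrict_iff' measurableSet_Ioi]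
      refine Eventually.of_forall fun t ht => ?_
      have ht' : 0 < t := ht
      have U0 : Uf q u t ^ (r / p) ≠ 0 := by
        rw [Ne, ENNReal.rpow_eq_zero_iff_of_pos (by positivity)]
        exact mul_ne_zero (by simpa using by positivity)
          (Phi_ne_zero q u hu (fun s hs => (hu0 s hs).1) t ht')
      have V0 : Phi m σ t ^ (r / m) ≠ 0 := by
        rw [Ne, ENNReal.rpow_eq_zero_iff_of_pos (by positivity)]
        exact (Phi_ne_zero m σ hσ (fun s hs => (hσ0 s hs).1) t ht')
      refine ENNReal.Tendsto.mul (ind_tend E u t (hev t ht')) (Or.inl (hu0 t ht').1) ?_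
        (Or.inr (hu0 t ht').2)
      refine ENNReal.Tendsto.mul ?_ (Or.inl U0) ?_ (Or.inl V0)
      · refine (ENNReal.continuous_rpow_const.tendsto _).comp ?_
        exact ENNReal.Tendsto.const_mul (Phi_tend q E hEmono hEm hev u hu t)
          (Or.inr ENNReal.ofReal_ne_top)
      · exact (ENNReal.continuous_rpow_const.tendsto _).comp (Phi_tend m E hEmono hEm hev σ hσ t)
  refine le_of_tendsto' (x := atTop) ?_ hn
  exact ENNReal.Tendsto.const_mul ((ENNReal.continuous_rpow_const.tendsto _).comp hlim)
    (Or.inr ENNReal.ofReal_ne_top)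

theorem upper2 (p q m r : ℝ) (hq : 1 < q) (hqp : q < p) (hm : m = p / (p - 1))
    (hr : r = p * q / (p - q)) : ∃ C : ℝ, 0 < C ∧
    ∀ u σ g : ℝ → ℝ≥0∞, Measurable u → Measurable σ → Measurable g →
      (∀ t, 0 < t → u t ≠ 0 ∧ u t ≠ ⊤) → (∀ t, 0 < t → σ t ≠ 0 ∧ σ t ≠ ⊤) →
      (∫⁻ t in Ioi (0 : ℝ), Phi 1 (fun s => σ s * g s) t ^ q * u t) ^ (1 / q) ≤
        ENNReal.ofReal C * Aint p q m r u σ ^ (1 / q - 1 / p) *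
          (∫⁻ s in Ioi (0 : ℝ), g s ^ p * σ s) ^ (1 / p) := by
  obtain ⟨hm1, hr0, -⟩ := expo p q m r hq hqp hm hr
  have hq0 : 0 < q := by linarith
  have hp0 : 0 < p := by linarith
  have hm0 : 0 < m := by linarith
  have hpq : 0 < p - q := by linarith
  have hd : 0 < 1 / q - 1 / p := by rw [sub_pos]; exact one_div_lt_one_div_of_lt hq0 hqp
  obtain ⟨C, hC, H⟩ := upper p q m r hq hqp hm hr
  refine ⟨C ^ (1 / q), by positivity, fun u σ g hu hσ hg hu0 hσ0 => ?_⟩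
  have hUm := Uf_measurable q u hu
  have hPm := Phi_measurable m σ hσ
  by_cases hA : Aint p q m r u σ = ⊤
  · by_cases hN : ∫⁻ s in Ioi (0 : ℝ), g s ^ p * σ s = 0
    · rw [lintegral_eq_zero_iff (by fun_prop)] at hN
      have hz : ∀ t, Phi 1 (fun s => σ s * g s) t = 0 := by
        intro t
        unfold Phi
        rw [lintegral_eq_zero_iff (by fun_prop)]
        filter_upwards [hN] with s hs
        have hs' : g s ^ p * σ s = 0 := hs
        show σ s * g s * _ = 0
        rcases mul_eq_zero.1 hs' with h | h
        · rw [ENNReal.rpow_eq_zero_iff_of_pos hp0] at h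
          simp [h]
        · simp [h]
      have : (∫⁻ t in Ioi (0 : ℝ), Phi 1 (fun s => σ s * g s) t ^ q * u t) = 0 := by
        simp [hz, ENNReal.zero_rpow_of_pos hq0]
      rw [this, ENNReal.zero_rpow_of_pos (by positivity)]
      exact zero_le
    · rw [hA, ENNReal.top_rpow_of_pos hd, ENNReal.mul_top (by simpa using by positivity),
        ENNReal.top_mul]
      · exact le_top
      · rw [Ne, ENNReal.rpow_eq_zero_iff_of_pos (by positivity)]
        exact hN
  · have hV : ∀ t, 0 < t → Phi m σ t ≠ 0 ∧ Phi m σ t ≠ ⊤ := by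
      have hae : ∀ᵐ t ∂(volume.restrict (Ioi (0 : ℝ))),
          u t * (Uf q u t ^ (r / p) * Phi m σ t ^ (r / m)) < ⊤ := by
        refine ae_lt_top (by fun_prop) hA
      have hpos : ∀ᵐ t ∂(volume.restrict (Ioi (0 : ℝ))), t ∈ Ioi (0 : ℝ) :=
        ae_restrict_mem measurableSet_Ioi
      have hne : (ae (volume.restrict (Ioi (0 : ℝ)))).NeBot := by
        rw [ae_neBot, Ne, Measure.restrict_eq_zero]
        simp
      obtain ⟨t0, h1, h2⟩ := (hae.and hpos).exists
      have h2' : 0 < t0 := h2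
      have U0 : Uf q u t0 ^ (r / p) ≠ 0 := by
        rw [Ne, ENNReal.rpow_eq_zero_iff_of_pos (by positivity)]
        exact mul_ne_zero (by simpa using by positivity)
          (Phi_ne_zero q u hu (fun s hs => (hu0 s hs).1) t0 h2')
      have hfin : Phi m σ t0 ≠ ⊤ := by
        intro h
        rw [h, ENNReal.top_rpow_of_pos (by positivity), ENNReal.mul_top U0,
          ENNReal.mul_top (hu0 t0 h2').1] at h1
        exact lt_irrefl _ h1
      intro t ht
      refine ⟨Phi_ne_zero m σ hσ (fun s hs => (hσ0 s hs).1) t ht, ?_⟩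
      exact ne_top_of_le_ne_top (ENNReal.mul_ne_top ENNReal.ofReal_ne_top hfin)
        (Phi_mono m hm0 σ t0 t h2' ht)
    have h := ENNReal.rpow_le_rpow (H u σ g hu hσ hg hV) (z := 1 / q) (by positivity)
    refine le_trans h (le_of_eq ?_)
    rw [ENNReal.mul_rpow_of_nonneg _ _ (by positivity), ENNReal.mul_rpow_of_nonneg _ _ (by positivity),
      ENNReal.ofReal_rpow_of_pos hC, ← ENNReal.rpow_mul, ← ENNReal.rpow_mul, mul_assoc]
    have c1 : q / r * (1 / q) = 1 / q - 1 / p := by rw [hr]; field_simp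
    have c2 : q / p * (1 / q) = 1 / p := by field_simp
    rw [c1, c2]

theorem Sop_eq (f : ℝ → ℝ≥0∞) (t : ℝ) (ht : 0 < t) : Sop f t = Phi 1 f t := by
  unfold Sop Phi
  refine setLIntegral_congr_fun measurableSet_Ioi fun s hs => ?_
  have hs' : 0 < s := hs
  rw [Real.rpow_neg_one, ENNReal.ofReal_inv_of_pos (by positivity), div_eq_mul_inv]

theorem const_eq (p q : ℝ) (hq : 1 < q) (hqp : q < p) (u v : ℝ → ℝ≥0∞) (hu : Measurable u) :
    StieltjesConstQP p q u v = Aint p q (p / (p - 1)) (p * q / (p - q)) u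
      (fun s => v s ^ (1 - p / (p - 1))) ^ (1 / q - 1 / p) := by
  obtain ⟨hm1, hr0, -⟩ := expo p q (p / (p - 1)) (p * q / (p - q)) hq hqp rfl rfl
  unfold StieltjesConstQP Aint
  congr 1
  refine setLIntegral_congr_fun measurableSet_Ioi fun t ht => ?_
  have ht' : 0 < t := ht
  have e : (∫⁻ s in Ioi (0 : ℝ), ENNReal.ofReal ((t / (s + t)) ^ q) * u s) = Uf q u t := by
    unfold Uf Phi
    rw [← lintegral_const_mul _ (by fun_prop)]
    refine setLIntegral_congr_fun measurableSet_Ioi fun s hs => ?_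
    have hs' : 0 < s := hs
    rw [Real.div_rpow ht'.le (by positivity), div_eq_mul_inv, ← Real.rpow_neg (by positivity),
      ENNReal.ofReal_mul (by positivity)]
    ring
  have e2 : (∫⁻ s in Ioi (0 : ℝ), (v s) ^ (1 - p / (p - 1)) *
          ENNReal.ofReal ((s + t) ^ (-(p / (p - 1))))) =
      Phi (p / (p - 1)) (fun s => v s ^ (1 - p / (p - 1))) t := rfl
  rw [e, e2, ENNReal.mul_rpow_of_nonneg _ _ hr0.le, ← ENNReal.rpow_mul, ← ENNReal.rpow_mul,
    one_div_mul_eq_div, one_div_mul_eq_div, mul_comm (u t)]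

theorem statement7 (p q : ℝ) (hq : 1 < q) (hqp : q < p) :
    ∃ c C : ℝ, 0 < c ∧ 0 < C ∧
      ∀ u v : ℝ → ℝ≥0∞, IsWeight ⊤ u → IsWeight ⊤ v →
        (∀ f : ℝ → ℝ≥0∞, Measurable f →
            (∫⁻ t in Ioi (0 : ℝ), (Sop f t) ^ q * u t) ^ (1 / q) ≤
              ENNReal.ofReal C * StieltjesConstQP p q u v *
                (∫⁻ t in Ioi (0 : ℝ), f t ^ p * v t) ^ (1 / p)) ∧
        ∀ K : ℝ≥0∞, (∀ f : ℝ → ℝ≥0∞, Measurable f →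
            (∫⁻ t in Ioi (0 : ℝ), (Sop f t) ^ q * u t) ^ (1 / q) ≤
              K * (∫⁻ t in Ioi (0 : ℝ), f t ^ p * v t) ^ (1 / p)) →
          ENNReal.ofReal c * StieltjesConstQP p q u v ≤ K := by
  obtain ⟨c, hc, HL⟩ := lower2 p q (p / (p - 1)) (p * q / (p - q)) hq hqp rfl rfl
  obtain ⟨C, hC, HU⟩ := upper2 p q (p / (p - 1)) (p * q / (p - q)) hq hqp rfl rfl
  refine ⟨c, C, hc, hC, fun u v hu hv => ?_⟩
  have hp0 : 0 < p := by linarith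
  have hp1 : 0 < p - 1 := by linarith
  have hum := hu.1
  have hvm := hv.1
  have hu0 : ∀ t, 0 < t → u t ≠ 0 ∧ u t ≠ ⊤ := fun t ht =>
    ⟨(hu.2.1 t ⟨ht, ENNReal.ofReal_lt_top⟩).1.ne', (hu.2.1 t ⟨ht, ENNReal.ofReal_lt_top⟩).2.ne⟩
  have hv0 : ∀ t, 0 < t → v t ≠ 0 ∧ v t ≠ ⊤ := fun t ht =>
    ⟨(hv.2.1 t ⟨ht, ENNReal.ofReal_lt_top⟩).1.ne', (hv.2.1 t ⟨ht, ENNReal.ofReal_lt_top⟩).2.ne⟩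
  rw [const_eq p q hq hqp u v hum]
  set σ : ℝ → ℝ≥0∞ := fun s => v s ^ (1 - p / (p - 1)) with hσ
  have hσm : Measurable σ := by fun_prop
  have hσ0 : ∀ t, 0 < t → σ t ≠ 0 ∧ σ t ≠ ⊤ := by
    intro t ht
    obtain ⟨h1, h2⟩ := hv0 t ht
    exact ⟨(ENNReal.rpow_pos (pos_iff_ne_zero.2 h1) h2).ne', ENNReal.rpow_ne_top_of_ne_zero h1 h2⟩
  have hσv : ∀ t, 0 < t → σ t ^ p * v t = σ t := by
    intro t ht
    obtain ⟨h1, h2⟩ := hv0 t ht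
    simp only [hσ]
    rw [← ENNReal.rpow_mul]
    nth_rw 2 [← ENNReal.rpow_one (v t)]
    rw [← ENNReal.rpow_add _ _ h1 h2]
    congr 1
    field_simp
    ring
  have hS : ∀ f : ℝ → ℝ≥0∞, ∫⁻ t in Ioi (0 : ℝ), (Sop f t) ^ q * u t =
      ∫⁻ t in Ioi (0 : ℝ), (Phi 1 f t) ^ q * u t := by
    intro f
    refine setLIntegral_congr_fun measurableSet_Ioi fun t ht => ?_
    simp only [Sop_eq f t ht]
  have hNorm : ∀ g : ℝ → ℝ≥0∞, ∫⁻ t in Ioi (0 : ℝ), (σ t * g t) ^ p * v t =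
      ∫⁻ t in Ioi (0 : ℝ), g t ^ p * σ t := by
    intro g
    refine setLIntegral_congr_fun measurableSet_Ioi fun t ht => ?_
    rw [ENNReal.mul_rpow_of_nonneg _ _ hp0.le]
    nth_rw 2 [← hσv t ht]
    ring
  constructor
  · intro f hf
    have hfg : ∀ s, 0 < s → σ s * (f s / σ s) = f s := fun s hs =>
      ENNReal.mul_div_cancel (hσ0 s hs).1 (hσ0 s hs).2
    have h := HU u σ (fun s => f s / σ s) hum hσm (by fun_prop) hu0 hσ0
    rw [← hNorm] at h
    have e1 : ∫⁻ t in Ioi (0 : ℝ), (σ t * (f t / σ t)) ^ p * v t =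
        ∫⁻ t in Ioi (0 : ℝ), f t ^ p * v t := by
      refine setLIntegral_congr_fun measurableSet_Ioi fun t ht => ?_
      simp only [hfg t ht]
    have e2 : Phi 1 (fun s => σ s * (f s / σ s)) = Phi 1 f :=
      funext fun t => Phi_congr 1 _ _ hfg t
    rw [e1, e2] at h
    rw [hS]
    exact h
  · intro K hK
    refine HL u σ hum hσm hu0 hσ0 K fun g hg => ?_
    have h := hK (fun s => σ s * g s) (by fun_prop)
    rw [hS, hNorm] at h
    exact h

end
end
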